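/- One has the commutation relation (B_∞^{(α)}(−t,q,u) + B_∞^{(α)}(−t,r,u)) · 𝒢^{(α)}(t,p,q,r) = 𝒢^{(α)}(t,p,q,r) · B_∞^{(α)}(−t,p,u), as an identity between linear operators from ℚ(α)[p] to ℚ(α)[q,r]⟦t,u⟧. -/

import Mathlib

open scoped Classical

noncomputable section

/-- The base field `ℚ(α)` of rational functions in the Jack parameter `α`. -/
abbrev F : Type := RatFunc ℚ

/-- The Jack deformation parameter `α`. -/
def alpha : F := RatFunc.X

/-- An integer partition, encoded as a multiset of positive integers (its parts). -/
abbrev JPartition : Type := Multiset ℕ+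

/-- The size `|λ|` of a partition. -/
def psize (l : JPartition) : ℕ := (l.map fun i => (i : ℕ)).sum

/-- The length `ℓ(λ)` of a partition. -/
def plen (l : JPartition) : ℕ := Multiset.card l

/-- `m_i(λ)`, the number of parts of `λ` equal to `i`. -/
def pmult (l : JPartition) (i : ℕ+) : ℕ := Multiset.count i l

/-- `λ ∪ 1^k`, adjoining `k` parts equal to `1`. -/
def addOnes (l : JPartition) (k : ℕ) : JPartition := l + Multiset.replicate k 1

/-- `λ̃`, the partition obtained by deleting all parts equal to `1`. -/
def removeOnes (l : JPartition) : JPartition := Multiset.filter (fun i => i ≠ 1) l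

/-- Exponent vectors of monomials in the power-sum generators `p₁, p₂, …`. -/
abbrev Exp : Type := ℕ+ →₀ ℕ

/-- The exponent vector of the monomial `p_λ`. -/
def toExp (l : JPartition) : Exp := l.toFinset.sum fun i => Finsupp.single i (Multiset.count i l)

/-- The partition corresponding to an exponent vector. -/
def toPart (m : Exp) : JPartition := m.sum fun i k => Multiset.replicate k i

/-- The weighted degree (`deg p_i = i`) of an exponent vector; this is the size of the
corresponding partition. -/
def wt (m : Exp) : ℕ := m.sum fun i k => k * (i : ℕ)

/-- The algebra `ℚ(α)[p₁, p₂, …]` of symmetric functions written in the power-sum basis. -/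
abbrev SymA : Type := MvPolynomial ℕ+ F

/-- The power-sum monomial `p_λ`. -/
def pPow (l : JPartition) : SymA := (l.map fun i => MvPolynomial.X i).prod

/-- `z_λ α^{ℓ(λ)}`, attached to the exponent vector of `p_λ`. -/
def zalpha (m : Exp) : F :=
  algebraMap ℚ F (m.prod fun i k => (Nat.factorial k : ℚ) * ((i : ℕ) : ℚ) ^ k) *
    alpha ^ (m.sum fun _ k => k)

/-- The `α`-deformed Hall scalar product: `⟨p_λ, p_μ⟩ = δ_{λμ} z_λ α^{ℓ(λ)}`. -/
def hall (f g : SymA) : F :=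
  ∑ m ∈ f.support, MvPolynomial.coeff m f * MvPolynomial.coeff m g * zalpha m

/-- The parts of a partition, sorted in weakly decreasing order. -/
def sortedParts (l : JPartition) : List ℕ := ((l.map fun i => (i : ℕ)).sort (· ≤ ·)).reverse

/-- The sum of the `k` largest parts of a partition. -/
def topSum (l : JPartition) (k : ℕ) : ℕ := ((sortedParts l).take k).sum

/-- The dominance order on partitions: `μ ⊴ λ`. -/
def dominates (mu lam : JPartition) : Prop :=
  psize mu = psize lam ∧ ∀ k, topSum mu k ≤ topSum lam k

/-- Evaluation of a symmetric function (in power-sum coordinates) in `N` variables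
`x₁, …, x_N`: it sends `p_i ↦ x₁^i + ⋯ + x_N^i`. -/
def evalN (N : ℕ) : SymA →ₐ[F] MvPolynomial (Fin N) F :=
  MvPolynomial.aeval fun i : ℕ+ => ∑ j : Fin N, MvPolynomial.X j ^ (i : ℕ)

/-- The exponent of the monomial `x₁^{μ₁} ⋯ x_s^{μ_s}` in `N` variables, for `μ` a
partition; its coefficient in a symmetric polynomial is the coefficient of the monomial
symmetric function `m_μ` (provided `N ≥ ℓ(μ)`). -/
def xexp (mu : JPartition) (N : ℕ) : Fin N →₀ ℕ :=
  Finsupp.equivFunOnFinite.symm fun j => (sortedParts mu).getD (j : ℕ) 0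

/-- The defining properties of the family of Jack polynomials `J_λ^{(α)}` (Macdonald's
characterization): orthogonality for the `α`-deformed Hall product, triangularity with
respect to monomial symmetric functions in dominance order, and normalization
`[p_{1^n}] J_λ^{(α)} = 1`. -/
structure IsJackFamily (J : JPartition → SymA) : Prop where
  orthogonal : ∀ l m : JPartition, l ≠ m → hall (J l) (J m) = 0
  triangular : ∀ l m : JPartition, ¬ dominates m l →
    MvPolynomial.coeff (xexp m (psize l + psize m + plen m))
      (evalN (psize l + psize m + plen m) (J l)) = 0
  normalized : ∀ l : JPartition, MvPolynomial.coeff (Finsupp.single 1 (psize l)) (J l) = 1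

/-- The Jack character `θ_μ^{(α)}(λ)`. -/
def theta (J : JPartition → SymA) (mu lam : JPartition) : F :=
  if psize lam < psize mu then 0
  else (Nat.choose (psize lam - psize mu + pmult mu 1) (pmult mu 1) : F) *
    MvPolynomial.coeff (toExp (addOnes mu (psize lam - psize mu))) (J lam)

/-- `g` is the family of structure coefficients of Jack characters:
`θ_μ^{(α)} θ_ν^{(α)} = ∑_π g^π_{μ,ν}(α) θ_π^{(α)}` (as functions on Young diagrams,
with finitely many nonzero terms). -/
def IsStructCoeffs (J : JPartition → SymA) (g : JPartition → JPartition → JPartition → F) :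
    Prop :=
  (∀ mu nu : JPartition, {pi : JPartition | g pi mu nu ≠ 0}.Finite) ∧
  ∀ mu nu lam : JPartition,
    theta J mu lam * theta J nu lam = ∑ᶠ pi : JPartition, g pi mu nu * theta J pi lam


/-- The polynomial algebra `ℚ(α)[p₁,p₂,…][y₀,y₁,…]` containing the catalytic variables. -/
abbrev PY : Type := MvPolynomial (ℕ+ ⊕ ℕ) F

/-- The variable `p_i` inside `PY`. -/
def pv (i : ℕ+) : PY := MvPolynomial.X (Sum.inl i)

/-- The catalytic variable `y_j` inside `PY`. -/
def yv (j : ℕ) : PY := MvPolynomial.X (Sum.inr j)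

/-- The operator `Y₊ = ∑_{i≥0} y_{i+1} ∂/∂y_i`. -/
def Yplus (f : PY) : PY := ∑ᶠ j : ℕ, yv (j + 1) * MvPolynomial.pderiv (Sum.inr j) f

/-- The operator
`Γ_Y = (1+b) ∑_{i,j≥1} y_{i+j} j ∂²/(∂y_{i-1}∂p_j) + ∑_{i,j≥1} y_i p_j ∂/∂y_{i+j-1}
      + b ∑_{i≥1} y_{i+1} i ∂/∂y_i`, with `b = α - 1`. -/
def GammaY (f : PY) : PY :=
  alpha • (∑ᶠ i : ℕ+, ∑ᶠ j : ℕ+, ((j : ℕ) : F) •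
      (yv ((i : ℕ) + (j : ℕ)) *
        MvPolynomial.pderiv (Sum.inl j) (MvPolynomial.pderiv (Sum.inr ((i : ℕ) - 1)) f)))
  + (∑ᶠ i : ℕ+, ∑ᶠ j : ℕ+,
      yv (i : ℕ) * pv j * MvPolynomial.pderiv (Sum.inr ((i : ℕ) + (j : ℕ) - 1)) f)
  + (alpha - 1) • (∑ᶠ i : ℕ+, ((i : ℕ) : F) •
      (yv ((i : ℕ) + 1) * MvPolynomial.pderiv (Sum.inr (i : ℕ)) f))

/-- The operator `Θ_Y = ∑_{i≥1} p_i ∂/∂y_i`. -/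
def ThetaY (f : PY) : PY := ∑ᶠ i : ℕ+, pv i * MvPolynomial.pderiv (Sum.inr (i : ℕ)) f

/-- Ordered composite of the operators `Y₊` (for `true`) and `Γ_Y` (for `false`). -/
def wordOp : List Bool → PY → PY
  | [], f => f
  | b :: w, f => (if b then Yplus else GammaY) (wordOp w f)

/-- Projection `PY → SymA` killing the catalytic variables. -/
def dropY : PY →ₐ[F] SymA :=
  MvPolynomial.aeval fun v => match v with
    | Sum.inl i => MvPolynomial.X i
    | Sum.inr _ => 0

/-- `Bc n ℓ` is the coefficient of `u^ℓ` in the operator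
`B_n^{(α)}(p, u) = Θ_Y (Γ_Y + u Y₊)^n (y₀ / (1+b))`, viewed as an operator on `ℚ(α)[p]`. -/
def Bc (n ℓ : ℕ) (f : SymA) : SymA :=
  dropY (ThetaY (∑ s ∈ Finset.univ.filter
      (fun s : Fin n → Bool => (Finset.univ.filter fun i => s i = true).card = ℓ),
    wordOp (List.ofFn s) (alpha⁻¹ • (yv 0 * MvPolynomial.rename Sum.inl f))))

/-- Matrix entries of `Bc n ℓ` in the basis of power-sum monomials. -/
def Bmat (n ℓ : ℕ) (m m' : Exp) : F :=
  MvPolynomial.coeff m (Bc n ℓ (MvPolynomial.monomial m' 1))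

/-- The adjoint of `Bc n ℓ` with respect to the `α`-deformed Hall scalar product
(`⟨Bperp f, g⟩ = ⟨f, Bc g⟩`), given by its matrix in the power-sum basis. -/
def Bperp (n ℓ : ℕ) (f : SymA) : SymA :=
  ∑ m' ∈ f.support, MvPolynomial.coeff m' f •
    ∑ᶠ m : Exp, (Bmat n ℓ m' m * zalpha m' / zalpha m) • (MvPolynomial.monomial m (1 : F))



/-- The coefficient of `q_μ r_ν t^k` in `𝒢^{(α)}(t,p,q,r) ⬝ f`, where
`𝒢^{(α)}(t,p,q,r) : ℚ(α)[p] → ℚ(α)[q,r]⟦t⟧` is the linear operator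
`p_π ↦ ∑_{μ,ν} t^{|μ|+|ν|-|π|} g^π_{μ,ν}(α) q_μ r_ν`. -/
def GopCoef (g : JPartition → JPartition → JPartition → F) (f : SymA)
    (mu nu : JPartition) (k : ℕ) : F :=
  ∑ᶠ pi : JPartition, if psize pi + k = psize mu + psize nu
    then g pi mu nu * MvPolynomial.coeff (toExp pi) f else 0


set_option linter.all false

namespace JP
open MvPolynomial

variable {K : Type*} [Field K] [CharZero K]

/-- Symmetric functions in power-sum coordinates over `K`. -/
abbrev SA (K : Type*) [Field K] := MvPolynomial ℕ+ K
abbrev VV (K : Type*) [Field K] := Polynomial (SA K)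

/-- The derivation `p_j ↦ α j X^j`. -/
def dl (α : K) : Derivation K (SA K) (VV K) :=
  mkDerivation K fun j : ℕ+ => (α * (j : ℕ)) • (Polynomial.X ^ (j : ℕ) : VV K)

theorem dl_X (α : K) (j : ℕ+) :
    dl α (X j) = (α * (j : ℕ)) • (Polynomial.X ^ (j : ℕ) : VV K) := by
  simp [dl]

theorem dl_coeff_zero (α : K) (f : SA K) : (dl α f).coeff 0 = 0 := by
  have : (Polynomial.lcoeff (SA K) 0).compDer (dl α) = 0 := by
    apply MvPolynomial.derivation_ext
    intro i
    simp [dl_X, Polynomial.coeff_X_pow, i.ne_zero.symm]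
  exact congrArg (fun D => D f) this

theorem dl_coeff (α : K) (f : SA K) (j : ℕ+) :
    (dl α f).coeff (j : ℕ) = (α * (j : ℕ)) • pderiv j f := by
  have : (Polynomial.lcoeff (SA K) (j : ℕ)).compDer (dl α) = (α * (j : ℕ)) • pderiv j := by
    apply MvPolynomial.derivation_ext
    intro i
    by_cases h : i = j
    · subst h; simp [dl_X]
    · have h' : ¬ (j : ℕ) = i := fun e => h (PNat.coe_injective e).symm
      have h2 : ¬ j = i := fun e => h e.symm
      simp [dl_X, Polynomial.coeff_X_pow, pderiv_X, h, h2]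
  exact congrArg (fun D => D f) this

/-- The operator `𝓛`, on `f X^i`. -/
def LopAux (α : K) (i : ℕ) : SA K →ₗ[K] VV K where
  toFun f := Polynomial.X ^ i * dl α f
    + ∑ j ∈ Finset.range i, Polynomial.monomial (i - 1 - j) (X (Nat.succPNat j) * f)
    + Polynomial.monomial i (((α - 1) * (i : K)) • f)
  map_add' f g := by
    simp only [map_add, mul_add, smul_add, Finset.sum_add_distrib]; abel
  map_smul' c f := by
    rw [Derivation.map_smul]
    simp only [mul_smul_comm, smul_add, Finset.smul_sum, RingHom.id_apply,
      smul_comm c ((α - 1) * (i : K)), ← Polynomial.smul_monomial]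

def Lop (α : K) : VV K →ₗ[K] VV K := Polynomial.lsum (LopAux α)

theorem Lop_monomial (α : K) (i : ℕ) (f : SA K) :
    Lop α (Polynomial.monomial i f) = Polynomial.X ^ i * dl α f
    + ∑ j ∈ Finset.range i, Polynomial.monomial (i - 1 - j) (X (Nat.succPNat j) * f)
    + Polynomial.monomial i (((α - 1) * (i : K)) • f) := by
  simp [Lop, LopAux]

theorem Lop_coeff_self (α : K) (i : ℕ) (f : SA K) :
    (Lop α (Polynomial.monomial i f)).coeff i = ((α - 1) * (i : K)) • f := by
  rw [Lop_monomial]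
  simp only [Polynomial.coeff_add, Polynomial.finsetSum_coeff, Polynomial.coeff_X_pow_mul',
    Polynomial.coeff_monomial]
  rw [Finset.sum_eq_zero]
  · simp [dl_coeff_zero]
  · intro j hj
    rw [if_neg]
    have := Finset.mem_range.1 hj
    omega

theorem Lop_coeff_gt (α : K) (i : ℕ) (j : ℕ+) (f : SA K) :
    (Lop α (Polynomial.monomial i f)).coeff (i + j) = (α * (j : ℕ)) • pderiv j f := by
  have hj := j.pos
  rw [Lop_monomial]
  simp only [Polynomial.coeff_add, Polynomial.finsetSum_coeff, Polynomial.coeff_X_pow_mul',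
    Polynomial.coeff_monomial]
  rw [Finset.sum_eq_zero]
  · simp [dl_coeff]
  · intro k hk
    rw [if_neg]
    have := Finset.mem_range.1 hk
    omega

theorem Lop_coeff_lt (α : K) (i : ℕ) (j : ℕ+) (f : SA K) :
    (Lop α (Polynomial.monomial (i + j) f)).coeff i = X j * f := by
  have hj := j.pos
  rw [Lop_monomial]
  simp only [Polynomial.coeff_add, Polynomial.finsetSum_coeff, Polynomial.coeff_X_pow_mul',
    Polynomial.coeff_monomial]
  rw [Finset.sum_eq_single ((j : ℕ) - 1)]
  · have h1 : i + (j : ℕ) - 1 - ((j : ℕ) - 1) = i := by omega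
    have h2 : Nat.succPNat ((j : ℕ) - 1) = j := by
      apply PNat.coe_injective; simp; omega
    simp [h1, h2]
  · intro k hk hne
    rw [if_neg]
    have := Finset.mem_range.1 hk
    omega
  · intro h
    exfalso; apply h; rw [Finset.mem_range]; omega

/-- division by `X`, as a linear map -/
def dvX : VV K →ₗ[K] VV K where
  toFun := Polynomial.divX
  map_add' _ _ := Polynomial.divX_add
  map_smul' c p := by ext1 n; simp [Polynomial.coeff_divX]

def mX : VV K →ₗ[K] VV K := LinearMap.mulLeft K Polynomial.X

def Cl : SA K →ₗ[K] VV K where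
  toFun := Polynomial.C
  map_add' := by simp
  map_smul' c f := by simp [Polynomial.smul_C]

def c0 : VV K →ₗ[K] SA K where
  toFun v := v.coeff 0
  map_add' := by simp
  map_smul' c f := by simp

/-- `Θ (f X^i) = p_i f`. -/
def Th : VV K →ₗ[K] SA K := Polynomial.lsum fun i =>
  if h : 0 < i then LinearMap.mulLeft K (X (⟨i, h⟩ : ℕ+)) else 0

theorem Th_monomial (i : ℕ+) (f : SA K) : Th (Polynomial.monomial (i : ℕ) f) = X i * f := by
  have : (⟨(i : ℕ), i.2⟩ : ℕ+) = i := rfl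
  simp [Th, this]

theorem Th_monomial_zero (f : SA K) : Th (Polynomial.monomial 0 f) = 0 := by
  simp [Th]

/-! The scalar product -/

def zg (α : K) (m : ℕ+ →₀ ℕ) : K :=
  (m.prod fun i k => (Nat.factorial k : K) * ((i : ℕ) : K) ^ k) * α ^ (m.sum fun _ k => k)

theorem zg_ne_zero {α : K} (hα : α ≠ 0) (m : ℕ+ →₀ ℕ) : zg α m ≠ 0 := by
  refine mul_ne_zero ?_ (pow_ne_zero _ hα)
  rw [Finsupp.prod, Finset.prod_ne_zero_iff]
  intro i _
  refine mul_ne_zero (by exact_mod_cast Nat.factorial_ne_zero _) (pow_ne_zero _ ?_)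
  exact_mod_cast i.ne_zero

theorem zg_zero (α : K) : zg α 0 = 1 := by simp [zg]

theorem zg_add (α : K) (m : ℕ+ →₀ ℕ) (j : ℕ+) :
    zg α (m + Finsupp.single j 1) = zg α m * (α * (j : ℕ) * (m j + 1)) := by
  unfold zg
  have h1 : ((m + Finsupp.single j 1).sum fun _ k => k) = (m.sum fun _ k => k) + 1 := by
    rw [Finsupp.sum_add_index' (by simp) (by simp)]; simp
  have hs : ∀ m' : ℕ+ →₀ ℕ, m'.support ⊆ insert j m.support →
      (m'.prod fun i k => (Nat.factorial k : K) * ((i : ℕ) : K) ^ k)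
      = ∏ i ∈ insert j m.support, (Nat.factorial (m' i) : K) * ((i : ℕ) : K) ^ (m' i) := by
    intro m' h
    exact Finsupp.prod_of_support_subset _ h _ (by simp)
  rw [h1, hs m (Finset.subset_insert _ _), hs (m + Finsupp.single j 1)]
  · rw [← Finset.mul_prod_erase _ _ (Finset.mem_insert_self j m.support),
      ← Finset.mul_prod_erase _ _ (Finset.mem_insert_self j m.support)]
    have : ∀ i ∈ (insert j m.support).erase j,
        (Nat.factorial ((m + Finsupp.single j 1 : ℕ+ →₀ ℕ) i) : K) *
          ((i : ℕ) : K) ^ ((m + Finsupp.single j 1 : ℕ+ →₀ ℕ) i)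
        = (Nat.factorial (m i) : K) * ((i : ℕ) : K) ^ (m i) := by
      intro i hi
      have : i ≠ j := Finset.ne_of_mem_erase hi
      simp [Finsupp.single_apply, this.symm]
    rw [Finset.prod_congr rfl this]
    simp [Nat.factorial_succ]
    ring
  · intro i hi
    rw [Finset.mem_insert]
    by_cases h : i = j
    · exact Or.inl h
    · right
      simpa [Finsupp.single_apply, h, Ne.symm h] using hi

/-- the bilinear form -/
def hb (α : K) : SA K →ₗ[K] SA K →ₗ[K] K :=
  (basisMonomials ℕ+ K).constr K fun m => zg α m • MvPolynomial.lcoeff K m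

theorem hb_monomial (α : K) (m : ℕ+ →₀ ℕ) (c : K) (g : SA K) :
    hb α (monomial m c) g = c * zg α m * coeff m g := by
  have : (monomial m c : SA K) = c • basisMonomials ℕ+ K m := by
    simp [smul_monomial]
  rw [this, map_smul, hb, Module.Basis.constr_basis]
  simp [mul_assoc, lcoeff]

theorem hb_eq_sum (α : K) (f g : SA K) :
    hb α f g = ∑ m ∈ f.support, coeff m f * coeff m g * zg α m := by
  conv_lhs => rw [f.as_sum]
  rw [map_sum, LinearMap.sum_apply]
  refine Finset.sum_congr rfl fun m _ => ?_
  rw [hb_monomial]; ring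

/-- linear maps agreeing on monomials agree -/
theorem lin_ext {M : Type*} [AddCommMonoid M] [Module K M] {a b : SA K →ₗ[K] M}
    (h : ∀ m, a (monomial m 1) = b (monomial m 1)) : a = b := by
  apply (basisMonomials ℕ+ K).ext
  intro m; simpa using h m

theorem hb_monomial_right (α : K) (m : ℕ+ →₀ ℕ) (c : K) (f : SA K) :
    hb α f (monomial m c) = c * zg α m * coeff m f := by
  have : (hb α).flip (monomial m c) = (c * zg α m) • lcoeff K m := by
    apply lin_ext
    intro m'
    simp only [LinearMap.flip_apply, hb_monomial, coeff_monomial, LinearMap.smul_apply, lcoeff,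
      LinearMap.coe_mk, AddHom.coe_mk, smul_eq_mul]
    by_cases h : m = m'
    · subst h; simp; ring
    · simp [h, Ne.symm h]
  simpa using congrArg (fun D => D f) this

theorem hb_symm (α : K) (f g : SA K) : hb α f g = hb α g f := by
  have : hb α f = (hb α).flip f := by
    apply lin_ext
    intro m
    simp [hb_monomial, hb_monomial_right]
  exact congrArg (fun D => D g) this

theorem hb_X_mul (α : K) (j : ℕ+) (f g : SA K) :
    hb α (X j * f) g = hb α f ((α * (j : ℕ)) • pderiv j g) := by
  have : ((hb α).flip g).comp (LinearMap.mulLeft K (X j)) =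
      (hb α).flip ((α * (j : ℕ)) • pderiv j g) := by
    apply lin_ext
    intro m
    have : (X j * monomial m 1 : SA K) = monomial (m + Finsupp.single j 1) 1 := by
      rw [X, monomial_mul, add_comm]; simp
    simp only [LinearMap.comp_apply, LinearMap.mulLeft_apply, LinearMap.flip_apply, this,
      hb_monomial, zg_add, coeff_smul, smul_eq_mul, coeff_pderiv]
    ring
  exact congrArg (fun D => D f) this

theorem hb_mul_X (α : K) (j : ℕ+) (f g : SA K) :
    hb α f (X j * g) = hb α ((α * (j : ℕ)) • pderiv j f) g := by
  rw [hb_symm, hb_X_mul, hb_symm]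

theorem hb_nondeg {α : K} (hα : α ≠ 0) {f : SA K} (h : ∀ g, hb α f g = 0) : f = 0 := by
  ext m
  have := h (monomial m 1)
  rw [hb_monomial_right] at this
  simpa [zg_ne_zero hα] using this

/-- bilinear form on `VV` -/
def hV (α : K) : VV K →ₗ[K] VV K →ₗ[K] K :=
  Polynomial.lsum fun i => (LinearMap.lcomp K K ((Polynomial.lcoeff (SA K) i).restrictScalars K)).comp (hb α)

theorem hV_monomial (α : K) (i : ℕ) (f : SA K) (w : VV K) :
    hV α (Polynomial.monomial i f) w = hb α f (w.coeff i) := by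
  simp [hV]

theorem linV_ext {M : Type*} [AddCommMonoid M] [Module K M] {a b : VV K →ₗ[K] M}
    (h : ∀ i f, a (Polynomial.monomial i f) = b (Polynomial.monomial i f)) : a = b := by
  apply LinearMap.ext
  intro v
  induction v using Polynomial.induction_on' with
  | add p q hp hq => simp [hp, hq]
  | monomial n a => exact h n a

theorem hV_monomial_right (α : K) (i : ℕ) (g : SA K) (w : VV K) :
    hV α w (Polynomial.monomial i g) = hb α (w.coeff i) g := by
  have : (hV α).flip (Polynomial.monomial i g) = ((hb α).flip g).comp
      ((Polynomial.lcoeff (SA K) i).restrictScalars K) := by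
    apply linV_ext
    intro k f
    simp [hV_monomial, Polynomial.coeff_monomial]
    by_cases h : i = k
    · simp [h]
    · simp [h, Ne.symm h]
  exact congrArg (fun D => D w) this

theorem hV_Lop (α : K) (v w : VV K) : hV α (Lop α v) w = hV α v (Lop α w) := by
  have : (hV α).comp (Lop α) = ((LinearMap.lcomp K K (Lop α))).comp (hV α) := by
    apply linV_ext
    intro i f
    apply linV_ext
    intro k g
    simp only [LinearMap.comp_apply, LinearMap.lcomp_apply, hV_monomial_right, hV_monomial]
    rcases lt_trichotomy i k with h | h | h
    · obtain ⟨j, rfl⟩ : ∃ j : ℕ+, k = i + j := ⟨⟨k - i, by omega⟩, by simp; omega⟩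
      rw [Lop_coeff_gt, Lop_coeff_lt, hb_mul_X]
    · subst h
      rw [Lop_coeff_self, Lop_coeff_self]; simp
    · obtain ⟨j, rfl⟩ : ∃ j : ℕ+, i = k + j := ⟨⟨i - k, by omega⟩, by simp; omega⟩
      rw [Lop_coeff_gt, Lop_coeff_lt, hb_X_mul]
  exact congrArg (fun D => D v w) this

theorem hV_mX (α : K) (v w : VV K) : hV α (mX v) w = hV α v (dvX w) := by
  have : (hV α).comp (mX) = ((LinearMap.lcomp K K dvX)).comp (hV α) := by
    apply linV_ext
    intro i f
    ext w
    simp [mX, dvX, Polynomial.X_mul_monomial, hV_monomial, Polynomial.coeff_divX]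
  exact congrArg (fun D => D v w) this

theorem hV_Cl (α : K) (f : SA K) (w : VV K) : hV α (Cl f) w = hb α f (c0 w) := by
  have : (Cl f : VV K) = Polynomial.monomial 0 f := rfl
  rw [this, hV_monomial]; rfl

theorem hb_Th (α : K) (v : VV K) (g : SA K) : hb α (Th v) g = hV α v (dl α g) := by
  have : ((hb α).flip g).comp Th = (hV α).flip (dl α g) := by
    apply linV_ext
    intro i f
    rcases Nat.eq_zero_or_pos i with h | h
    · subst h
      simp only [LinearMap.comp_apply, Th_monomial_zero, LinearMap.flip_apply, hV_monomial,
        dl_coeff_zero, map_zero]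
    · obtain ⟨j, rfl⟩ : ∃ j : ℕ+, i = j := ⟨⟨i, h⟩, rfl⟩
      simp only [LinearMap.comp_apply, Th_monomial, LinearMap.flip_apply, hV_monomial, dl_coeff,
        hb_X_mul]
  exact congrArg (fun D => D v) this

end JP

namespace JP
open MvPolynomial

section cf
variable {R : Type*} [Ring R]
/-- coefficient of `u^ℓ` in `(a + u b)^n`. -/
def cf (a b : R) (n ℓ : ℕ) : R := ((Polynomial.C a + Polynomial.C b * Polynomial.X) ^ n).coeff ℓ

theorem cf_zero (a b : R) (ℓ : ℕ) : cf a b 0 ℓ = if ℓ = 0 then 1 else 0 := by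
  simp [cf, Polynomial.coeff_one]

theorem cf_succ_zero (a b : R) (n : ℕ) : cf a b (n+1) 0 = a * cf a b n 0 := by
  simp [cf, pow_succ', add_mul, mul_assoc]

theorem cf_succ_succ (a b : R) (n ℓ : ℕ) :
    cf a b (n+1) (ℓ+1) = a * cf a b n (ℓ+1) + b * cf a b n ℓ := by
  simp [cf, pow_succ', add_mul, mul_assoc, Polynomial.coeff_X_mul]

theorem cf_succ_zero' (a b : R) (n : ℕ) : cf a b (n+1) 0 = cf a b n 0 * a := by
  simp [cf, pow_succ, mul_add, ← mul_assoc]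

theorem cf_succ_succ' (a b : R) (n ℓ : ℕ) :
    cf a b (n+1) (ℓ+1) = cf a b n (ℓ+1) * a + cf a b n ℓ * b := by
  simp [cf, pow_succ, mul_add, ← mul_assoc, Polynomial.coeff_mul_X]

theorem cf_gt (a b : R) (n ℓ : ℕ) (h : n < ℓ) : cf a b n ℓ = 0 := by
  induction n generalizing ℓ with
  | zero => rw [cf_zero, if_neg]; omega
  | succ n ih =>
    obtain ⟨ℓ, rfl⟩ : ∃ l, ℓ = l + 1 := ⟨ℓ - 1, by omega⟩
    rw [cf_succ_succ, ih _ (by omega), ih _ (by omega)]; simp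

theorem cf_self (a b : R) (n : ℕ) : cf a b n n = b ^ n := by
  induction n with
  | zero => simp [cf_zero]
  | succ n ih => rw [cf_succ_succ, ih, cf_gt _ _ _ _ (Nat.lt_succ_self n), pow_succ']; simp

theorem cf_sum {k : Type*} [CommRing k] [Algebra k R] (a b : R) (u : k) (n N : ℕ) (h : n < N) :
    ∑ ℓ ∈ Finset.range N, u ^ ℓ • cf a b n ℓ = (a + u • b) ^ n := by
  induction n generalizing N with
  | zero =>
    rw [Finset.sum_eq_single 0]
    · simp [cf_zero]
    · intro l _ hl; simp [cf_zero, hl]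
    · simp; omega
  | succ n ih =>
    obtain ⟨N, rfl⟩ : ∃ l, N = l + 1 := ⟨N - 1, by omega⟩
    rw [pow_succ', add_mul, Finset.sum_range_succ']
    simp only [cf_succ_succ, cf_succ_zero, smul_add, Finset.sum_add_distrib]
    have h1 := ih (N + 1) (by omega)
    have h2 := ih N (by omega)
    have e : a * (a + u • b) ^ n + u • b * (a + u • b) ^ n =
      a * ∑ ℓ ∈ Finset.range (N + 1), u ^ ℓ • cf a b n ℓ
        + u • b * ∑ ℓ ∈ Finset.range N, u ^ ℓ • cf a b n ℓ := by rw [h1, h2]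
    rw [e, Finset.sum_range_succ']
    simp only [mul_add, Finset.mul_sum, smul_mul_assoc, mul_smul_comm, Finset.smul_sum, smul_smul,
      pow_succ', pow_zero, mul_comm _ u]
    abel
end cf

variable {K : Type*} [Field K] [CharZero K]

def cL (α : K) : Module.End K (VV K) := (Lop α) ∘ₗ dvX

/-- adjoint of the `u^ℓ` coefficient of `B_n` -/
def bdc (α : K) (n ℓ : ℕ) : Module.End K (SA K) :=
  α⁻¹ • (c0 ∘ₗ (cf (R := Module.End K (VV K)) ((Lop α) ∘ₗ dvX) dvX n ℓ) ∘ₗ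
    (dl α : SA K →ₗ[K] VV K))

/-- the `u^ℓ` coefficient of `B_n` -/
def Bo (α : K) (n ℓ : ℕ) : Module.End K (SA K) :=
  α⁻¹ • (Th ∘ₗ (cf (R := Module.End K (VV K)) (mX ∘ₗ Lop α) mX n ℓ) ∘ₗ Cl)

theorem hV_cf (α : K) (n ℓ : ℕ) (v w : VV K) :
    hV α (cf (R := Module.End K (VV K)) (mX ∘ₗ Lop α) mX n ℓ v) w
    = hV α v (cf (R := Module.End K (VV K)) ((Lop α) ∘ₗ dvX) dvX n ℓ w) := by
  induction n generalizing ℓ v w with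
  | zero => rw [cf_zero, cf_zero]; split_ifs <;> simp
  | succ n ih =>
    cases ℓ with
    | zero =>
      rw [cf_succ_zero, cf_succ_zero']
      simp only [Module.End.mul_apply, LinearMap.comp_apply, hV_mX, hV_Lop, ih]
    | succ ℓ =>
      rw [cf_succ_succ, cf_succ_succ']
      simp only [Module.End.mul_apply, LinearMap.comp_apply, LinearMap.add_apply, map_add,
        hV_mX, hV_Lop, ih]

theorem hb_Bo (α : K) (n ℓ : ℕ) (f g : SA K) :
    hb α (Bo α n ℓ f) g = hb α f (bdc α n ℓ g) := by
  simp only [Bo, bdc, LinearMap.smul_apply, LinearMap.comp_apply, map_smul, hb_Th, hV_cf, hV_Cl]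
  rfl

/-- `𝔅_n(u)` -/
def bU (α u : K) (n : ℕ) : Module.End K (SA K) :=
  α⁻¹ • (c0 ∘ₗ (((Lop α + u • LinearMap.id) ∘ₗ dvX : Module.End K (VV K)) ^ n) ∘ₗ
    (dl α : SA K →ₗ[K] VV K))

theorem bU_eq (α u : K) (n N : ℕ) (h : n < N) :
    bU α u n = ∑ ℓ ∈ Finset.range N, u ^ ℓ • bdc α n ℓ := by
  have := cf_sum (R := Module.End K (VV K)) ((Lop α) ∘ₗ dvX) dvX u n N h
  have h2 : (Lop α + u • LinearMap.id) ∘ₗ dvX = (Lop α) ∘ₗ dvX + u • (dvX : VV K →ₗ[K] VV K) := by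
    ext1 x; simp
  rw [bU, h2, ← this]
  refine LinearMap.ext fun x => ?_
  simp only [bdc, LinearMap.smul_apply, LinearMap.comp_apply, LinearMap.sum_apply, map_sum,
    Finset.smul_sum, map_smul]
  refine Finset.sum_congr rfl fun i _ => ?_
  rw [smul_smul, smul_smul, mul_comm]

theorem dvX_pow_coeff (n i : ℕ) (v : VV K) :
    ((dvX ^ n : Module.End K (VV K)) v).coeff i = v.coeff (i + n) := by
  induction n generalizing i with
  | zero => simp
  | succ n ih =>
    rw [pow_succ', Module.End.mul_apply]
    change (Polynomial.divX _).coeff i = _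
    rw [Polynomial.coeff_divX, ih]; congr 1; omega

theorem bdc_self {α : K} (hα : α ≠ 0) (n : ℕ+) (f : SA K) :
    bdc α n n f = ((n : ℕ) : K) • pderiv n f := by
  simp only [bdc, cf_self, LinearMap.smul_apply, LinearMap.comp_apply]
  change α⁻¹ • ((dvX ^ (n : ℕ) : Module.End K (VV K)) (dl α f)).coeff 0 = _
  rw [dvX_pow_coeff, zero_add, dl_coeff, smul_smul, inv_mul_cancel_left₀ hα]

theorem bdc_gt (α : K) (n ℓ : ℕ) (h : n < ℓ) : bdc α n ℓ = 0 := by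
  refine LinearMap.ext fun x => ?_
  simp [bdc, cf_gt _ _ _ _ h]

theorem bdc_zero (α : K) (ℓ : ℕ) : bdc α 0 ℓ = 0 := by
  refine LinearMap.ext fun x => ?_
  rw [bdc, cf_zero]
  split_ifs
  · change α⁻¹ • (dl α x).coeff 0 = _
    simp [dl_coeff_zero]
  · simp

/-! homogeneity -/
def wg (m : ℕ+ →₀ ℕ) : ℕ := m.sum fun i k => k * (i : ℕ)

theorem wg_add (m m' : ℕ+ →₀ ℕ) : wg (m + m') = wg m + wg m' := by
  unfold wg
  rw [Finsupp.sum_add_index' (by simp) (by intros; ring)]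

theorem wg_single (j : ℕ+) (k : ℕ) : wg (Finsupp.single j k) = k * j := by
  simp [wg]

theorem wg_zero : wg 0 = 0 := by simp [wg]

theorem wg_pos {m : ℕ+ →₀ ℕ} (h : m ≠ 0) : 0 < wg m := by
  obtain ⟨i, hi⟩ := Finsupp.ne_iff.1 h
  unfold wg
  refine Finset.sum_pos' (fun _ _ => Nat.zero_le _) ⟨i, by simpa using hi, ?_⟩
  exact Nat.mul_pos (Nat.pos_of_ne_zero hi) i.pos

/-- `f` has all weights `w` with `w + k = d` -/
def AH (K : Type*) [Field K] (k d : ℕ) : Submodule K (SA K) where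
  carrier := {f | ∀ m, coeff m f ≠ 0 → wg m + k = d}
  add_mem' := by
    intro a b ha hb m hm
    by_cases h : coeff m a = 0
    · exact hb m (by simpa [h] using hm)
    · exact ha m h
  zero_mem' := by intro m hm; simp at hm
  smul_mem' := by
    intro c a ha m hm
    exact ha m (by intro h; simp [h] at hm)

theorem AH_monomial {k d : ℕ} (m : ℕ+ →₀ ℕ) (c : K) (h : wg m + k = d) :
    monomial m c ∈ AH K k d := by
  intro m' hm
  rw [coeff_monomial] at hm
  by_cases h' : m = m'
  · rw [← h']; exact h
  · simp [h'] at hm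

theorem AH_shift {k d : ℕ} (r : ℕ) {f : SA K} : f ∈ AH K (k + r) (d + r) ↔ f ∈ AH K k d := by
  constructor
  · intro h m hm; have := h m hm; omega
  · intro h m hm; have := h m hm; omega

theorem AH_eq_zero {k d : ℕ} (h : d < k) {f : SA K} (hf : f ∈ AH K k d) : f = 0 := by
  ext m
  by_contra hm
  have := hf m hm; omega

theorem AH_X_mul {k d : ℕ} (j : ℕ+) {f : SA K} (hf : f ∈ AH K (k + j) d) : X j * f ∈ AH K k d := by
  intro m hm
  rw [coeff_X_mul'] at hm
  split_ifs at hm with h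
  · have := hf _ hm
    have h2 : m - Finsupp.single j 1 + Finsupp.single j 1 = m := by
      apply tsub_add_cancel_of_le
      rw [Finsupp.single_le_iff]
      have := Finsupp.mem_support_iff.1 h
      omega
    rw [← h2, wg_add, wg_single]; omega
  · exact absurd rfl hm

theorem AH_pderiv {k d : ℕ} (j : ℕ+) {f : SA K} (hf : f ∈ AH K k d) :
    pderiv j f ∈ AH K (k + j) d := by
  intro m hm
  rw [coeff_pderiv] at hm
  have := hf _ (left_ne_zero_of_mul hm)
  rw [wg_add, wg_single] at this; omega

def HV (K : Type*) [Field K] (k d : ℕ) : Submodule K (VV K) where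
  carrier := {v | ∀ i, v.coeff i ∈ AH K (i + k) d}
  add_mem' := by
    intro a b ha hb i
    rw [Polynomial.coeff_add]; exact add_mem (ha i) (hb i)
  zero_mem' := by intro i; simp
  smul_mem' := by
    intro c a ha i
    rw [Polynomial.coeff_smul]; exact Submodule.smul_mem _ _ (ha i)

theorem HV_dl {α : K} {k d : ℕ} {f : SA K} (hf : f ∈ AH K k d) : dl α f ∈ HV K k d := by
  intro i
  rcases Nat.eq_zero_or_pos i with h | h
  · subst h; rw [dl_coeff_zero]; exact zero_mem _
  · obtain ⟨j, rfl⟩ : ∃ j : ℕ+, i = j := ⟨⟨i, h⟩, rfl⟩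
    rw [dl_coeff]
    rw [add_comm]
    exact Submodule.smul_mem _ _ (AH_pderiv j hf)

theorem HV_dvX {k d : ℕ} {v : VV K} (hv : v ∈ HV K k d) : dvX v ∈ HV K (k + 1) d := by
  intro i
  change (Polynomial.divX v).coeff i ∈ _
  rw [Polynomial.coeff_divX]
  have := hv (i + 1)
  rwa [show i + (k + 1) = i + 1 + k by ring]

theorem HV_Lop {α : K} {k d : ℕ} {v : VV K} (hv : v ∈ HV K k d) : Lop α v ∈ HV K k d := by
  rw [v.as_sum_support, map_sum]
  refine Submodule.sum_mem _ fun i _ => ?_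
  intro l
  have hi := hv i
  rcases lt_trichotomy i l with h | h | h
  · obtain ⟨j, rfl⟩ : ∃ j : ℕ+, l = i + j := ⟨⟨l - i, by omega⟩, by simp; omega⟩
    rw [Lop_coeff_gt]
    rw [show i + (j : ℕ) + k = i + k + j by ring]
    exact Submodule.smul_mem _ _ (AH_pderiv j hi)
  · subst h
    rw [Lop_coeff_self]; exact Submodule.smul_mem _ _ hi
  · obtain ⟨j, rfl⟩ : ∃ j : ℕ+, i = l + j := ⟨⟨i - l, by omega⟩, by simp; omega⟩
    rw [Lop_coeff_lt]
    apply AH_X_mul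
    rwa [show l + k + (j : ℕ) = l + j + k by ring]

theorem HV_cf {α : K} (n ℓ : ℕ) {k d : ℕ} {v : VV K} (hv : v ∈ HV K k d) :
    cf (R := Module.End K (VV K)) ((Lop α) ∘ₗ dvX) dvX n ℓ v ∈ HV K (k + n) d := by
  induction n generalizing ℓ with
  | zero =>
    rw [cf_zero]; split_ifs
    · exact hv
    · exact zero_mem _
  | succ n ih =>
    cases ℓ with
    | zero =>
      rw [cf_succ_zero, Module.End.mul_apply, LinearMap.comp_apply]
      exact HV_Lop (HV_dvX (ih 0))
    | succ ℓ =>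
      rw [cf_succ_succ, LinearMap.add_apply, Module.End.mul_apply, Module.End.mul_apply,
        LinearMap.comp_apply]
      exact add_mem (HV_Lop (HV_dvX (ih (ℓ+1)))) (HV_dvX (ih ℓ))

/-- operators lowering the weight by exactly `n` -/
def Low (n : ℕ) (T : Module.End K (SA K)) : Prop :=
  ∀ k d f, f ∈ AH K k d → T f ∈ AH K (k + n) d

theorem bdc_low (α : K) (n ℓ : ℕ) : Low n (bdc α n ℓ) := by
  intro k d f hf
  refine Submodule.smul_mem _ _ ?_
  have := HV_cf (α := α) n ℓ (HV_dl (α := α) hf) 0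
  rwa [zero_add] at this

theorem low_add {n : ℕ} {S T : Module.End K (SA K)} (hS : Low n S) (hT : Low n T) : Low n (S + T) :=
  fun k d f hf => add_mem (hS k d f hf) (hT k d f hf)
theorem low_smul {n : ℕ} {S : Module.End K (SA K)} (c : K) (hS : Low n S) : Low n (c • S) :=
  fun k d f hf => Submodule.smul_mem _ _ (hS k d f hf)
theorem low_zero (n : ℕ) : Low n (0 : Module.End K (SA K)) :=
  fun k d f hf => zero_mem _
theorem low_one : Low 0 (1 : Module.End K (SA K)) :=
  fun k d f hf => hf
theorem low_sum {ι : Type*} {n : ℕ} (s : Finset ι) (S : ι → Module.End K (SA K))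
    (h : ∀ i ∈ s, Low n (S i)) : Low n (∑ i ∈ s, S i) := fun k d f hf => by
  rw [LinearMap.sum_apply]
  exact Submodule.sum_mem _ fun i hi => h i hi k d f hf
theorem low_mul {n n' : ℕ} {S T : Module.End K (SA K)} (hS : Low n S) (hT : Low n' T) :
    Low (n + n') (S * T) := fun k d f hf => by
  have := hS _ _ _ (hT k d f hf)
  rwa [show k + (n + n') = k + n' + n by ring]

theorem bU_low (α u : K) (n : ℕ) : Low n (bU α u n) := by
  rw [bU_eq α u n _ (Nat.lt_succ_self n)]
  exact low_sum _ _ fun _ _ => low_smul _ (bdc_low _ _ _)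

end JP

namespace JP
open MvPolynomial

section dunkl
variable {K : Type*} [Field K] [CharZero K] {ι : Type*} [Fintype ι]

/-- transposition of variables -/
def sw (K : Type*) [Field K] (a b : ι) : MvPolynomial ι K →ₐ[K] MvPolynomial ι K :=
  rename (Equiv.swap a b)

theorem sw_X_left (a b : ι) : sw K a b (X a) = X b := by simp [sw]
theorem sw_X_right (a b : ι) : sw K a b (X b) = X a := by simp [sw]
theorem sw_X_other (a b c : ι) (h : c ≠ a) (h' : c ≠ b) : sw K a b (X c) = X c := by
  simp [sw, Equiv.swap_apply_of_ne_of_ne h h']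
theorem sw_self (a : ι) (f : MvPolynomial ι K) : sw K a a f = f := by
  simp [sw]
theorem sw_symm (a b : ι) : sw K a b = sw K b a := by
  rw [sw, Equiv.swap_comm]; rfl
theorem rename_sw (σ : Equiv.Perm ι) (a b : ι) (f : MvPolynomial ι K) :
    rename σ (sw K a b f) = sw K (σ a) (σ b) (rename σ f) := by
  simp only [sw, rename_rename]
  congr 2
  funext x
  simp only [Function.comp_apply]
  rw [Equiv.swap_apply_apply]
  simp

theorem X_sub_ne {a b : ι} (h : a ≠ b) : (X a - X b : MvPolynomial ι K) ≠ 0 := by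
  rw [sub_ne_zero]
  exact fun e => h (X_injective e)

theorem dd_exists (a b : ι) (f : MvPolynomial ι K) :
    ∃ q, (X a - X b) * q = f - sw K a b f := by
  induction f using MvPolynomial.induction_on with
  | C c => exact ⟨0, by simp [sw]⟩
  | add p q hp hq =>
    obtain ⟨u, hu⟩ := hp
    obtain ⟨v, hv⟩ := hq
    exact ⟨u + v, by rw [mul_add, hu, hv, map_add]; ring⟩
  | mul_X p c hp =>
    obtain ⟨u, hu⟩ := hp
    by_cases hca : c = a
    · subst hca
      exact ⟨X c * u + sw K c b p, by
        rw [map_mul, sw_X_left]; linear_combination X c * hu⟩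
    · by_cases hcb : c = b
      · subst hcb
        exact ⟨X c * u - sw K a c p, by
          rw [map_mul, sw_X_right]; linear_combination X c * hu⟩
      · exact ⟨X c * u, by
          rw [map_mul, sw_X_other _ _ _ hca hcb]; linear_combination X c * hu⟩

def ddf (a b : ι) (f : MvPolynomial ι K) : MvPolynomial ι K :=
  if a = b then 0 else (dd_exists a b f).choose

theorem ddf_spec (a b : ι) (f : MvPolynomial ι K) :
    (X a - X b) * ddf a b f = f - sw K a b f := by
  unfold ddf
  split_ifs with h
  · subst h; simp [sw_self]
  · exact (dd_exists a b f).choose_spec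

theorem ddf_unique {a b : ι} (h : a ≠ b) {f g : MvPolynomial ι K}
    (e : (X a - X b) * g = f - sw K a b f) : ddf a b f = g := by
  apply mul_left_cancel₀ (X_sub_ne h)
  rw [ddf_spec, e]

/-- divided difference -/
def dd (a b : ι) : MvPolynomial ι K →ₗ[K] MvPolynomial ι K where
  toFun := ddf a b
  map_add' f g := by
    by_cases h : a = b
    · simp [ddf, h]
    · apply ddf_unique h
      rw [mul_add, ddf_spec, ddf_spec, map_add]; ring
  map_smul' c f := by
    by_cases h : a = b
    · simp [ddf, h]
    · apply ddf_unique h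
      rw [RingHom.id_apply, mul_smul_comm, ddf_spec, map_smul, smul_sub]

theorem dd_spec (a b : ι) (f : MvPolynomial ι K) :
    (X a - X b) * dd a b f = f - sw K a b f := ddf_spec a b f
theorem dd_unique {a b : ι} (h : a ≠ b) {f g : MvPolynomial ι K}
    (e : (X a - X b) * g = f - sw K a b f) : dd a b f = g := ddf_unique h e
theorem dd_self (a : ι) (f : MvPolynomial ι K) : dd a a f = 0 := by
  change ddf a a f = 0
  simp [ddf]

/-- transposition, zero on the diagonal -/
def swz (K : Type*) [Field K] (a b : ι) : MvPolynomial ι K →ₗ[K] MvPolynomial ι K :=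
  if a = b then 0 else (sw K a b).toLinearMap

theorem swz_ne {a b : ι} (h : a ≠ b) (f : MvPolynomial ι K) : swz K a b f = sw K a b f := by
  simp [swz, h]
theorem swz_self (a : ι) (f : MvPolynomial ι K) : swz K a a f = 0 := by
  simp [swz]

theorem dd_X_left (a b : ι) (f : MvPolynomial ι K) :
    dd a b (X a * f) = X a * dd a b f + swz K a b f := by
  by_cases h : a = b
  · subst h; simp [dd_self, swz_self]
  · rw [swz_ne h]
    apply dd_unique h
    rw [map_mul, sw_X_left]; linear_combination X a * dd_spec a b f

theorem dd_X_right (a b : ι) (h : a ≠ b) (f : MvPolynomial ι K) :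
    dd a b (X b * f) = X b * dd a b f - swz K a b f := by
  rw [swz_ne h]
  apply dd_unique h
  rw [map_mul, sw_X_right]; linear_combination X b * dd_spec a b f

theorem dd_X_other (a b c : ι) (h : c ≠ a) (h' : c ≠ b) (f : MvPolynomial ι K) :
    dd a b (X c * f) = X c * dd a b f := by
  by_cases hab : a = b
  · subst hab; simp [dd_self]
  apply dd_unique hab
  rw [map_mul, sw_X_other _ _ _ h h']; linear_combination X c * dd_spec a b f

theorem rename_dd (σ : Equiv.Perm ι) (a b : ι) (f : MvPolynomial ι K) :
    rename σ (dd a b f) = dd (σ a) (σ b) (rename σ f) := by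
  by_cases h : a = b
  · subst h; simp [dd_self]
  · symm
    apply dd_unique (fun e => h (σ.injective e))
    rw [← rename_sw, ← map_sub, ← dd_spec]; simp

/-- Dunkl operator -/
def Du (c κ : K) (a : ι) : Module.End K (MvPolynomial ι K) :=
  c • (pderiv a : Derivation K (MvPolynomial ι K) (MvPolynomial ι K)).toLinearMap
    + κ • ∑ b, dd a b

theorem Du_apply (c κ : K) (a : ι) (f : MvPolynomial ι K) :
    Du c κ a f = c • pderiv a f + κ • ∑ b, dd a b f := by
  simp [Du, LinearMap.sum_apply]

theorem Du_X_self (c κ : K) (a : ι) (f : MvPolynomial ι K) :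
    Du c κ a (X a * f) = X a * Du c κ a f + c • f + κ • ∑ b, swz K a b f := by
  simp only [Du_apply, dd_X_left, Derivation.leibniz, pderiv_X_self, Finset.sum_add_distrib,
    smul_add, smul_eq_mul, mul_one, mul_add, mul_smul_comm, Finset.mul_sum]
  abel

theorem Du_X_other (c κ : K) (a b : ι) (h : b ≠ a) (f : MvPolynomial ι K) :
    Du c κ a (X b * f) = X b * Du c κ a f - κ • sw K a b f := by
  have h1 : ∀ d, dd a d (X b * f) = X b * dd a d f - if d = b then sw K a b f else 0 := by
    intro d
    by_cases hd : d = b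
    · subst hd; rw [dd_X_right _ _ h.symm, swz_ne h.symm]; simp
    · rw [dd_X_other _ _ _ h (Ne.symm hd)]; simp [hd]
  simp only [Du_apply, h1, Derivation.leibniz, pderiv_X_of_ne h, Finset.sum_sub_distrib,
    smul_sub, smul_eq_mul, mul_zero, mul_add, mul_smul_comm, Finset.mul_sum, add_zero]
  simp
  abel

theorem rename_pderiv (σ : Equiv.Perm ι) (a : ι) (f : MvPolynomial ι K) :
    rename σ (pderiv a f) = pderiv (σ a) (rename σ f) :=
  (pderiv_rename σ.injective a f).symm

theorem rename_Du (c κ : K) (σ : Equiv.Perm ι) (a : ι) (f : MvPolynomial ι K) :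
    rename σ (Du c κ a f) = Du c κ (σ a) (rename σ f) := by
  simp only [Du_apply, map_add, map_smul, map_sum, rename_pderiv, rename_dd]
  congr 2
  exact Equiv.sum_comp σ fun b => dd (σ a) b (rename σ f)

theorem sw_Du (c κ : K) (a b d : ι) (f : MvPolynomial ι K) :
    sw K a b (Du c κ d f) = Du c κ (Equiv.swap a b d) (sw K a b f) := rename_Du _ _ _ _ _

theorem Du_C (c κ : K) (a : ι) (x : K) : Du c κ a (C x) = 0 := by
  have : ∀ b, dd a b (C x : MvPolynomial ι K) = 0 := by
    intro b
    by_cases h : a = b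
    · subst h; exact dd_self _ _
    · exact dd_unique h (by simp [sw])
  simp [Du_apply, this]

/-- the commutator step -/
theorem Du_comm_step (c κ : K) (a b : ι) (hab : a ≠ b) (f : MvPolynomial ι K)
    (ih : Du c κ a (Du c κ b f) = Du c κ b (Du c κ a f)) :
    Du c κ a (Du c κ b (X a * f)) = Du c κ b (Du c κ a (X a * f)) := by
  rw [Du_X_other _ _ _ _ hab, Du_X_self, map_sub, map_add, map_add, map_smul, map_smul, map_smul,
    Du_X_self, Du_X_other _ _ _ _ hab, map_sum, ih]
  have key : ∑ x, swz K a x (Du c κ b f) - ∑ x, Du c κ b (swz K a x f)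
      = Du c κ a (sw K b a f) - sw K b a (Du c κ a f) := by
    rw [← Finset.sum_sub_distrib, Finset.sum_eq_single b]
    · rw [swz_ne hab, swz_ne hab, sw_Du, sw_Du, sw_symm b a, Equiv.swap_apply_right,
        Equiv.swap_apply_right]
    · intro x _ hx
      by_cases hxa : x = a
      · subst hxa; simp [swz_self]
      · rw [swz_ne (Ne.symm hxa), swz_ne (Ne.symm hxa), sw_Du,
          Equiv.swap_apply_of_ne_of_ne hab.symm hx.symm, sub_self]
    · simp
  have key' := congrArg (fun z => κ • z) key
  simp only [smul_sub] at key'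
  linear_combination (exp := 1) key'

theorem Du_comm (c κ : K) (a b : ι) (f : MvPolynomial ι K) :
    Du c κ a (Du c κ b f) = Du c κ b (Du c κ a f) := by
  by_cases hab : a = b
  · subst hab; rfl
  induction f using MvPolynomial.induction_on with
  | C x => simp [Du_C]
  | add p q hp hq => simp only [map_add, hp, hq]
  | mul_X p d ih =>
    rw [mul_comm p (X d)]
    by_cases hda : d = a
    · subst hda; exact Du_comm_step c κ _ _ hab p ih
    by_cases hdb : d = b
    · subst hdb; exact (Du_comm_step c κ _ _ (Ne.symm hab) p ih.symm).symm
    rw [Du_X_other _ _ _ _ hdb, Du_X_other _ _ _ _ hda, map_sub, map_sub, map_smul, map_smul,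
      Du_X_other _ _ _ _ hdb, Du_X_other _ _ _ _ hda, sw_Du, sw_Du,
      Equiv.swap_apply_of_ne_of_ne (Ne.symm hab) (Ne.symm hdb),
      Equiv.swap_apply_of_ne_of_ne hab (Ne.symm hda), ih]
    ring

abbrev DuAlg (K : Type*) [Field K] [CharZero K] (ι : Type*) [Fintype ι] (c κ : K) :
    Subalgebra K (Module.End K (MvPolynomial ι K)) :=
  Algebra.adjoin K (Set.range (Du (ι := ι) c κ))

instance (c κ : K) : CommRing (DuAlg K ι c κ) :=
  Algebra.adjoinCommRingOfComm K (by
    rintro _ ⟨a, rfl⟩ _ ⟨b, rfl⟩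
    refine LinearMap.ext fun f => ?_
    exact Du_comm c κ a b f)

/-- evaluation of polynomials at the commuting Dunkl operators -/
def Psi (c κ : K) : MvPolynomial ι K →ₐ[K] Module.End K (MvPolynomial ι K) :=
  (DuAlg K ι c κ).val.comp (aeval (fun a => (⟨Du c κ a, Algebra.subset_adjoin ⟨a, rfl⟩⟩ : DuAlg K ι c κ)))

theorem Psi_X (c κ : K) (a : ι) : Psi c κ (X a) = Du c κ a := by
  simp [Psi]

end dunkl
end JP

namespace JP
open MvPolynomial

section dunkl
variable {K : Type*} [Field K] [CharZero K] {ι : Type*} [Fintype ι]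

theorem Psi_comm (c κ : K) (h h' f : MvPolynomial ι K) :
    Psi c κ h (Psi c κ h' f) = Psi c κ h' (Psi c κ h f) := by
  rw [← Module.End.mul_apply, ← map_mul, mul_comm, map_mul, Module.End.mul_apply]

theorem Psi_mul (c κ : K) (h h' f : MvPolynomial ι K) :
    Psi c κ (h * h') f = Psi c κ h (Psi c κ h' f) := by
  rw [map_mul, Module.End.mul_apply]

theorem Psi_C (c κ x : K) (f : MvPolynomial ι K) : Psi c κ (C x) f = x • f := by
  rw [← algebraMap_eq, AlgHom.commutes, Module.algebraMap_end_apply]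

theorem rename_Psi (c κ : K) (σ : Equiv.Perm ι) (h f : MvPolynomial ι K) :
    rename σ (Psi c κ h f) = Psi c κ (rename σ h) (rename σ f) := by
  induction h using MvPolynomial.induction_on generalizing f with
  | C x => simp [Psi_C]
  | add p q hp hq => simp only [map_add, hp, hq, LinearMap.add_apply]
  | mul_X p a ih => rw [Psi_mul, ih, Psi_X, rename_Du, map_mul, rename_X, Psi_mul, Psi_X]

theorem sw_Psi (c κ : K) (a b : ι) (h f : MvPolynomial ι K) :
    sw K a b (Psi c κ h f) = Psi c κ (sw K a b h) (sw K a b f) := rename_Psi _ _ _ _ _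

/-- sum of all partial derivatives -/
def Eder (K : Type*) [Field K] (ι : Type*) : Derivation K (MvPolynomial ι K) (MvPolynomial ι K) :=
  mkDerivation K fun _ => 1

theorem Eder_X (a : ι) : Eder K ι (X a) = 1 := by simp [Eder]

theorem Du_xbar (c κ : K) (a : ι) (f : MvPolynomial ι K) :
    Du c κ a ((∑ b, X b) * f) = (∑ b, X b) * Du c κ a f + c • f := by
  rw [Finset.sum_mul, map_sum, Finset.sum_mul, ← Finset.add_sum_erase _ _ (Finset.mem_univ a),
    ← Finset.add_sum_erase _ (fun b => X b * Du c κ a f) (Finset.mem_univ a), Du_X_self,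
    Finset.sum_congr rfl (fun b hb => Du_X_other c κ a b (Finset.ne_of_mem_erase hb) f),
    Finset.sum_sub_distrib, ← Finset.add_sum_erase _ (fun b => swz K a b f) (Finset.mem_univ a),
    swz_self, Finset.sum_congr rfl (fun b hb => swz_ne (Finset.ne_of_mem_erase hb).symm f),
    zero_add, Finset.smul_sum]
  ring

theorem Psi_xbar (c κ : K) (h f : MvPolynomial ι K) :
    Psi c κ h ((∑ b, X b) * f) = (∑ b, X b) * Psi c κ h f + c • Psi c κ (Eder K ι h) f := by
  induction h using MvPolynomial.induction_on generalizing f with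
  | C x => simp [Psi_C]
  | add p q hp hq =>
    simp only [map_add, hp, hq, LinearMap.add_apply, smul_add, mul_add]; abel
  | mul_X p a ih =>
    have e : ∀ h f, Psi c κ h (Du c κ a f) = Du c κ a (Psi c κ h f) := by
      intro h f; rw [← Psi_X, Psi_comm]
    rw [Psi_mul, Psi_X, Du_xbar, map_add, ih, Psi_mul, Derivation.leibniz, map_add, Eder_X,
      smul_eq_mul, smul_eq_mul, mul_one, LinearMap.add_apply, Psi_mul, map_smul, Psi_X, e, e]
    simp only [smul_add]
    ring

theorem newton (k : ℕ) : ((k : MvPolynomial ι K) + 1) * esymm ι K (k+1)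
    = ∑ i ∈ Finset.range (k+1), (-1) ^ i * esymm ι K (k - i) * psum ι K (i+1) := by
  have h := mul_esymm_eq_sum ι K (k+1)
  push_cast at h
  rw [h, Finset.sum_filter, Finset.Nat.sum_antidiagonal_eq_sum_range_succ_mk,
    Finset.sum_range_succ, if_neg (by simp), add_zero, ← Finset.sum_range_reflect, Finset.mul_sum]
  refine Finset.sum_congr rfl fun i hi => ?_
  have hi' := Finset.mem_range.1 hi
  have e1 : k + 1 - 1 - i = k - i := by omega
  rw [e1, if_pos (by simp only; omega)]
  have e2 : k + 1 - (k - i) = i + 1 := by omega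
  simp only [e2]
  rw [← mul_assoc, ← mul_assoc, ← pow_add]
  congr 2
  rw [show k + 1 + 1 + (k - i) = i + 2 * (k - i + 1) by omega, pow_add, pow_mul]; simp

theorem Eder_psum (n : ℕ) : Eder K ι (psum ι K (n+1)) = ((n : MvPolynomial ι K) + 1) * psum ι K n := by
  simp only [psum, map_sum, Derivation.leibniz_pow, Eder_X, Finset.mul_sum]
  refine Finset.sum_congr rfl fun i _ => ?_
  simp

theorem Eder_esymm (k : ℕ) : Eder K ι (esymm ι K (k+1))
    = ((Fintype.card ι : MvPolynomial ι K) - k) * esymm ι K k := by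
  induction k using Nat.strong_induction_on with
  | _ k ih =>
  have h := congrArg (Eder K ι) (newton (K := K) (ι := ι) k)
  have hne : ((k : MvPolynomial ι K) + 1) ≠ 0 := by exact_mod_cast Nat.succ_ne_zero k
  have hk : Eder K ι ((k : MvPolynomial ι K) + 1) = 0 := by
    have : ((k : MvPolynomial ι K) + 1) = C ((k : K) + 1) := by simp
    rw [this, derivation_C]
  rw [Derivation.leibniz, hk, smul_zero, add_zero, smul_eq_mul] at h
  apply mul_left_cancel₀ hne
  rw [h, map_sum]
  have hD : ∀ i, Eder K ι ((-1) ^ i * esymm ι K (k - i) * psum ι K (i+1))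
      = (-1) ^ i * (Eder K ι (esymm ι K (k - i)) * psum ι K (i+1))
        + (-1) ^ i * ((i : MvPolynomial ι K) + 1) * esymm ι K (k - i) * psum ι K i := by
    intro i
    have : Eder K ι ((-1) ^ i) = 0 := by
      have : ((-1) ^ i : MvPolynomial ι K) = C ((-1) ^ i) := by simp
      rw [this, derivation_C]
    rw [Derivation.leibniz, Derivation.leibniz, this, Eder_psum]
    simp only [smul_eq_mul]; ring
  simp only [hD, Finset.sum_add_distrib]
  rw [Finset.sum_range_succ, Nat.sub_self, esymm_zero, Derivation.map_one_eq_zero, zero_mul, mul_zero,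
    add_zero, Finset.sum_range_succ' _ k]
  rcases k with _ | k
  · simp [psum]
  · have hn := newton (K := K) (ι := ι) k
    have e : ∀ i ∈ Finset.range (k+1), (-1) ^ i * (Eder K ι (esymm ι K (k + 1 - i)) * psum ι K (i+1))
      = ((Fintype.card ι : MvPolynomial ι K) - k + i) * ((-1) ^ i * esymm ι K (k - i) * psum ι K (i+1)) := by
      intro i hi
      have hi' := Finset.mem_range.1 hi
      rw [show k + 1 - i = (k - i) + 1 by omega, ih (k - i) (by omega), Nat.cast_sub (by omega)]
      ring
    have e' : ∀ i ∈ Finset.range (k+1), (-1) ^ (i+1) * (((i+1 : ℕ) : MvPolynomial ι K) + 1) * esymm ι K (k + 1 - (i+1)) * psum ι K (i+1)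
      = - ((i : MvPolynomial ι K) + 2) * ((-1) ^ i * esymm ι K (k - i) * psum ι K (i+1)) := by
      intro i hi
      rw [Nat.add_sub_add_right]; push_cast; ring
    rw [Finset.sum_congr rfl e, Finset.sum_congr rfl e', ← add_assoc, ← Finset.sum_add_distrib]
    have e'' : ∀ i ∈ Finset.range (k+1),
       ((Fintype.card ι : MvPolynomial ι K) - k + i) * ((-1) ^ i * esymm ι K (k - i) * psum ι K (i+1))
       + - ((i : MvPolynomial ι K) + 2) * ((-1) ^ i * esymm ι K (k - i) * psum ι K (i+1))
       = ((Fintype.card ι : MvPolynomial ι K) - k - 2) * ((-1) ^ i * esymm ι K (k - i) * psum ι K (i+1)) := by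
      intro i _; ring
    rw [Finset.sum_congr rfl e'', ← Finset.mul_sum, ← hn]
    simp [psum]
    ring

theorem Psi_X_step (c κ : K) (a : ι) (T : Finset ι) (ha : a ∉ T) (g : MvPolynomial ι K) :
    Psi c κ (∏ x ∈ T, X x) (X a * g) = X a * Psi c κ (∏ x ∈ T, X x) g
      - κ • ∑ d ∈ T, Psi c κ (∏ x ∈ T.erase d, X x) (sw K a d g) := by
  induction T using Finset.induction_on generalizing g with
  | empty => simp
  | insert d T hd ih =>
    have had : a ≠ d := fun e => ha (by simp [e])
    have haT : a ∉ T := fun e => ha (Finset.mem_insert_of_mem e)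
    have h1 : ∀ x ∈ T, ∏ y ∈ (insert d T).erase x, (X y : MvPolynomial ι K) = X d * ∏ y ∈ T.erase x, X y := by
      intro x hx
      have : d ≠ x := fun e => hd (e ▸ hx)
      rw [Finset.erase_insert_of_ne this, Finset.prod_insert]
      exact fun e => hd (Finset.mem_of_mem_erase e)
    have h3 : ∑ x ∈ T, Psi c κ (∏ y ∈ (insert d T).erase x, X y) (sw K a x g)
        = ∑ x ∈ T, Psi c κ (X d) (Psi c κ (∏ y ∈ T.erase x, X y) (sw K a x g)) :=
      Finset.sum_congr rfl (fun x hx => by rw [h1 x hx, Psi_mul])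
    rw [Finset.prod_insert hd, Finset.sum_insert hd, Finset.erase_insert hd, Psi_mul, ih haT,
      h3, ← map_sum, map_sub, map_smul,
      Psi_X, Du_X_other _ _ _ _ had, Psi_mul, Psi_X, sw_Psi, sw_symm d a]
    have h2 : sw K a d (∏ x ∈ T, X x) = ∏ x ∈ T, X x := by
      rw [map_prod]
      exact Finset.prod_congr rfl fun x hx => sw_X_other _ _ _ (fun e => haT (e ▸ hx)) (fun e => hd (e ▸ hx))
    rw [h2, smul_add]; ring

theorem Psi_prod_X (c κ : K) (a : ι) (g : MvPolynomial ι K) :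
    Psi c κ (∏ x, X x) (X a * g) = X a * Psi c κ (∏ x, X x) g
      + c • Psi c κ (∏ x ∈ Finset.univ.erase a, X x) g := by
  have h0 : (∏ x, X x : MvPolynomial ι K) = X a * ∏ x ∈ Finset.univ.erase a, X x :=
    (Finset.mul_prod_erase _ _ (Finset.mem_univ a)).symm
  rw [h0, Psi_mul, Psi_mul, Psi_X_step _ _ _ _ (Finset.notMem_erase _ _), map_sub, map_smul, Psi_X,
    Du_X_self, map_sum]
  have : ∑ b, swz K a b (Psi c κ (∏ x ∈ Finset.univ.erase a, X x) g)
     = ∑ d ∈ Finset.univ.erase a, Du c κ a (Psi c κ (∏ x ∈ (Finset.univ.erase a).erase d, X x) (sw K a d g)) := by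
    rw [← Finset.add_sum_erase _ _ (Finset.mem_univ a), swz_self, zero_add]
    refine Finset.sum_congr rfl fun d hd => ?_
    have hda := Finset.ne_of_mem_erase hd
    rw [swz_ne hda.symm, sw_Psi, ← Psi_X, ← Psi_mul]
    congr 2
    rw [← Finset.mul_prod_erase _ (fun x => (X x : MvPolynomial ι K)) hd, map_mul, sw_X_right, map_prod]
    congr 1
    refine Finset.prod_congr rfl fun x hx => sw_X_other _ _ _ ?_ ?_
    · exact Finset.ne_of_mem_erase (Finset.mem_of_mem_erase hx)
    · exact Finset.ne_of_mem_erase hx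
  rw [this]; ring

/-- `e (X_a D_a) = (X_a D_a + c) e` -/
theorem Psi_prod_XD (c κ : K) (a : ι) (g : MvPolynomial ι K) :
    Psi c κ (∏ x, X x) (X a * Du c κ a g) = X a * Du c κ a (Psi c κ (∏ x, X x) g)
      + c • Psi c κ (∏ x, X x) g := by
  rw [Psi_prod_X, ← Psi_X c κ a, Psi_comm, ← Psi_mul c κ _ (X a),
    Finset.prod_erase_mul _ _ (Finset.mem_univ a)]

end dunkl
end JP

namespace JP
open MvPolynomial

section spec
variable {K : Type*} [Field K] [CharZero K] {ι : Type*} [Fintype ι]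

/-- specialization `p_n ↦ κ ∑ x_a^n` -/
def ph (ι : Type*) [Fintype ι] (κ : K) : SA K →ₐ[K] MvPolynomial ι K :=
  aeval fun j : ℕ+ => κ • ∑ a : ι, X a ^ (j : ℕ)

theorem ph_X (κ : K) (j : ℕ+) : ph ι κ (X j) = κ • ∑ a : ι, X a ^ (j : ℕ) := by simp [ph]

def ev (κ : K) (a : ι) : VV K →ₗ[K] MvPolynomial ι K where
  toFun := Polynomial.eval₂ (ph ι κ : SA K →+* MvPolynomial ι K) (X a)
  map_add' _ _ := Polynomial.eval₂_add _ _
  map_smul' c v := by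
    have : c • v = Polynomial.C (C c) * v := by
      ext1 n
      simp [smul_eq_C_mul, Polynomial.coeff_C_mul]
    rw [this, Polynomial.eval₂_mul, Polynomial.eval₂_C]
    simp [smul_eq_C_mul, ph]

theorem ev_monomial (κ : K) (a : ι) (i : ℕ) (f : SA K) :
    ev κ a (Polynomial.monomial i f) = ph ι κ f * X a ^ i := by
  change Polynomial.eval₂ _ _ _ = _
  rw [Polynomial.eval₂_monomial]; rfl

theorem ev_mul (κ : K) (a : ι) (v w : VV K) : ev κ a (v * w) = ev κ a v * ev κ a w :=
  Polynomial.eval₂_mul _ _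

theorem ev_C (κ : K) (a : ι) (f : SA K) : ev κ a (Polynomial.C f) = ph ι κ f :=
  Polynomial.eval₂_C _ _
theorem ev_X (κ : K) (a : ι) : ev κ a Polynomial.X = X a :=
  Polynomial.eval₂_X _ _
theorem ev_X_pow (κ : K) (a : ι) (n : ℕ) : ev κ a (Polynomial.X ^ n) = X a ^ n :=
  Polynomial.eval₂_X_pow _ _

theorem rename_ph (κ : K) (σ : Equiv.Perm ι) (f : SA K) : rename σ (ph ι κ f) = ph ι κ f := by
  have : (rename σ).comp (ph ι κ) = ph ι κ := by
    apply MvPolynomial.algHom_ext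
    intro j
    simp only [AlgHom.comp_apply, ph_X, map_smul, map_sum, map_pow, rename_X]
    congr 1
    exact Equiv.sum_comp σ fun b => (X b : MvPolynomial ι K) ^ (j : ℕ)
  exact congrArg (fun D => D f) this

theorem sw_ph (κ : K) (a b : ι) (f : SA K) : sw K a b (ph ι κ f) = ph ι κ f := rename_ph _ _ _

theorem ev_sw (κ : K) (a b : ι) (v : VV K) : ev κ b v = sw K a b (ev κ a v) := by
  have : ev κ b = (sw K a b).toLinearMap.comp (ev κ a) := by
    apply linV_ext
    intro i f
    simp [ev_monomial, sw_ph, sw_X_left]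
  exact congrArg (fun D => D v) this

theorem ev_dl (α κ : K) (a : ι) (f : SA K) :
    κ • ev κ a (dl α f) = α • (X a * pderiv a (ph ι κ f)) := by
  induction f using MvPolynomial.induction_on with
  | C c => simp [ph]
  | add p q hp hq => simp only [map_add, smul_add, hp, hq, mul_add]
  | mul_X p j ih =>
    have h1 : dl α (p * X j) = Polynomial.C p * ((α * (j : ℕ)) • Polynomial.X ^ (j : ℕ))
        + Polynomial.C (X j) * dl α p := by
      rw [Derivation.leibniz, dl_X, ← Polynomial.smul_eq_C_mul, ← Polynomial.smul_eq_C_mul]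
    have h2 : pderiv a (ph ι κ (X j)) = (κ * (j : ℕ)) • X a ^ ((j : ℕ) - 1) := by
      rw [ph_X, Derivation.map_smul, map_sum, Finset.sum_eq_single a]
      · rw [Derivation.leibniz_pow, pderiv_X_self]
        simp [mul_smul, smul_eq_C_mul]
      · intro b _ hb
        rw [Derivation.leibniz_pow, pderiv_X_of_ne hb]; simp
      · simp
    have h3 : (X a : MvPolynomial ι K) * X a ^ ((j : ℕ) - 1) = X a ^ (j : ℕ) := by
      rw [← pow_succ', Nat.sub_add_cancel j.pos]
    rw [h1, map_add, ev_mul, ev_mul, ev_C, ev_C, map_smul, ev_X_pow, map_mul, Derivation.leibniz, h2]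
    simp only [smul_add, smul_eq_mul, mul_add]
    rw [← h3]
    simp only [smul_eq_C_mul, map_mul] at ih ⊢
    linear_combination (ph ι κ (X j)) * ih

/-- image of `𝓛` -/
def Xi (c κ : K) (a : ι) (g : MvPolynomial ι K) : MvPolynomial ι K :=
  c • (X a * pderiv a g) + κ • ∑ b, X b * dd a b g

theorem dd_ph_pow {κ : K} {a b : ι} (h : a ≠ b) (f : SA K) (i : ℕ) :
    dd a b (ph ι κ f * X a ^ i) = ph ι κ f * ∑ j ∈ Finset.range i, X b ^ j * X a ^ (i - 1 - j) := by
  apply dd_unique h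
  rw [map_mul, sw_ph, map_pow, sw_X_left]
  have := (Commute.all (X b : MvPolynomial ι K) (X a)).mul_geom_sum₂ i
  linear_combination (-ph ι κ f) * this

theorem ev_Lop {α κ : K} (hκ : κ ≠ 0) (hk : κ ^ 2 + (α - 1) * κ = α) (a : ι) (v : VV K) :
    ev κ a (Lop α v) = Xi (α / κ) κ a (ev κ a v) := by
  induction v using Polynomial.induction_on' with
  | add p q hp hq =>
    rw [map_add, map_add, hp, hq, map_add]
    simp only [Xi, map_add, mul_add, smul_add, Finset.sum_add_distrib]; abel
  | monomial i f =>
    rw [Lop_monomial, map_add, map_add, ev_mul, ev_X_pow, map_sum, ev_monomial]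
    have h0 := ev_dl α κ a f
    have h1 : ev κ a (dl α f) = (α / κ) • (X a * pderiv a (ph ι κ f)) := by
      rw [div_eq_inv_mul, mul_smul, ← h0, smul_smul, inv_mul_cancel₀ hκ, one_smul]
    rw [h1, Xi, ev_monomial]
    have h2 : ∀ b, X b * dd a b (ph ι κ f * X a ^ i) = ph ι κ f *
        ∑ j ∈ Finset.range i, X b ^ (j+1) * X a ^ (i - 1 - j)
        - if b = a then ph ι κ f * ((i : MvPolynomial ι K) * X a ^ i) else 0 := by
      intro b
      by_cases hb : b = a
      · subst hb
        rw [dd_self, if_pos rfl]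
        have : ∀ j ∈ Finset.range i, (X b : MvPolynomial ι K) ^ (j+1) * X b ^ (i - 1 - j) = X b ^ i := by
          intro j hj
          have := Finset.mem_range.1 hj
          rw [← pow_add]; congr 1; omega
        rw [Finset.sum_congr rfl this]; simp
      · rw [dd_ph_pow (Ne.symm hb), if_neg hb, sub_zero, mul_left_comm, Finset.mul_sum]
        congr 1
        exact Finset.sum_congr rfl fun j _ => by ring
    simp only [h2, Finset.sum_sub_distrib, Finset.sum_ite_eq', Finset.mem_univ, if_true]
    simp only [ev_monomial, map_mul, ph_X, Nat.succPNat_coe, Nat.succ_eq_add_one]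
    have h3 : ∑ x ∈ Finset.range i, (κ • ∑ a_1 : ι, X a_1 ^ (x + 1)) * ph ι κ f * X a ^ (i - 1 - x)
      = κ • ∑ b : ι, ph ι κ f * ∑ j ∈ Finset.range i, X b ^ (j+1) * X a ^ (i - 1 - j) := by
      simp only [Finset.mul_sum, Finset.smul_sum, Finset.sum_mul]
      rw [Finset.sum_comm]
      refine Finset.sum_congr rfl fun b _ => Finset.sum_congr rfl fun j _ => ?_
      simp only [smul_eq_C_mul]; ring
    rw [h3, Derivation.leibniz, Derivation.leibniz_pow, pderiv_X_self]
    have h4 : (α - 1) * (i : K) = (α / κ) * i - κ * i := by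
      field_simp; linear_combination (i : K) * hk
    rw [map_smul, h4]
    rcases i with _ | i
    · simp [smul_eq_C_mul]
    · simp only [smul_eq_C_mul, smul_eq_mul, nsmul_eq_mul, map_sub, map_mul, Nat.add_sub_cancel,
        map_natCast]
      ring

theorem ph_Lop_zero (α κ : K) (v : VV K) :
    ph ι κ ((Lop α v).coeff 0) = κ • ∑ a : ι, ev κ a v - (κ * Fintype.card ι) • ph ι κ (v.coeff 0) := by
  induction v using Polynomial.induction_on' with
  | add p q hp hq =>
    simp only [map_add, Polynomial.coeff_add, hp, hq, smul_add, Finset.sum_add_distrib]; abel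
  | monomial i f =>
    rcases Nat.eq_zero_or_pos i with h | h
    · subst h
      rw [Lop_coeff_self]
      simp [ev_monomial, ev_C, mul_smul, smul_eq_C_mul]
    · obtain ⟨j, rfl⟩ : ∃ j : ℕ+, i = j := ⟨⟨i, h⟩, rfl⟩
      have := Lop_coeff_lt α 0 j f
      rw [zero_add] at this
      rw [this, map_mul, ph_X, Polynomial.coeff_monomial, if_neg j.ne_zero]
      simp only [ev_monomial, map_zero, smul_zero, sub_zero, smul_mul_assoc, Finset.sum_mul]
      congr 1
      exact Finset.sum_congr rfl fun _ _ => mul_comm _ _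

theorem ev_dvX (κ : K) (a : ι) (w : VV K) :
    X a * ev κ a (dvX w) = ev κ a w - ph ι κ (w.coeff 0) := by
  have := congrArg (ev κ a) (Polynomial.divX_mul_X_add w)
  rw [map_add, ev_mul, ev_X, ev_C] at this
  rw [← this]; change X a * ev κ a (Polynomial.divX w) = _; ring

theorem ev_step {α κ : K} (hκ : κ ≠ 0) (hk : κ ^ 2 + (α - 1) * κ = α) (a : ι) (v : VV K) :
    ev κ a (dvX (Lop α v + (κ * Fintype.card ι) • v)) = Du (α / κ) κ a (ev κ a v) := by
  apply mul_left_cancel₀ (X_ne_zero a : (X a : MvPolynomial ι K) ≠ 0)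
  rw [ev_dvX, Polynomial.coeff_add, map_add, map_add, ph_Lop_zero, ev_Lop hκ hk, map_smul,
    Polynomial.coeff_smul, map_smul, Xi, Du_apply]
  have h1 : ∑ b : ι, ev κ b v = ∑ b : ι, (ev κ a v - (X a - X b) * dd a b (ev κ a v)) := by
    refine Finset.sum_congr rfl fun b _ => ?_
    rw [dd_spec, ev_sw κ a b]; ring
  rw [h1, Finset.sum_sub_distrib]
  simp only [sub_mul, Finset.sum_sub_distrib, Finset.sum_const, Finset.card_univ, ← Finset.mul_sum]
  simp only [smul_eq_C_mul, map_mul, nsmul_eq_mul, map_natCast]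
  ring

theorem dd_ph (κ : K) (a b : ι) (f : SA K) : dd a b (ph ι κ f) = 0 := by
  by_cases h : a = b
  · subst h; exact dd_self _ _
  · exact dd_unique h (by rw [sw_ph]; simp)

theorem Du_ph (c κ : K) (a : ι) (f : SA K) : Du c κ a (ph ι κ f) = c • pderiv a (ph ι κ f) := by
  simp [Du_apply, dd_ph]

theorem ev_dvX_dl {α κ : K} (hκ : κ ≠ 0) (a : ι) (f : SA K) :
    ev κ a (dvX (dl α f)) = Du (α / κ) κ a (ph ι κ f) := by
  apply mul_left_cancel₀ (X_ne_zero a : (X a : MvPolynomial ι K) ≠ 0)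
  rw [ev_dvX, dl_coeff_zero, map_zero, sub_zero, Du_ph, mul_smul_comm, div_eq_inv_mul, mul_smul,
    ← ev_dl, smul_smul, inv_mul_cancel₀ hκ, one_smul]

theorem ph_bU {α κ : K} (hκ : κ ≠ 0) (hk : κ ^ 2 + (α - 1) * κ = α) (n : ℕ) (f : SA K) :
    ph ι κ (bU α (κ * Fintype.card ι) (n+1) f)
      = (κ / α) • Psi (α / κ) κ (psum ι K (n+1)) (ph ι κ f) := by
  set L : Module.End K (VV K) := Lop α + (κ * (Fintype.card ι : K)) • LinearMap.id with hL
  have h1 : ∀ (m : ℕ), ((L ∘ₗ dvX : Module.End K (VV K)) ^ (m+1)) =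
      L * (dvX ∘ₗ L : Module.End K (VV K)) ^ m * dvX := by
    intro m
    have e1 : (L ∘ₗ dvX : Module.End K (VV K)) = L * dvX := rfl
    have e2 : (dvX ∘ₗ L : Module.End K (VV K)) = dvX * L := rfl
    rw [e1, e2, pow_succ, ← mul_assoc, mul_pow_mul]
  have h2 : ∀ (a : ι) m v, ev κ a (((dvX ∘ₗ L : Module.End K (VV K)) ^ m) v) = (Du (α/κ) κ a ^ m) (ev κ a v) := by
    intro a m
    induction m with
    | zero => intro v; simp
    | succ m ih =>
      intro v
      rw [pow_succ', pow_succ', Module.End.mul_apply, Module.End.mul_apply, ← ih]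
      exact ev_step hκ hk a _
  have h3 : ∀ v, ph ι κ ((L v).coeff 0) = κ • ∑ a : ι, ev κ a v := by
    intro v
    simp only [hL, LinearMap.add_apply, LinearMap.smul_apply, LinearMap.id_apply,
      Polynomial.coeff_add, Polynomial.coeff_smul, map_add, map_smul, ph_Lop_zero]
    abel
  have h4 : bU α (κ * Fintype.card ι) (n+1) f = α⁻¹ • (L (((dvX ∘ₗ L : Module.End K (VV K)) ^ n) (dvX (dl α f)))).coeff 0 := by
    rw [bU, ← hL, h1]; rfl
  rw [h4, map_smul, h3, psum, map_sum, LinearMap.sum_apply, smul_smul, ← div_eq_inv_mul]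
  congr 1
  refine Finset.sum_congr rfl fun a _ => ?_
  rw [h2, ev_dvX_dl hκ, map_pow, Psi_X, pow_succ, Module.End.mul_apply]

/-- weights at most `d` -/
def Le (K : Type*) [Field K] (d : ℕ) : Submodule K (SA K) where
  carrier := {f | ∀ m, coeff m f ≠ 0 → wg m ≤ d}
  add_mem' := by
    intro a b ha hb m hm
    by_cases h : coeff m a = 0
    · exact hb m (by simpa [h] using hm)
    · exact ha m h
  zero_mem' := by intro m hm; simp at hm
  smul_mem' := by
    intro c a ha m hm
    exact ha m (by intro h; simp [h] at hm)

theorem AH_Le {k d e : ℕ} (h : d ≤ e + k) {f : SA K} (hf : f ∈ AH K k d) : f ∈ Le K e := by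
  intro m hm; have := hf m hm; omega

theorem pderiv_all_zero {f : SA K} (h : ∀ j, pderiv j f = 0) : f = C (coeff 0 f) := by
  ext m
  rw [coeff_C]
  by_cases hm : 0 = m
  · subst hm; simp
  rw [if_neg hm]
  obtain ⟨j, hj⟩ := Finsupp.ne_iff.1 (Ne.symm hm)
  have e : m - Finsupp.single j 1 + Finsupp.single j 1 = m := by
    apply tsub_add_cancel_of_le
    rw [Finsupp.single_le_iff]
    simp at hj; omega
  have h1 := congrArg (coeff (m - Finsupp.single j 1)) (h j)
  rw [coeff_pderiv, e, coeff_zero] at h1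
  exact (mul_eq_zero.1 h1).resolve_right (Nat.cast_add_one_ne_zero _)

theorem ph_inj {α κ : K} (hα : α ≠ 0) (hκ : κ ≠ 0) (d : ℕ) (hd : d ≤ Fintype.card ι) :
    ∀ f ∈ Le K d, ph ι κ f = 0 → f = 0 := by
  induction d using Nat.strong_induction_on with
  | _ d ih =>
  intro f hf h0
  have hdeg : ∀ j : ℕ+, d < j → pderiv j f = 0 := by
    intro j hj
    ext m
    rw [coeff_pderiv, coeff_zero]
    by_contra hne
    have := hf _ (left_ne_zero_of_mul hne)
    rw [wg_add, wg_single] at this; omega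
  have hz : ∀ j : ℕ+, pderiv j f = 0 := by
    intro j
    by_cases hjd : d < j
    · exact hdeg j hjd
    push Not at hjd
    have hj := j.pos
    refine ih (d - j) (by omega) (by omega) _ ?_ ?_
    · intro m hm
      rw [coeff_pderiv] at hm
      have := hf _ (left_ne_zero_of_mul hm)
      rw [wg_add, wg_single] at this; omega
    · set Q : Polynomial (MvPolynomial ι K) := (dvX (dl α f)).map (ph ι κ : SA K →+* MvPolynomial ι K) with hQ
      have hQ0 : Q = 0 := by
        refine Polynomial.eq_zero_of_natDegree_lt_card_of_eval_eq_zero Q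
          (f := fun a : ι => (X a : MvPolynomial ι K)) X_injective ?_ ?_
        · intro a
          rw [hQ, Polynomial.eval_map]
          change ev κ a _ = 0
          rw [ev_dvX_dl hκ, h0, map_zero]
        · have : Q.natDegree ≤ d - 1 := by
            rw [Polynomial.natDegree_le_iff_coeff_eq_zero]
            intro N hN
            rw [hQ, Polynomial.coeff_map]
            change _root_.id (ph ι κ ((Polynomial.divX (dl α f)).coeff N)) = 0
            rw [Polynomial.coeff_divX]
            have := dl_coeff α f (Nat.succPNat N)
            rw [Nat.succPNat_coe] at this
            rw [this, hdeg _ (by rw [Nat.succPNat_coe]; omega)]; simp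
          omega
      have hc := congrArg (fun q => q.coeff ((j : ℕ) - 1)) hQ0
      simp only [hQ, Polynomial.coeff_map, Polynomial.coeff_zero] at hc
      change ph ι κ ((Polynomial.divX (dl α f)).coeff _) = 0 at hc
      rw [Polynomial.coeff_divX, Nat.sub_add_cancel hj, dl_coeff, map_smul] at hc
      refine (smul_eq_zero.1 hc).resolve_left ?_
      exact mul_ne_zero hα (by exact_mod_cast j.ne_zero)
  have hf' := pderiv_all_zero hz
  rw [hf'] at h0 ⊢
  have : C (coeff 0 f) = (0 : MvPolynomial ι K) := by rw [← h0]; simp [ph]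
  rw [C_eq_zero] at this
  rw [this, C_0]

end spec
end JP

namespace JP
open MvPolynomial

section poly
variable {K : Type*} [Field K] [CharZero K]

/-- polynomial functions with values in a vector space -/
def PolyF {M : Type*} [AddCommGroup M] [Module K M] (g : K → M) : Prop :=
  ∃ (N : ℕ) (c : ℕ → M), ∀ u, g u = ∑ i ∈ Finset.range N, u ^ i • c i

variable {M M' M'' : Type*} [AddCommGroup M] [Module K M] [AddCommGroup M'] [Module K M']
  [AddCommGroup M''] [Module K M'']

theorem PolyF.congr {g h : K → M} (hg : PolyF g) (e : ∀ u, h u = g u) : PolyF h := by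
  obtain ⟨N, c, hc⟩ := hg
  exact ⟨N, c, fun u => by rw [e, hc]⟩

theorem PolyF.const (x : M) : PolyF (fun _ : K => x) := ⟨1, fun _ => x, by simp⟩

theorem PolyF.pow_smul_const (x : M) (k : ℕ) : PolyF (fun u : K => u ^ k • x) :=
  ⟨k + 1, fun i => if i = k then x else 0, fun u => by simp⟩

theorem polyF_extend {N N' : ℕ} (h : N ≤ N') (c : ℕ → M) (u : K) :
    ∑ i ∈ Finset.range N, u ^ i • c i
      = ∑ i ∈ Finset.range N', u ^ i • (if i < N then c i else 0) := by
  symm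
  rw [← Finset.sum_subset (Finset.range_mono h)]
  · exact Finset.sum_congr rfl fun i hi => by rw [if_pos (Finset.mem_range.1 hi)]
  · intro i _ hi; rw [if_neg (by simpa using hi), smul_zero]

theorem PolyF.add {g h : K → M} (hg : PolyF g) (hh : PolyF h) : PolyF (fun u => g u + h u) := by
  obtain ⟨N, c, hc⟩ := hg
  obtain ⟨N', c', hc'⟩ := hh
  refine ⟨max N N', fun i => (if i < N then c i else 0) + (if i < N' then c' i else 0), fun u => ?_⟩
  show g u + h u = _
  rw [hc, hc', polyF_extend (le_max_left N N'), polyF_extend (le_max_right N N')]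
  simp only [smul_add, Finset.sum_add_distrib]

theorem PolyF.sum {ι : Type*} (s : Finset ι) {g : ι → K → M} (h : ∀ i ∈ s, PolyF (g i)) :
    PolyF (fun u => ∑ i ∈ s, g i u) := by
  induction s using Finset.induction_on with
  | empty => simpa using PolyF.const (0 : M)
  | insert a s ha ih =>
    refine PolyF.congr (PolyF.add (h a (Finset.mem_insert_self _ _))
      (ih fun i hi => h i (Finset.mem_insert_of_mem hi))) fun u => ?_
    rw [Finset.sum_insert ha]

theorem PolyF.lin {g : K → M} (L : M →ₗ[K] M') (hg : PolyF g) : PolyF (fun u => L (g u)) := by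
  obtain ⟨N, c, hc⟩ := hg
  exact ⟨N, fun i => L (c i), fun u => by show L (g u) = _; rw [hc, map_sum]; simp⟩

theorem PolyF.pow_smul {g : K → M} (k : ℕ) (hg : PolyF g) : PolyF (fun u => u ^ k • g u) := by
  obtain ⟨N, c, hc⟩ := hg
  refine PolyF.congr (PolyF.sum (Finset.range N) (g := fun i u => u ^ (k + i) • c i)
    fun i _ => PolyF.pow_smul_const _ _) fun u => ?_
  rw [hc, Finset.smul_sum]
  exact Finset.sum_congr rfl fun i _ => by rw [smul_smul, pow_add]

theorem PolyF.bilin {g : K → M} {h : K → M'} (B : M →ₗ[K] M' →ₗ[K] M'') (hg : PolyF g)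
    (hh : PolyF h) : PolyF (fun u => B (g u) (h u)) := by
  obtain ⟨N, c, hc⟩ := hg
  refine PolyF.congr (PolyF.sum (Finset.range N) (g := fun i u => u ^ i • B (c i) (h u))
    fun i _ => PolyF.pow_smul i (PolyF.lin (B (c i)) hh)) fun u => ?_
  rw [hc, map_sum, LinearMap.sum_apply]
  simp

theorem PolyF.neg {g : K → M} (hg : PolyF g) : PolyF (fun u => - g u) :=
  PolyF.lin (-LinearMap.id) hg
theorem PolyF.sub {g h : K → M} (hg : PolyF g) (hh : PolyF h) : PolyF (fun u => g u - h u) :=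
  PolyF.congr (PolyF.add hg (PolyF.neg hh)) fun u => sub_eq_add_neg _ _

theorem poly_vanish (N : ℕ) (c : ℕ → M) (S : Set K) (hS : S.Infinite)
    (h : ∀ u ∈ S, ∑ i ∈ Finset.range N, u ^ i • c i = 0) : ∀ i < N, c i = 0 := by
  intro i hi
  rw [← Module.forall_dual_apply_eq_zero_iff K]
  intro φ
  set p : Polynomial K := ∑ i ∈ Finset.range N, Polynomial.monomial i (φ (c i)) with hp
  have : p = 0 := by
    apply Polynomial.eq_zero_of_infinite_isRoot
    refine hS.mono fun u hu => ?_
    have := congrArg φ (h u hu)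
    simp only [map_sum, map_smul, smul_eq_mul, map_zero] at this
    simp only [Set.mem_setOf_eq, Polynomial.IsRoot, hp, Polynomial.eval_finset_sum, Polynomial.eval_monomial]
    rw [← this]
    exact Finset.sum_congr rfl fun _ _ => mul_comm _ _
  have h2 := congrArg (fun q => q.coeff i) this
  simp only [hp, Polynomial.finsetSum_coeff, Polynomial.coeff_monomial, Polynomial.coeff_zero] at h2
  simpa [hi] using h2

theorem PolyF.vanish {g : K → M} (hg : PolyF g) {S : Set K} (hS : S.Infinite)
    (h : ∀ u ∈ S, g u = 0) (u : K) : g u = 0 := by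
  obtain ⟨N, c, hc⟩ := hg
  have := poly_vanish N c S hS fun u hu => by rw [← hc, h u hu]
  rw [hc]
  exact Finset.sum_eq_zero fun i hi => by rw [this i (Finset.mem_range.1 hi), smul_zero]

/-- extraction of the linear coefficient -/
theorem PolyF.linear_coeff {x : M} {g : K → M} (hg : PolyF g) {S : Set K} (hS : S.Infinite)
    (h : ∀ u ∈ S, u • x + u ^ 2 • g u = 0) : x = 0 := by
  obtain ⟨N, c, hc⟩ := hg
  have := poly_vanish (N + 2) (fun i => match i with | 0 => 0 | 1 => x | (i+2) => c i) S hS (by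
    intro u hu
    have h1 := h u hu
    rw [hc, Finset.smul_sum] at h1
    rw [Finset.sum_range_succ', Finset.sum_range_succ']
    simp only [pow_zero, smul_zero, add_zero, zero_add, pow_one]
    rw [add_comm, ← h1]
    congr 1
    refine Finset.sum_congr rfl fun i _ => ?_
    rw [smul_smul, ← pow_add, add_comm 2 i])
  exact this 1 (by omega)

theorem infinite_nat : (Set.range (fun n : ℕ => (n : K))).Infinite :=
  Set.infinite_range_of_injective Nat.cast_injective

theorem infinite_negs {α : K} (hα : α ≠ 0) (d : ℕ) : (Set.range (fun n : ℕ => -α * ((n + d : ℕ) : K))).Infinite := by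
  apply Set.infinite_range_of_injective
  intro a b h
  have := mul_left_cancel₀ (neg_ne_zero.2 hα) h
  have := Nat.cast_injective this
  omega

end poly

section Wr
variable {K : Type*} [Field K] [CharZero K] {R : Type*} [Ring R] [Algebra K R]

/-- coefficients of `exp (τ ∑ b_i t^{i+1}/(i+1))` -/
def Wr (b : ℕ → R) (τ : K) : ℕ → R
  | 0 => 1
  | (Nat.succ k) => (((Nat.cast k : K) + 1)⁻¹ * τ) • ∑ i : Fin (k+1), b i * Wr b τ (k - i)

theorem Wr_zero (b : ℕ → R) (τ : K) : Wr b τ 0 = 1 := by rw [Wr]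
theorem Wr_succ (b : ℕ → R) (τ : K) (k : ℕ) : Wr b τ (k+1) =
    (((k : K) + 1)⁻¹ * τ) • ∑ i ∈ Finset.range (k+1), b i * Wr b τ (k - i) := by
  rw [Wr, Finset.sum_range]

theorem Wr_succ' (b : ℕ → R) (τ : K) (k : ℕ) : ((k : K) + 1) • Wr b τ (k+1) =
    τ • ∑ i ∈ Finset.range (k+1), b i * Wr b τ (k - i) := by
  rw [Wr_succ, smul_smul, mul_inv_cancel_left₀ (Nat.cast_add_one_ne_zero k)]

theorem Wr_unique (b : ℕ → R) (τ : K) (w : ℕ → R) (h0 : w 0 = 1)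
    (h : ∀ k : ℕ, ((k : K) + 1) • w (k+1) = τ • ∑ i ∈ Finset.range (k+1), b i * w (k - i)) (k : ℕ) :
    w k = Wr b τ k := by
  induction k using Nat.strong_induction_on with
  | _ k ih =>
  cases k with
  | zero => rw [h0, Wr_zero]
  | succ k =>
    have hne : ((k : K) + 1) ≠ 0 := Nat.cast_add_one_ne_zero k
    have : ((k : K) + 1) • w (k+1) = ((k : K) + 1) • Wr b τ (k+1) := by
      rw [h, Wr_succ']
      congr 1
      exact Finset.sum_congr rfl fun i _ => by rw [ih (k - i) (by omega)]
    have h2 := congrArg (fun z => ((k : K) + 1)⁻¹ • z) this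
    simpa [smul_smul, inv_mul_cancel₀ hne] using h2

theorem Wr_map {R' : Type*} [Ring R'] [Algebra K R'] (g : R →ₐ[K] R') (b : ℕ → R) (τ : K) (k : ℕ) :
    g (Wr b τ k) = Wr (fun i => g (b i)) τ k := by
  refine Wr_unique (fun i => g (b i)) τ (fun k => g (Wr b τ k)) (by simp [Wr_zero]) (fun k => ?_) k
  rw [← map_smul, Wr_succ', map_smul, map_sum]
  simp

theorem Wr_add_comm {S : Type*} [CommRing S] [Algebra K S] (b : ℕ → S) (τ σ : K) (k : ℕ) :
    ∑ x ∈ Finset.HasAntidiagonal.antidiagonal k, Wr b τ x.1 * Wr b σ x.2 = Wr b (τ + σ) k := by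
  refine Wr_unique b (τ + σ) (fun k => ∑ x ∈ Finset.HasAntidiagonal.antidiagonal k, Wr b τ x.1 * Wr b σ x.2)
    (by simp [Wr_zero]) (fun k => ?_) k
  set B : PowerSeries S := PowerSeries.mk b with hB
  have hd : ∀ τ : K, PowerSeries.derivative S (PowerSeries.mk (Wr b τ))
      = algebraMap K (PowerSeries S) τ * (B * PowerSeries.mk (Wr b τ)) := by
    intro τ
    ext k
    have h1 := Wr_succ' b τ k
    rw [PowerSeries.coeff_derivative, PowerSeries.coeff_mk]
    have h3 : algebraMap K (PowerSeries S) τ * (B * PowerSeries.mk (Wr b τ))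
      = τ • (B * PowerSeries.mk (Wr b τ)) := (Algebra.smul_def _ _).symm
    rw [h3, PowerSeries.coeff_smul, PowerSeries.coeff_mul,
      Finset.Nat.sum_antidiagonal_eq_sum_range_succ_mk]
    simp only [hB, PowerSeries.coeff_mk]
    rw [← h1, Algebra.smul_def]
    simp [mul_comm]
  have hprod := Derivation.leibniz (PowerSeries.derivative S) (PowerSeries.mk (Wr b τ)) (PowerSeries.mk (Wr b σ))
  rw [hd, hd] at hprod
  have h4 : (PowerSeries.mk (Wr b τ)) • (algebraMap K (PowerSeries S) σ * (B * PowerSeries.mk (Wr b σ)))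
     + (PowerSeries.mk (Wr b σ)) • (algebraMap K (PowerSeries S) τ * (B * PowerSeries.mk (Wr b τ)))
     = (τ + σ) • (B * (PowerSeries.mk (Wr b τ) * PowerSeries.mk (Wr b σ))) := by
    rw [Algebra.smul_def (τ + σ), map_add]; simp only [smul_eq_mul]; ring
  rw [h4] at hprod
  have h5 := congrArg (PowerSeries.coeff k) hprod
  rw [PowerSeries.coeff_derivative, PowerSeries.coeff_smul, PowerSeries.coeff_mul, PowerSeries.coeff_mul] at h5
  simp only [hB, PowerSeries.coeff_mk, PowerSeries.coeff_mul] at h5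
  rw [Finset.Nat.sum_antidiagonal_eq_sum_range_succ (f := fun a c => b a * ∑ x ∈ Finset.HasAntidiagonal.antidiagonal c, Wr b τ x.1 * Wr b σ x.2) k] at h5
  rw [← h5, Algebra.smul_def]
  simp [mul_comm]

theorem Wr_add (b : ℕ → R) (hb : ∀ i j, b i * b j = b j * b i) (τ σ : K) (k : ℕ) :
    ∑ x ∈ Finset.HasAntidiagonal.antidiagonal k, Wr b τ x.1 * Wr b σ x.2 = Wr b (τ + σ) k := by
  let S := Algebra.adjoin K (Set.range b)
  letI : CommRing S := Algebra.adjoinCommRingOfComm K (by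
    rintro _ ⟨i, rfl⟩ _ ⟨j, rfl⟩; exact hb i j)
  let b' : ℕ → S := fun i => ⟨b i, Algebra.subset_adjoin ⟨i, rfl⟩⟩
  have h := congrArg S.val (Wr_add_comm b' τ σ k)
  have e : ∀ τ k, S.val (Wr b' τ k) = Wr b τ k := fun τ k => Wr_map S.val b' τ k
  rw [map_sum, e] at h
  rw [← h]
  refine Finset.sum_congr rfl fun x _ => ?_
  rw [map_mul, e, e]

theorem Wr_poly0 (b : ℕ → R) (k : ℕ) :
    ∃ g : K → R, PolyF g ∧ ∀ τ, Wr b τ k = (if k = 0 then 1 else 0) + τ • g τ := by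
  induction k using Nat.strong_induction_on with
  | _ k ih =>
  cases k with
  | zero => exact ⟨fun _ => 0, PolyF.const _, fun τ => by simp [Wr_zero]⟩
  | succ k =>
    refine ⟨fun τ => ((k : K) + 1)⁻¹ • ∑ i ∈ Finset.range (k+1), b i * Wr b τ (k - i), ?_, fun τ => ?_⟩
    · refine PolyF.lin (((k : K) + 1)⁻¹ • (LinearMap.id : R →ₗ[K] R)) (PolyF.sum (Finset.range (k+1)) (g := fun i τ => b i * Wr b τ (k - i)) fun i hi => ?_)
      obtain ⟨g, hg, e⟩ := ih (k - i) (by omega)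
      refine PolyF.lin (LinearMap.mulLeft K (b i)) (PolyF.congr (PolyF.add (PolyF.const (if k - i = 0 then 1 else 0)) (PolyF.pow_smul 1 hg)) fun u => ?_)
      rw [e, pow_one]
    · rw [Wr_succ, if_neg (Nat.succ_ne_zero k), zero_add, mul_comm, mul_smul]

theorem Wr_poly (b : ℕ → R) (k : ℕ) :
    ∃ g : K → R, PolyF g ∧ ∀ τ, Wr b τ (k+1) = τ • (((k : K) + 1)⁻¹ • b k) + τ ^ 2 • g τ := by
  choose g hg e using Wr_poly0 (K := K) b
  refine ⟨fun τ => ((k : K) + 1)⁻¹ • ∑ i ∈ Finset.range (k+1), b i * g (k - i) τ, ?_, fun τ => ?_⟩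
  · exact PolyF.lin (((k : K) + 1)⁻¹ • (LinearMap.id : R →ₗ[K] R)) (PolyF.sum (Finset.range (k+1)) (g := fun i τ => b i * g (k - i) τ) fun i hi =>
      PolyF.lin (LinearMap.mulLeft K (b i)) (hg _))
  · rw [Wr_succ]
    simp only [e, mul_add, Finset.sum_add_distrib]
    rw [Finset.sum_eq_single k]
    · simp only [Nat.sub_self, if_true, mul_one, smul_add, smul_smul, mul_smul_comm, ← Finset.smul_sum]
      congr 2 <;> ring
    · intro i hi hne
      have := Finset.mem_range.1 hi
      rw [if_neg (by omega), mul_zero]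
    · simp

end Wr
end JP

namespace JP
open MvPolynomial

section ops
variable {K : Type*} [Field K] [CharZero K]

theorem exists_Le (f : SA K) : ∃ d, f ∈ Le K d := by
  refine ⟨f.support.sup wg, fun m hm => ?_⟩
  exact Finset.le_sup (f := wg) (mem_support_iff.2 hm)

theorem Le_mono {d e : ℕ} (h : d ≤ e) {f : SA K} (hf : f ∈ Le K d) : f ∈ Le K e :=
  fun m hm => (hf m hm).trans h

theorem as_sum_smul (f : SA K) : f = ∑ m ∈ f.support, coeff m f • monomial m (1 : K) := by
  conv_lhs => rw [f.as_sum]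
  exact Finset.sum_congr rfl fun m _ => by rw [smul_monomial, smul_eq_mul, mul_one]

theorem low_Le {n : ℕ} {T : Module.End K (SA K)} (hT : Low n T) {d e : ℕ} (h : d ≤ e + n) {f : SA K}
    (hf : f ∈ Le K d) : T f ∈ Le K e := by
  rw [as_sum_smul f, map_sum]
  refine Submodule.sum_mem _ fun m hm => ?_
  rw [map_smul]
  refine Submodule.smul_mem _ _ ?_
  have := hf m (mem_support_iff.1 hm)
  exact AH_Le (by omega) (hT 0 (wg m) _ (AH_monomial m 1 (by omega)))

theorem low_Le_zero {n : ℕ} {T : Module.End K (SA K)} (hT : Low n T) {d : ℕ} (h : d < n) {f : SA K}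
    (hf : f ∈ Le K d) : T f = 0 := by
  rw [as_sum_smul f, map_sum]
  refine Finset.sum_eq_zero fun m hm => ?_
  have := hf m (mem_support_iff.1 hm)
  rw [map_smul, AH_eq_zero (by omega) (hT 0 (wg m) _ (AH_monomial m 1 (by omega))), smul_zero]

theorem bU_poly (α : K) (n : ℕ) : PolyF (fun u : K => bU α u n) :=
  ⟨n + 1, fun ℓ => bdc α n ℓ, fun u => bU_eq α u n (n+1) (by omega)⟩

theorem hk_neg (α : K) : (-α) ^ 2 + (α - 1) * (-α) = α := by ring

theorem ph_bU' {α : K} (hα : α ≠ 0) {ι : Type*} [Fintype ι] (n : ℕ) (f : SA K) :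
    ph ι (-α) (bU α (-α * Fintype.card ι) (n+1) f)
      = - Psi (-1) (-α) (psum ι K (n+1)) (ph ι (-α) f) := by
  rw [ph_bU (neg_ne_zero.2 hα) (hk_neg α), neg_div, div_self hα, div_neg, div_self hα, neg_smul, one_smul]

theorem bU_bU_Le (α u : K) (a b : ℕ) {d : ℕ} {f : SA K} (hf : f ∈ Le K d) :
    bU α u a (bU α u b f) ∈ Le K d := by
  have h1 : bU α u b f ∈ Le K d := low_Le (bU_low α u b) (Nat.le_add_right d b) hf
  exact low_Le (bU_low α u a) (Nat.le_add_right d a) h1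

theorem bU_comm_spec {α : K} (hα : α ≠ 0) (s n m d : ℕ) (hs : d ≤ s) {f : SA K} (hf : f ∈ Le K d) :
    bU α (-α * s) (n+1) (bU α (-α * s) (m+1) f) - bU α (-α * s) (m+1) (bU α (-α * s) (n+1) f) = 0 := by
  refine ph_inj (ι := Fin s) hα (neg_ne_zero.2 hα) d (by simpa using hs) _
    (sub_mem (bU_bU_Le _ _ _ _ hf) (bU_bU_Le _ _ _ _ hf)) ?_
  have h2 := fun a => ph_bU' hα (ι := Fin s) a
  simp only [Fintype.card_fin] at h2
  rw [map_sub, h2, h2, h2, h2, map_neg, map_neg, Psi_comm, sub_self]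

theorem bU_comm_poly (α : K) (n m : ℕ) (f : SA K) :
    PolyF (fun u => bU α u (n+1) (bU α u (m+1) f)) :=
  PolyF.congr (PolyF.lin (LinearMap.applyₗ f) (PolyF.bilin (LinearMap.mul K (Module.End K (SA K))) (bU_poly α (n+1)) (bU_poly α (m+1))))
    fun u => rfl

theorem bU_comm {α : K} (hα : α ≠ 0) (u : K) (n m : ℕ) :
    bU α u (n+1) * bU α u (m+1) = bU α u (m+1) * bU α u (n+1) := by
  refine LinearMap.ext fun f => ?_
  obtain ⟨d, hd⟩ := exists_Le f
  have key := PolyF.vanish (PolyF.sub (bU_comm_poly α n m f) (bU_comm_poly α m n f)) (infinite_negs hα d) (by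
      rintro _ ⟨s, rfl⟩
      exact bU_comm_spec hα (s+d) n m d (by omega) hd) u
  exact sub_eq_zero.1 key

def bs (α u : K) (i : ℕ) : Module.End K (SA K) := (-1 : K) ^ (i+1) • bU α u (i+1)

theorem bs_comm {α : K} (hα : α ≠ 0) (u : K) (i j : ℕ) : bs α u i * bs α u j = bs α u j * bs α u i := by
  simp only [bs, smul_mul_smul_comm]
  rw [bU_comm hα, mul_comm]

theorem bs_low (α u : K) (i : ℕ) : Low (i+1) (bs α u i) := low_smul _ (bU_low _ _ _)

theorem Wr_low (b : ℕ → Module.End K (SA K)) (hb : ∀ i, Low (i+1) (b i)) (τ : K) (k : ℕ) : Low k (Wr b τ k) := by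
  induction k using Nat.strong_induction_on with
  | _ k ih =>
  cases k with
  | zero => rw [Wr_zero]; exact low_one
  | succ k =>
    rw [Wr_succ]
    refine low_smul _ (low_sum _ _ fun i hi => ?_)
    have := Finset.mem_range.1 hi
    have := low_mul (hb i) (ih (k - i) (by omega))
    convert this using 1
    omega

theorem Wr_polyb {R : Type*} [Ring R] [Algebra K R] (b : K → ℕ → R) (hb : ∀ i, PolyF (fun u => b u i)) (τ : K) (k : ℕ) :
    PolyF (fun u => Wr (b u) τ k) := by
  induction k using Nat.strong_induction_on with
  | _ k ih =>
  cases k with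
  | zero => exact PolyF.congr (PolyF.const 1) fun u => Wr_zero _ _
  | succ k =>
    refine PolyF.congr (PolyF.lin (((((k:ℕ) : K) + 1)⁻¹ * τ) • (LinearMap.id : R →ₗ[K] R)) (PolyF.sum (Finset.range (k+1))
      (g := fun i u => b u i * Wr (b u) τ (k - i)) fun i hi => ?_)) fun u => Wr_succ _ _ _
    exact PolyF.bilin (LinearMap.mul K R) (hb i) (ih (k - i) (by omega))

/-- `W_k` -/
def W (α u τ : K) (k : ℕ) : Module.End K (SA K) := Wr (bs α u) τ k

theorem W_low (α u τ : K) (k : ℕ) : Low k (W α u τ k) := Wr_low _ (bs_low α u) τ k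
theorem W_poly (α τ : K) (k : ℕ) : PolyF (fun u => W α u τ k) :=
  Wr_polyb _ (fun i => PolyF.lin ((-1 : K) ^ (i+1) • (LinearMap.id : Module.End K (SA K) →ₗ[K] _)) (bU_poly α (i+1))) τ k
theorem W_zero (α u τ : K) : W α u τ 0 = 1 := Wr_zero _ _

theorem ph_W {α : K} (hα : α ≠ 0) {ι : Type*} [Fintype ι] (k : ℕ) (f : SA K) :
    ph ι (-α) (W α (-α * Fintype.card ι) 1 k f) = Psi (-1) (-α) (esymm ι K k) (ph ι (-α) f) := by
  induction k using Nat.strong_induction_on with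
  | _ k ih =>
  cases k with
  | zero => simp [W_zero]
  | succ k =>
    have hne : ((k : K) + 1) ≠ 0 := Nat.cast_add_one_ne_zero k
    have e1 : ((k : K) + 1) • W α (-α * Fintype.card ι) 1 (k+1) f = ((k : K) + 1) • Wr (bs α (-α * (Fintype.card ι : K))) (1 : K) (k+1) f := rfl
    have e2 : ((k : K) + 1) • ph ι (-α) (W α (-α * Fintype.card ι) 1 (k+1) f)
        = ((k : K) + 1) • Psi (-1) (-α) (esymm ι K (k+1)) (ph ι (-α) f) := by
      rw [← map_smul, e1, ← LinearMap.smul_apply, Wr_succ', one_smul, LinearMap.sum_apply, map_sum]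
      have e3 : ((k : K) + 1) • Psi (-1) (-α) (esymm ι K (k+1)) (ph ι (-α) f)
        = Psi (-1) (-α) (((k : MvPolynomial ι K) + 1) * esymm ι K (k+1)) (ph ι (-α) f) := by
        rw [Psi_mul, show ((k : MvPolynomial ι K) + 1) = C ((k : K) + 1) by simp, Psi_C]
      rw [e3, newton, map_sum, LinearMap.sum_apply]
      refine Finset.sum_congr rfl fun i hi => ?_
      rw [Module.End.mul_apply, bs, LinearMap.smul_apply, map_smul, ph_bU' hα]
      rw [show Wr (bs α (-α * (Fintype.card ι : K))) (1 : K) (k - i) = W α (-α * Fintype.card ι) 1 (k - i) from rfl, ih _ (by omega),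
        Psi_mul, Psi_comm _ _ _ (psum _ _ _), Psi_mul, Psi_comm,
        show ((-1 : MvPolynomial ι K) ^ i) = C ((-1 : K) ^ i) by simp, Psi_C, Psi_comm, pow_succ]
      simp
    have h2 := congrArg (fun z => ((k : K) + 1)⁻¹ • z) e2
    simpa [smul_smul, inv_mul_cancel₀ hne] using h2

/-! locally finite sums -/
def locSum (T : ℕ → Module.End K (SA K)) : Module.End K (SA K) :=
  (basisMonomials ℕ+ K).constr K fun m => ∑ k ∈ Finset.range (wg m + 1), T k (monomial m 1)

theorem locSum_monomial (T : ℕ → Module.End K (SA K)) (m : ℕ+ →₀ ℕ) :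
    locSum T (monomial m 1) = ∑ k ∈ Finset.range (wg m + 1), T k (monomial m 1) := by
  have := (basisMonomials ℕ+ K).constr_basis K (fun m => ∑ k ∈ Finset.range (wg m + 1), T k (monomial m 1)) m
  rw [locSum]
  rwa [coe_basisMonomials] at this

theorem locSum_eq {T : ℕ → Module.End K (SA K)} (hT : ∀ k, Low k (T k)) {d N : ℕ} (h : d < N) {f : SA K}
    (hf : f ∈ Le K d) : locSum T f = ∑ k ∈ Finset.range N, T k f := by
  conv_lhs => rw [as_sum_smul f]
  conv_rhs => rw [as_sum_smul f]
  simp only [map_sum]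
  rw [Finset.sum_comm]
  refine Finset.sum_congr rfl fun m hm => ?_
  simp only [map_smul]
  rw [← Finset.smul_sum, locSum_monomial]
  congr 1
  have := hf m (mem_support_iff.1 hm)
  apply Finset.sum_subset (Finset.range_mono (by omega))
  intro k _ hk
  rw [Finset.mem_range, not_lt] at hk
  exact low_Le_zero (hT k) (d := wg m) (by omega) (AH_Le (k := 0) (le_refl _) (AH_monomial m 1 rfl))

def Zop (α u τ : K) : Module.End K (SA K) := locSum (W α u τ)
def Xc (α : K) (ℓ n : ℕ) : Module.End K (SA K) := ((-1 : K) ^ n / (n : K)) • bdc α n ℓ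
def Xop (α : K) (ℓ : ℕ) : Module.End K (SA K) := locSum (Xc α ℓ)
def XUc (α u : K) (n : ℕ) : Module.End K (SA K) := ((-1 : K) ^ n / (n : K)) • bU α u n
def XU (α u : K) : Module.End K (SA K) := locSum (XUc α u)

theorem Xc_low (α : K) (ℓ n : ℕ) : Low n (Xc α ℓ n) := low_smul _ (bdc_low _ _ _)
theorem XUc_low (α u : K) (n : ℕ) : Low n (XUc α u n) := low_smul _ (bU_low _ _ _)

theorem Zop_eq (α u τ : K) {d N : ℕ} (h : d < N) {f : SA K} (hf : f ∈ Le K d) :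
    Zop α u τ f = ∑ k ∈ Finset.range N, W α u τ k f := locSum_eq (W_low α u τ) h hf
theorem Xop_eq (α : K) (ℓ : ℕ) {d N : ℕ} (h : d < N) {f : SA K} (hf : f ∈ Le K d) :
    Xop α ℓ f = ∑ k ∈ Finset.range N, Xc α ℓ k f := locSum_eq (Xc_low α ℓ) h hf
theorem XU_eq (α u : K) {d N : ℕ} (h : d < N) {f : SA K} (hf : f ∈ Le K d) :
    XU α u f = ∑ k ∈ Finset.range N, XUc α u k f := locSum_eq (XUc_low α u) h hf

theorem Zop_Le (α u τ : K) {d : ℕ} {f : SA K} (hf : f ∈ Le K d) : Zop α u τ f ∈ Le K d := by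
  rw [Zop_eq α u τ (Nat.lt_succ_self d) hf]
  exact Submodule.sum_mem _ fun k _ => low_Le (W_low _ _ _ _) (by omega) hf

theorem sum_tri {M : Type*} [AddCommMonoid M] (N : ℕ) (G : ℕ × ℕ → M) (h : ∀ x, N ≤ x.1 + x.2 → G x = 0) :
    ∑ j ∈ Finset.range N, ∑ k ∈ Finset.range N, G (j, k)
      = ∑ n ∈ Finset.range N, ∑ x ∈ Finset.HasAntidiagonal.antidiagonal n, G x := by
  rw [← Finset.sum_product']
  rw [← Finset.sum_filter_of_ne (p := fun x : ℕ × ℕ => x.1 + x.2 < N)]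
  · rw [← Finset.sum_fiberwise_of_maps_to (t := Finset.range N) (g := fun x : ℕ × ℕ => x.1 + x.2)]
    · refine Finset.sum_congr rfl fun n hn => ?_
      refine Finset.sum_congr ?_ fun _ _ => rfl
      ext x
      simp only [Finset.mem_filter, Finset.mem_product, Finset.mem_range, Finset.HasAntidiagonal.mem_antidiagonal] at hn ⊢
      omega
    · intro x hx
      simpa using (Finset.mem_filter.1 hx).2
  · intro x _ hx
    by_contra h'
    exact hx (h x (by omega))

theorem Zop_add {α : K} (hα : α ≠ 0) (u τ σ : K) (f : SA K) :
    Zop α u τ (Zop α u σ f) = Zop α u (τ + σ) f := by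
  obtain ⟨d, hd⟩ := exists_Le f
  rw [Zop_eq α u τ (Nat.lt_succ_self d) (Zop_Le _ _ _ hd), Zop_eq α u (τ + σ) (Nat.lt_succ_self d) hd,
    Zop_eq α u σ (Nat.lt_succ_self d) hd]
  simp only [map_sum]
  rw [sum_tri (d+1) (fun x => W α u τ x.1 (W α u σ x.2 f))]
  · refine Finset.sum_congr rfl fun n _ => ?_
    rw [W, ← Wr_add _ (bs_comm hα u), LinearMap.sum_apply]
    rfl
  · intro x hx
    exact low_Le_zero (low_mul (W_low α u τ x.1) (W_low α u σ x.2)) (d := d) (by omega) hd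

theorem Zop_poly_u (α τ : K) (f : SA K) : PolyF (fun u => Zop α u τ f) := by
  obtain ⟨d, hd⟩ := exists_Le f
  refine PolyF.congr (PolyF.sum (Finset.range (d+1)) (g := fun k u => W α u τ k f) fun k _ => ?_)
    fun u => Zop_eq α u τ (Nat.lt_succ_self d) hd
  exact PolyF.lin (LinearMap.applyₗ f) (W_poly α τ k)

theorem Zop_expand (α u : K) (f : SA K) : ∃ g : K → SA K, PolyF g ∧
    ∀ τ, Zop α u τ f = f + τ • XU α u f + τ ^ 2 • g τ := by
  obtain ⟨d, hd⟩ := exists_Le f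
  choose g hg e using Wr_poly (K := K) (bs α u)
  refine ⟨fun τ => ∑ k ∈ Finset.range d, g k τ f, PolyF.sum _ fun k _ =>
    PolyF.lin (LinearMap.applyₗ f) (hg k), fun τ => ?_⟩
  rw [Zop_eq α u τ (Nat.lt_succ_self d) hd, XU_eq α u (Nat.lt_succ_self d) hd,
    Finset.sum_range_succ', Finset.sum_range_succ', W_zero]
  have : XUc α u 0 f = 0 := by simp [XUc]
  rw [this, add_zero, Finset.smul_sum, Finset.smul_sum]
  have h2 : ∀ k, W α u τ (k+1) f = τ • XUc α u (k+1) f + τ ^ 2 • g k τ f := by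
    intro k
    rw [W, e]
    simp only [XUc, bs, LinearMap.add_apply, LinearMap.smul_apply]
    congr 2
    rw [smul_smul]; congr 1; push_cast; field_simp
  simp only [h2, Finset.sum_add_distrib, Module.End.one_apply]
  abel

theorem Zop_zero {α : K} (hα : α ≠ 0) (u : K) (f : SA K) : Zop α u 0 f = f := by
  obtain ⟨g, _, h⟩ := Zop_expand α u f
  rw [h]; simp

theorem Zop_poly_tau (α u : K) (f : SA K) : PolyF (fun τ => Zop α u τ f) := by
  obtain ⟨g, hg, h⟩ := Zop_expand α u f
  refine PolyF.congr (PolyF.add (PolyF.add (PolyF.const f) (PolyF.pow_smul_const (XU α u f) 1)) (PolyF.pow_smul 2 hg)) fun τ => ?_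
  rw [h, pow_one]

theorem XU_Xop (α u : K) {d : ℕ} {f : SA K} (hf : f ∈ Le K d) :
    XU α u f = ∑ ℓ ∈ Finset.range (d+1), u ^ ℓ • Xop α ℓ f := by
  rw [XU_eq α u (Nat.lt_succ_self d) hf]
  simp only [Xop_eq α _ (Nat.lt_succ_self d) hf, Finset.smul_sum]
  rw [Finset.sum_comm]
  refine Finset.sum_congr rfl fun n hn => ?_
  rw [XUc, bU_eq α u n (d+1) (by simpa using hn), LinearMap.smul_apply, LinearMap.sum_apply, Finset.smul_sum]
  refine Finset.sum_congr rfl fun ℓ _ => ?_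
  simp only [Xc, LinearMap.smul_apply, smul_smul, mul_comm]

end ops
end JP

namespace JP
open MvPolynomial

section I3
variable {K : Type*} [Field K] [CharZero K] {ι : Type*} [Fintype ι]

def I3 (α : K) : Module.End K (SA K) :=
  c0 ∘ₗ Lop α ∘ₗ Lop α ∘ₗ Lop α ∘ₗ Cl

theorem Lop_Cl (α : K) (f : SA K) : Lop α (Cl f) = dl α f := by
  have : (Cl f : VV K) = Polynomial.monomial 0 f := rfl
  rw [this, Lop_monomial]; simp

theorem I3_apply (α : K) (f : SA K) : I3 α f = (Lop α (Lop α (dl α f))).coeff 0 := by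
  rw [← Lop_Cl]; rfl

theorem hb_I3 (α : K) (f g : SA K) : hb α (I3 α f) g = hb α f (I3 α g) := by
  have h1 : ∀ f g : SA K, hb α f (I3 α g) = hV α (Cl f) (Lop α (Lop α (Lop α (Cl g)))) := by
    intro f g; rw [hV_Cl]; rfl
  rw [h1, hb_symm, h1, ← hV_Lop, ← hV_Lop, ← hV_Lop]
  have h2 : hV α (Lop α (Lop α (Lop α (Cl g)))) (Cl f) = hb α (c0 (Lop α (Lop α (Lop α (Cl g))))) f := by
    have : (Cl f : VV K) = Polynomial.monomial 0 f := rfl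
    rw [this, hV_monomial_right]; rfl
  rw [h2, hb_symm, ← hV_Cl]

theorem I3_low (α : K) : Low 0 (I3 α) := by
  intro k d f hf
  rw [I3_apply]
  have := HV_Lop (α := α) (HV_Lop (α := α) (HV_dl (α := α) hf)) 0
  simpa using this

def Eul (g : MvPolynomial ι K) : MvPolynomial ι K := ∑ a, X a * pderiv a g

theorem ph_hom (κ : K) {d : ℕ} {f : SA K} (hf : f ∈ AH K 0 d) : (ph ι κ f).IsHomogeneous d := by
  rw [as_sum_smul f, map_sum]
  refine IsHomogeneous.sum _ _ _ fun m hm => ?_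
  have h1 := hf m (mem_support_iff.1 hm)
  rw [map_smul, smul_eq_C_mul, ← zero_add d]
  refine (isHomogeneous_C _ _).mul ?_
  rw [ph, aeval_monomial, map_one, one_mul, ← h1, add_zero, wg]
  refine IsHomogeneous.prod _ _ _ fun j hj => ?_
  show ((κ • ∑ a : ι, X a ^ (j : ℕ)) ^ (m j)).IsHomogeneous (m j * (j : ℕ))
  rw [mul_comm]
  refine IsHomogeneous.pow ?_ _
  rw [smul_eq_C_mul, ← zero_add (j : ℕ)]
  refine (isHomogeneous_C _ _).mul (IsHomogeneous.sum _ _ _ fun a _ => ?_)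
  simpa using (isHomogeneous_X K a).pow (j : ℕ)

theorem Eul_ph (κ : K) {d : ℕ} {f : SA K} (hf : f ∈ AH K 0 d) :
    Eul (ph ι κ f) = (d : K) • ph ι κ f := by
  rw [Eul, (ph_hom κ hf).sum_X_mul_pderiv, Nat.cast_smul_eq_nsmul]

theorem ph_I3 {α κ : K} (hκ : κ ≠ 0) (hk : κ ^ 2 + (α - 1) * κ = α) (f : SA K) :
    ph ι κ (I3 α f) = α • ∑ a, Xi (α / κ) κ a (X a * pderiv a (ph ι κ f))
      - (κ * Fintype.card ι * α) • Eul (ph ι κ f) := by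
  have e : ∀ a : ι, ev κ a (dl α f) = (α / κ) • (X a * pderiv a (ph ι κ f)) := by
    intro a
    rw [div_eq_inv_mul, mul_smul, ← ev_dl, smul_smul, inv_mul_cancel₀ hκ, one_smul]
  have hXi : ∀ (a : ι) (c : K) g, Xi (α / κ) κ a (c • g) = c • Xi (α / κ) κ a g := by
    intro a c g
    simp only [Xi, map_smul, mul_smul_comm, smul_add, Finset.smul_sum, smul_smul, Derivation.map_smul]
    congr 1
    · rw [mul_comm]
    · exact Finset.sum_congr rfl fun _ _ => by rw [mul_comm]
  rw [I3_apply, ph_Lop_zero, ph_Lop_zero, dl_coeff_zero, map_zero, smul_zero, sub_zero]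
  simp only [ev_Lop hκ hk, e, hXi]
  rw [← Finset.smul_sum, ← Finset.smul_sum, smul_smul, smul_smul, smul_smul, mul_div_cancel₀ _ hκ]
  congr 2
  field_simp

theorem Du_smul (c κ : K) (a : ι) (x : K) (g : MvPolynomial ι K) : Du c κ a (x • g) = x • Du c κ a g := map_smul _ _ _

/-- `t_a = x_a D_a` -/
theorem sum_Xi (c κ : K) (hc : c ≠ 0) (g : MvPolynomial ι K) (hg : ∀ a b, sw K a b g = g) :
    c • ∑ a, Xi c κ a (X a * pderiv a g) = ∑ a, X a * Du c κ a (X a * Du c κ a g) := by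
  have hdd : ∀ a b, dd a b g = 0 := by
    intro a b
    by_cases h : a = b
    · subst h; exact dd_self _ _
    · exact dd_unique h (by rw [hg, sub_self, mul_zero])
  have hD : ∀ a, Du c κ a g = c • pderiv a g := by
    intro a; rw [Du_apply]; simp [hdd]
  have hd : ∀ (a : ι) (h : MvPolynomial ι K), Xi c κ a h = X a * Du c κ a h - κ • ∑ b, (h - sw K a b h) := by
    intro a h
    rw [Xi, Du_apply, mul_add, mul_smul_comm, mul_smul_comm, add_sub_assoc, ← smul_sub, Finset.mul_sum, ← Finset.sum_sub_distrib]
    congr 2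
    refine Finset.sum_congr rfl fun b _ => ?_
    rw [← dd_spec]; ring
  simp only [hd, hD, Finset.sum_sub_distrib]
  have hsw : ∀ a b, sw K a b (X a * pderiv a g) = X b * pderiv b g := by
    intro a b
    rw [map_mul, sw_X_left, sw, rename_pderiv]
    congr 2
    · simp
    · exact hg a b
  simp only [hsw]
  rw [← Finset.smul_sum, Finset.sum_sub_distrib, Finset.sum_comm (f := fun a b => X b * pderiv b g)]
  rw [sub_self, smul_zero, sub_zero, Finset.smul_sum]
  simp only [mul_smul_comm, map_smul]

theorem Eul_Du (c κ : K) (g : MvPolynomial ι K) (hg : ∀ a b, sw K a b g = g) :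
    c • Eul g = ∑ a, X a * Du c κ a g := by
  have hdd : ∀ a b, dd a b g = 0 := by
    intro a b
    by_cases h : a = b
    · subst h; exact dd_self _ _
    · exact dd_unique h (by rw [hg, sub_self, mul_zero])
  have hD : ∀ a, Du c κ a g = c • pderiv a g := by
    intro a; rw [Du_apply]; simp [hdd]
  simp only [hD, Eul, Finset.smul_sum, mul_smul_comm]

theorem esymm_card : esymm ι K (Fintype.card ι) = ∏ a, X a := by
  rw [esymm, ← Finset.card_univ, Finset.powersetCard_self, Finset.sum_singleton]

theorem W_I3 {α : K} (hα : α ≠ 0) (s n : ℕ) (hn : n ≤ s) {f : SA K} (hf : f ∈ AH K 0 (n + s)) :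
    W α (-α * s) 1 s (I3 α f) = I3 α (W α (-α * s) 1 s f)
      + (α ^ 2 * s ^ 2 - α * (2 * n + s)) • W α (-α * s) 1 s f := by
  have hW : ∀ h ∈ AH K 0 (n + s), W α (-α * s) 1 s h ∈ AH K 0 n := by
    intro h hh
    have := W_low α (-α * s) 1 s 0 (n+s) h hh
    exact (AH_shift s).1 this
  have hI : ∀ d, ∀ h ∈ AH K 0 d, I3 α h ∈ AH K 0 d := fun d h hh => I3_low α 0 d h hh
  have hLe : ∀ h ∈ AH K 0 n, h ∈ Le K n := fun h hh => AH_Le (le_refl _) hh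
  rw [← sub_eq_zero]
  refine ph_inj (ι := Fin s) hα (neg_ne_zero.2 hα) n (by simpa using hn) _ (hLe _ (sub_mem (hW _ (hI _ _ hf))
    (add_mem (hI _ _ (hW _ hf)) (Submodule.smul_mem _ _ (hW _ hf))))) ?_
  have h2 := ph_W hα (ι := Fin s) s
  have h3 : esymm (Fin s) K s = ∏ a, X a := by have := esymm_card (K := K) (ι := Fin s); rwa [Fintype.card_fin] at this
  simp only [Fintype.card_fin, h3] at h2
  have hI3 : ∀ h : SA K, ph (Fin s) (-α) (I3 α h) = - α • ∑ a, X a * Du (-1) (-α) a (X a * Du (-1) (-α) a (ph (Fin s) (-α) h))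
      - (α ^ 2 * s) • ∑ a, X a * Du (-1) (-α) a (ph (Fin s) (-α) h) := by
    intro h
    rw [ph_I3 (neg_ne_zero.2 hα) (hk_neg α), div_neg, div_self hα, ← sum_Xi _ _ (by norm_num) _ (fun a b => sw_ph _ _ _ _),
      ← Eul_Du _ _ _ (fun a b => sw_ph _ _ _ _), smul_smul, smul_smul, Fintype.card_fin]
    congr 2 <;> ring
  have hE : ∑ a, X a * Du (-1) (-α) a (ph (Fin s) (-α) (W α (-α * s) 1 s f)) = (-(n : K)) • ph (Fin s) (-α) (W α (-α * s) 1 s f) := by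
    rw [← Eul_Du _ _ _ (fun a b => sw_ph _ _ _ _), Eul_ph _ (hW f hf), smul_smul]; congr 1; ring
  rw [map_sub, map_add, map_smul, h2, hI3, hI3, map_sub, map_smul, map_smul, map_sum, map_sum]
  simp only [Psi_prod_XD, ← h2, map_add, mul_add, smul_add, map_smul, mul_smul_comm, Finset.sum_add_distrib, hE, ← Finset.smul_sum, Finset.sum_const, Finset.card_univ, Fintype.card_fin, ← Nat.cast_smul_eq_nsmul K]
  module

end I3
end JP

namespace JP
open MvPolynomial

section tri
variable {K : Type*} [Field K] [CharZero K] {ι : Type*} [Fintype ι]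

theorem rec_tri (t : ℕ) (g h : ℕ → ℕ → K)
    (R1 : ∀ i j, h i (j+1) - h (i+1) j = g (i+1) j - g j (i+1))
    (R0 : ∀ j, h 0 j = g j 0 - g 0 j) (R0' : ∀ i, h i 0 = 0)
    (hb : ∀ i j, t < i^2 + j^2 → g i j = 0) (i j : ℕ) (hij : i^2 + j^2 = t) :
    h i j = if i < j then g j i - g i j else 0 := by
  have A1 : ∀ i j, i < j → t < i^2+j^2 → h i j = 0 := by
    intro i
    induction i with
    | zero => intro j hj ht; rw [R0, hb _ _ ht, hb j 0 (by linarith), sub_zero]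
    | succ i ih =>
      intro j hj ht
      have := R1 i j
      rw [ih (j+1) (by omega) (by nlinarith), hb _ _ ht, hb j (i+1) (by linarith)] at this
      simpa using this
  have A2 : ∀ j i, j ≤ i → t ≤ i^2+j^2 → h i j = 0 := by
    intro j
    induction j with
    | zero => intro i _ _; exact R0' i
    | succ j ih =>
      intro i hj ht
      have := R1 i j
      rw [ih (i+1) (by omega) (by nlinarith), hb (i+1) j (by nlinarith), hb j (i+1) (by nlinarith)] at this
      simpa using this
  split_ifs with hl
  · cases i with
    | zero => exact R0 j
    | succ i =>
      have := R1 i j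
      rw [A1 i (j+1) (by omega) (by nlinarith)] at this
      linear_combination -this
  · exact A2 j i (by omega) (by omega)

def qe (η : ι →₀ ℕ) : ℕ := ∑ a, η a ^ 2

def pt (μ : ι →₀ ℕ) (a b : ι) (i j : ℕ) : ι →₀ ℕ := μ + Finsupp.single a i + Finsupp.single b j

theorem pt_swap (μ : ι →₀ ℕ) {a b : ι} (hab : a ≠ b) (ha : μ a = 0) (hb : μ b = 0) (i j : ℕ) :
    (pt μ a b i j).mapDomain (Equiv.swap a b) = pt μ a b j i := by
  have hμ : μ.mapDomain (Equiv.swap a b) = μ := by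
    ext c
    rw [← Finsupp.equivMapDomain_eq_mapDomain, Finsupp.equivMapDomain_apply, Equiv.symm_swap]
    by_cases h : c = a
    · subst h; rw [Equiv.swap_apply_left, ha, hb]
    by_cases h' : c = b
    · subst h'; rw [Equiv.swap_apply_right, ha, hb]
    rw [Equiv.swap_apply_of_ne_of_ne h h']
  rw [pt, Finsupp.mapDomain_add, Finsupp.mapDomain_add, hμ, Finsupp.mapDomain_single, Finsupp.mapDomain_single,
    Equiv.swap_apply_left, Equiv.swap_apply_right, pt]
  abel

theorem pt_qe (μ : ι →₀ ℕ) {a b : ι} (hab : a ≠ b) (ha : μ a = 0) (hb : μ b = 0) (i j : ℕ) :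
    qe (pt μ a b i j) = qe μ + (i ^ 2 + j ^ 2) := by
  unfold qe
  have : ∀ c, (pt μ a b i j) c ^ 2 = μ c ^ 2 + ((if c = a then i ^ 2 else 0) + (if c = b then j ^ 2 else 0)) := by
    intro c
    by_cases h : c = a
    · subst h; simp [pt, ha, hab, hab.symm]
    by_cases h' : c = b
    · subst h'; simp [pt, hb, hab, hab.symm]
    simp [pt, h, h', Ne.symm h, Ne.symm h']
  simp only [this, Finset.sum_add_distrib]
  simp

theorem coeff_sw (a b : ι) (g : MvPolynomial ι K) (m : ι →₀ ℕ) :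
    coeff (m.mapDomain (Equiv.swap a b)) (sw K a b g) = coeff m g :=
  coeff_rename_mapDomain _ (Equiv.swap a b).injective _ _

theorem dd_coeff {a b : ι} (hab : a ≠ b) (g : MvPolynomial ι K) (ζ : ι →₀ ℕ)
    (hg : ∀ η, coeff η g ≠ 0 → qe η ≤ qe ζ) :
    coeff ζ (X b * dd a b g) = if ζ a < ζ b then coeff (ζ.mapDomain (Equiv.swap a b)) g - coeff ζ g else 0 := by
  obtain ⟨μ, ha, hb, hζ⟩ : ∃ μ : ι →₀ ℕ, μ a = 0 ∧ μ b = 0 ∧ ζ = pt μ a b (ζ a) (ζ b) := by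
    refine ⟨(ζ.erase a).erase b, ?_, ?_, ?_⟩
    · rw [Finsupp.erase_ne hab, Finsupp.erase_same]
    · rw [Finsupp.erase_same]
    · ext c
      by_cases h : c = a
      · subst h; simp [pt, hab, hab.symm, Finsupp.erase_ne hab]
      by_cases h' : c = b
      · subst h'; simp [pt, hab, hab.symm]
      simp [pt, h, h', Ne.symm h, Ne.symm h']
  set D := dd a b g
  have hbs : ∀ i j, coeff (pt μ a b i (j+1)) (X b * D) = coeff (pt μ a b i j) D := by
    intro i j
    have : pt μ a b i (j+1) = Finsupp.single b 1 + pt μ a b i j := by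
      simp only [pt, Finsupp.single_add]; abel
    rw [this, coeff_X_mul]
  have has : ∀ i j, coeff (pt μ a b (i+1) j) (X a * D) = coeff (pt μ a b i j) D := by
    intro i j
    have : pt μ a b (i+1) j = Finsupp.single a 1 + pt μ a b i j := by
      simp only [pt, Finsupp.single_add]; abel
    rw [this, coeff_X_mul]
  have hb0 : ∀ i, coeff (pt μ a b i 0) (X b * D) = 0 := by
    intro i
    rw [coeff_X_mul', if_neg]
    simp [pt, hb, hab, hab.symm]
  have ha0 : ∀ j, coeff (pt μ a b 0 j) (X a * D) = 0 := by
    intro j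
    rw [coeff_X_mul', if_neg]
    simp [pt, ha, hab, hab.symm]
  have hs := dd_spec a b g
  have hrel : ∀ i j, coeff (pt μ a b i j) (X a * D) - coeff (pt μ a b i j) (X b * D)
      = coeff (pt μ a b i j) g - coeff (pt μ a b j i) g := by
    intro i j
    have h1 := congrArg (coeff (pt μ a b i j)) hs
    rw [sub_mul, coeff_sub, coeff_sub] at h1
    rw [h1, ← pt_swap μ hab ha hb j i, coeff_sw, pt_swap μ hab ha hb j i]
  have key := rec_tri (ζ a ^ 2 + ζ b ^ 2) (fun i j => coeff (pt μ a b i j) g) (fun i j => coeff (pt μ a b i j) (X b * D))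
    (fun i j => by
      have := hrel (i+1) j
      rw [has] at this
      beta_reduce
      rw [hbs]; exact this)
    (fun j => by
      have := hrel 0 j
      rw [ha0] at this
      beta_reduce
      linear_combination -this) (fun i => hb0 i)
    (fun i j hij => by
      by_contra h
      have := hg _ h
      rw [hζ, pt_qe μ hab ha hb, pt_qe μ hab ha hb] at this
      omega) (ζ a) (ζ b) rfl
  beta_reduce at key
  have e2 : ζ.mapDomain (Equiv.swap a b) = pt μ a b (ζ b) (ζ a) := by
    conv_lhs => rw [hζ]
    exact pt_swap μ hab ha hb _ _
  rw [← hζ, ← e2] at key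
  exact key

theorem coeff_X_pderiv (a : ι) (g : MvPolynomial ι K) (ζ : ι →₀ ℕ) :
    coeff ζ (X a * pderiv a g) = (ζ a : K) * coeff ζ g := by
  rw [coeff_X_mul']
  split_ifs with h
  · have h0 : ζ a ≠ 0 := Finsupp.mem_support_iff.1 h
    have h2 : ζ - Finsupp.single a 1 + Finsupp.single a 1 = ζ := by
      apply tsub_add_cancel_of_le
      rw [Finsupp.single_le_iff]; omega
    rw [coeff_pderiv, h2, mul_comm]
    congr 1
    have : ((ζ - Finsupp.single a 1 : ι →₀ ℕ) a) + 1 = ζ a := by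
      simp; omega
    exact_mod_cast this
  · have h0 : ζ a = 0 := by simpa using h
    simp [h0]

theorem qe_swap (a b : ι) (ζ : ι →₀ ℕ) : qe (ζ.mapDomain (Equiv.swap a b)) = qe ζ := by
  unfold qe
  rw [← Equiv.sum_comp (Equiv.swap a b)]
  refine Finset.sum_congr rfl fun c _ => ?_
  rw [Finsupp.mapDomain_apply (Equiv.swap a b).injective]

/-- integer part of the eigenvalue -/
def zint (ζ : ι →₀ ℕ) : ℤ := (∑ a, ∑ b, if ζ a < ζ b then ((ζ b : ℤ) - ζ a) else 0) - Fintype.card ι * ∑ a, (ζ a : ℤ)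

theorem coeff_I3 (α : K) (f : SA K) (ζ : ι →₀ ℕ)
    (hf : ∀ η, coeff η (ph ι 1 f) ≠ 0 → qe η ≤ qe ζ) :
    coeff ζ (ph ι 1 (I3 α f)) = (α ^ 2 * (qe ζ : K) + α * (zint ζ : K)) * coeff ζ (ph ι 1 f) := by
  rw [ph_I3 one_ne_zero (by ring)]
  set g := ph ι 1 f with hgdef
  have hsw : ∀ a b, coeff (ζ.mapDomain (Equiv.swap a b)) g = coeff ζ g := by
    intro a b
    conv_lhs => rw [hgdef, ← sw_ph 1 a b f]
    exact coeff_sw _ _ _ _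
  have hd : ∀ a b, coeff ζ (X b * dd a b (X a * pderiv a g)) = ((if ζ a < ζ b then ((ζ b : ℤ) - ζ a) else 0 : ℤ) : K) * coeff ζ g := by
    intro a b
    by_cases hab : a = b
    · subst hab; rw [dd_self]; simp
    rw [dd_coeff hab _ _ (fun η hη => hf η (by
      rw [coeff_X_pderiv] at hη; exact right_ne_zero_of_mul hη))]
    split_ifs with h
    · rw [coeff_X_pderiv, coeff_X_pderiv, hsw]
      have : (ζ.mapDomain (Equiv.swap a b)) a = ζ b := by
        have := Finsupp.mapDomain_apply (Equiv.swap a b).injective ζ b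
        rwa [Equiv.swap_apply_right] at this
      rw [this]; push_cast; ring
    · simp
  have hq : (qe ζ : K) = ∑ a, (ζ a : K) ^ 2 := by simp [qe]
  simp only [Xi, Eul, coeff_sub, coeff_smul, coeff_sum, coeff_add, coeff_X_pderiv, hd, smul_eq_mul, one_mul, div_one, zint, hq,
    Finset.sum_add_distrib]
  have e1 : ∑ x, α * ((ζ x : K) * ((ζ x : K) * coeff ζ g)) = α * (∑ a, (ζ a : K) ^ 2) * coeff ζ g := by
    rw [Finset.mul_sum, Finset.sum_mul]
    exact Finset.sum_congr rfl fun _ _ => by ring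
  have e2 : ∑ x, ∑ x_1, ((if ζ x < ζ x_1 then ((ζ x_1 : ℤ) - ζ x) else 0 : ℤ) : K) * coeff ζ g
      = ((∑ a, ∑ b, if ζ a < ζ b then ((ζ b : ℤ) - ζ a) else 0 : ℤ) : K) * coeff ζ g := by
    rw [Int.cast_sum, Finset.sum_mul]
    refine Finset.sum_congr rfl fun _ _ => ?_
    rw [Int.cast_sum, Finset.sum_mul]
  have e3 : ∑ x, (ζ x : K) * coeff ζ g = ((∑ a, (ζ a : ℤ) : ℤ) : K) * coeff ζ g := by
    rw [Int.cast_sum, Finset.sum_mul]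
    exact Finset.sum_congr rfl fun _ _ => by push_cast; ring
  rw [e1, e2, e3, Int.cast_sub, Int.cast_mul]
  push_cast
  ring

end tri
end JP

namespace JP
open MvPolynomial

section comb

theorem exists_perm {N : ℕ} (f g : Fin N → ℕ) (h : (List.ofFn f).Perm (List.ofFn g)) :
    ∃ σ : Equiv.Perm (Fin N), f = g ∘ σ := by
  have h1 : (List.ofFn (f ∘ Tuple.sort f)).Perm (List.ofFn (g ∘ Tuple.sort g)) :=
    ((Equiv.Perm.ofFn_comp_perm _ f).trans h).trans (Equiv.Perm.ofFn_comp_perm _ g).symm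
  have h2 : List.ofFn (f ∘ Tuple.sort f) = List.ofFn (g ∘ Tuple.sort g) :=
    List.Perm.eq_of_sortedLE (List.sortedLE_ofFn_iff.2 (Tuple.monotone_sort f))
      (List.sortedLE_ofFn_iff.2 (Tuple.monotone_sort g)) h1
  have h3 := List.ofFn_injective h2
  refine ⟨(Tuple.sort f).symm.trans (Tuple.sort g), ?_⟩
  funext x
  have := congrFun h3 ((Tuple.sort f).symm x)
  simpa using this

theorem ofFn_getD (L : List ℕ) (N : ℕ) (h : L.length ≤ N) :
    List.ofFn (fun j : Fin N => L.getD (j : ℕ) 0) = L ++ List.replicate (N - L.length) 0 := by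
  apply List.ext_getElem
  · simp; omega
  · intro i h1 h2
    simp only [List.getElem_ofFn, List.getD_eq_getElem?_getD]
    by_cases hi : i < L.length
    · rw [List.getElem_append_left hi, List.getElem?_eq_getElem hi]; rfl
    · rw [List.getElem_append_right (by omega), List.getElem?_eq_none (by omega)]; simp

theorem bind_coe (l : JPartition) : (do let a ← l; pure (a : ℕ) : Multiset ℕ) = l.map fun i : ℕ+ => (i : ℕ) := by
  show l.bind (fun a : ℕ+ => ({(a : ℕ)} : Multiset ℕ)) = _
  rw [Multiset.bind_singleton]

theorem psize_eq (l : JPartition) : psize l = (l.map fun i : ℕ+ => (i : ℕ)).sum := by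
  rw [psize, Multiset.map_id', bind_coe]

theorem sortedParts_coe (l : JPartition) : ((sortedParts l : List ℕ) : Multiset ℕ) = l.map fun i : ℕ+ => (i : ℕ) := by
  rw [sortedParts, Multiset.coe_reverse, Multiset.sort_eq, Multiset.map_id', bind_coe]

theorem sortedParts_length (l : JPartition) : (sortedParts l).length = plen l := by
  rw [← Multiset.coe_card, sortedParts_coe, Multiset.card_map]; rfl

theorem xexp_vals (l : JPartition) (N : ℕ) (h : plen l ≤ N) :
    (Finset.univ : Finset (Fin N)).val.map (xexp l N) = (l.map fun i : ℕ+ => (i : ℕ)) + Multiset.replicate (N - plen l) 0 := by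
  rw [Fin.univ_val_map]
  have : List.ofFn (xexp l N) = List.ofFn (fun j : Fin N => (sortedParts l).getD (j : ℕ) 0) := rfl
  rw [this, ofFn_getD _ _ (by rw [sortedParts_length]; exact h), ← Multiset.coe_add, sortedParts_coe,
    sortedParts_length, Multiset.coe_replicate]

/-- sum of squares of parts -/
def qp (l : JPartition) : ℕ := (l.map fun i : ℕ+ => (i : ℕ) ^ 2).sum

theorem xexp_sum (l : JPartition) (N : ℕ) (h : plen l ≤ N) (φ : ℕ → ℕ) (h0 : φ 0 = 0) :
    ∑ a, φ (xexp l N a) = (l.map fun i : ℕ+ => φ (i : ℕ)).sum := by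
  have : ∑ a, φ (xexp l N a) = (((Finset.univ : Finset (Fin N)).val.map (xexp l N)).map φ).sum := by
    rw [Multiset.map_map]; rfl
  rw [this, xexp_vals l N h]
  simp [h0, Multiset.map_map, Function.comp_def]

theorem qe_xexp (l : JPartition) (N : ℕ) (h : plen l ≤ N) : qe (xexp l N) = qp l :=
  xexp_sum l N h (fun x => x ^ 2) (by simp)

theorem sum_xexp (l : JPartition) (N : ℕ) (h : plen l ≤ N) : ∑ a, xexp l N a = psize l :=
  (xexp_sum l N h (fun x => x) (by simp)).trans (psize_eq l).symm

theorem map_filter_inj {l m : JPartition} {a b : ℕ}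
    (h : (l.map fun i : ℕ+ => (i : ℕ)) + Multiset.replicate a 0 = (m.map fun i : ℕ+ => (i : ℕ)) + Multiset.replicate b 0) : l = m := by
  have key : ∀ (l : JPartition) (a : ℕ), ((l.map fun i : ℕ+ => (i : ℕ)) + Multiset.replicate a 0).filter (fun x => x ≠ 0)
      = l.map fun i : ℕ+ => (i : ℕ) := by
    intro l a
    rw [Multiset.filter_add]
    have h1 : Multiset.filter (fun x => x ≠ 0) (Multiset.replicate a 0) = 0 := by
      rw [Multiset.filter_eq_nil]; intro x hx; simp [Multiset.eq_of_mem_replicate hx]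
    have h2 : Multiset.filter (fun x => x ≠ 0) (l.map fun i : ℕ+ => (i : ℕ)) = l.map fun i : ℕ+ => (i : ℕ) := by
      rw [Multiset.filter_eq_self]; intro x hx
      obtain ⟨i, _, rfl⟩ := Multiset.mem_map.1 hx
      exact i.ne_zero
    rw [h1, h2, add_zero]
  have h3 := key l a
  rw [h, key m b] at h3
  exact (Multiset.map_injective PNat.coe_injective h3).symm

theorem exists_part {N : ℕ} (η : Fin N →₀ ℕ) : ∃ l : JPartition, plen l ≤ N ∧
    ∃ σ : Equiv.Perm (Fin N), ∀ a, η a = xexp l N (σ a) := by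
  set M := (Finset.univ : Finset (Fin N)).val.map η with hM
  have hcard : M.card = N := by simp [hM]
  obtain ⟨l, hl⟩ : ∃ l : JPartition, (l.map fun i : ℕ+ => (i : ℕ)) = M.filter (fun x => x ≠ 0) := by
    refine ⟨(M.filter (fun x => x ≠ 0)).map (fun x => if h : 0 < x then ⟨x, h⟩ else 1), ?_⟩
    rw [Multiset.map_map]
    conv_rhs => rw [← Multiset.map_id (M.filter (fun x => x ≠ 0))]
    refine Multiset.map_congr rfl fun x hx => ?_
    have : 0 < x := Nat.pos_of_ne_zero (Multiset.mem_filter.1 hx).2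
    simp [this]
  have h1 : M = (l.map fun i : ℕ+ => (i : ℕ)) + Multiset.replicate (Multiset.count 0 M) 0 := by
    rw [hl]
    conv_lhs => rw [← Multiset.filter_add_not (fun x => x ≠ 0) M]
    congr 1
    simp only [not_not]
    rw [Multiset.filter_eq']
  have h2 : plen l + Multiset.count 0 M = N := by
    have := congrArg Multiset.card h1
    rw [hcard] at this
    simp at this
    rw [plen]; exact this.symm
  refine ⟨l, by omega, ?_⟩
  have h3 := xexp_vals l N (by omega)
  have h4 : N - plen l = Multiset.count 0 M := by omega
  rw [h4, ← h1, hM, Fin.univ_val_map, Fin.univ_val_map] at h3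
  obtain ⟨σ, hσ⟩ := exists_perm (η : Fin N → ℕ) (xexp l N) (Multiset.coe_eq_coe.1 h3).symm
  exact ⟨σ, fun a => congrFun hσ a⟩

theorem sum_take (L : List ℕ) (k : ℕ) : (L.take k).sum = ∑ i ∈ Finset.range k, L.getD i 0 := by
  induction k with
  | zero => simp
  | succ k ih =>
    rw [Finset.sum_range_succ, ← ih]
    by_cases h : k < L.length
    · rw [List.sum_take_succ _ _ h]; simp [List.getD_eq_getElem?_getD, h]
    · rw [List.take_of_length_le (by omega), List.take_of_length_le (by omega)]
      simp [List.getD_eq_getElem?_getD, h]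

theorem abel_sq (a b : ℕ → ℤ) (N : ℕ) (ha : ∀ i, a (i+1) ≤ a i)
    (hD : ∀ k, 0 ≤ ∑ i ∈ Finset.range k, (b i - a i)) (hN : ∑ i ∈ Finset.range N, (b i - a i) = 0) :
    ∑ i ∈ Finset.range N, (b i - a i) ^ 2 ≤ ∑ i ∈ Finset.range N, b i ^ 2 - ∑ i ∈ Finset.range N, a i ^ 2 := by
  have h : ∀ k, a k * ∑ i ∈ Finset.range k, (b i - a i) ≤ ∑ i ∈ Finset.range k, a i * (b i - a i) := by
    intro k
    induction k with
    | zero => simp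
    | succ k ih =>
      have h1 := mul_le_mul_of_nonneg_right (ha k) (hD (k+1))
      rw [Finset.sum_range_succ] at h1 ⊢
      rw [Finset.sum_range_succ (fun i => a i * (b i - a i))]
      linarith
  have h2 := h N
  rw [hN, mul_zero] at h2
  have h3 : ∑ i ∈ Finset.range N, b i ^ 2 - ∑ i ∈ Finset.range N, a i ^ 2
      = ∑ i ∈ Finset.range N, (b i - a i) ^ 2 + 2 * ∑ i ∈ Finset.range N, a i * (b i - a i) := by
    rw [Finset.mul_sum, ← Finset.sum_sub_distrib, ← Finset.sum_add_distrib]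
    exact Finset.sum_congr rfl fun _ _ => by ring
  linarith

theorem sp_anti (l : JPartition) (i : ℕ) : (sortedParts l).getD (i+1) 0 ≤ (sortedParts l).getD i 0 := by
  by_cases h : i + 1 < (sortedParts l).length
  · rw [List.getD_eq_getElem _ _ h, List.getD_eq_getElem _ _ (by omega)]
    have h1 : (sortedParts l).Pairwise (· ≥ ·) := by
      rw [sortedParts, List.pairwise_reverse]
      exact Multiset.pairwise_sort _ _
    exact List.pairwise_iff_getElem.1 h1 _ _ _ h (by omega)
  · simp [List.getD_eq_getElem?_getD, h]

theorem dom_q {m l : JPartition} (h : dominates m l) (hne : m ≠ l) : qp m < qp l := by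
  set N := plen m + plen l with hN
  set a : ℕ → ℤ := fun i => ((sortedParts m).getD i 0 : ℕ) with ha
  set b : ℕ → ℤ := fun i => ((sortedParts l).getD i 0 : ℕ) with hb
  have hsum : ∀ k, ∑ i ∈ Finset.range k, (b i - a i) = (topSum l k : ℤ) - topSum m k := by
    intro k
    rw [Finset.sum_sub_distrib, topSum, topSum, sum_take, sum_take]; push_cast; rfl
  have hsz : ∀ (p : JPartition), plen p ≤ N → topSum p N = psize p := by
    intro p hp
    rw [topSum, List.take_of_length_le (by rw [sortedParts_length]; exact hp), ← Multiset.sum_coe, sortedParts_coe, psize_eq]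
  have hq : ∀ (p : JPartition), plen p ≤ N → ∑ i ∈ Finset.range N, (((sortedParts p).getD i 0 : ℕ) : ℤ) ^ 2 = qp p := by
    intro p hp
    rw [← qe_xexp p N hp, qe, Finset.sum_range]
    push_cast; rfl
  have key := abel_sq a b N (fun i => by simpa [ha] using sp_anti m i)
    (fun k => by rw [hsum]; have := h.2 k; omega)
    (by rw [hsum, hsz l (by omega), hsz m (by omega), h.1, sub_self])
  rw [hq l (by omega), hq m (by omega)] at key
  by_contra hlt
  have h0 : ∑ i ∈ Finset.range N, (b i - a i) ^ 2 = 0 :=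
    le_antisymm (by omega) (Finset.sum_nonneg fun _ _ => sq_nonneg _)
  rw [Finset.sum_eq_zero_iff_of_nonneg (fun _ _ => sq_nonneg _)] at h0
  apply hne
  have e : xexp m N = xexp l N := by
    ext j
    have := h0 j (Finset.mem_range.2 j.2)
    rw [sq_eq_zero_iff, sub_eq_zero] at this
    simp only [ha, hb] at this
    exact_mod_cast this.symm
  have h1 := xexp_vals m N (by omega)
  rw [e, xexp_vals l N (by omega)] at h1
  exact (map_filter_inj h1).symm

theorem finite_size (n : ℕ) : {l : JPartition | psize l = n}.Finite := by
  have : Finite {l : JPartition // psize l = n} := by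
    refine Finite.of_injective (β := Nat.Partition n) (fun l => ⟨l.1.map fun i : ℕ+ => (i : ℕ), ?_, (psize_eq _).symm.trans l.2⟩) ?_
    · intro i hi
      obtain ⟨j, _, rfl⟩ := Multiset.mem_map.1 hi
      exact j.pos
    · intro l m h
      have := congrArg Nat.Partition.parts h
      exact Subtype.ext (Multiset.map_injective PNat.coe_injective this)
  exact Set.finite_coe_iff.1 this

end comb
end JP

namespace JP
open MvPolynomial

section mc
variable {K : Type*} [Field K] [CharZero K]

theorem coeff_killCompl {σ τ : Type*} {f : σ → τ} (hf : Function.Injective f) (g : MvPolynomial τ K) (η : σ →₀ ℕ) :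
    coeff η (killCompl hf g) = coeff (η.mapDomain f) g := by
  induction g using MvPolynomial.induction_on' with
  | add p q hp hq => rw [map_add, coeff_add, coeff_add, hp, hq]
  | monomial m c =>
    by_cases h : ∃ η', m = Finsupp.mapDomain f η'
    · obtain ⟨η', rfl⟩ := h
      rw [← rename_monomial, killCompl_rename_app, coeff_rename_mapDomain _ hf]
    · have h1 : ∃ t, m t ≠ 0 ∧ t ∉ Set.range f := by
        by_contra hc
        push Not at hc
        exact h ⟨m.comapDomain f hf.injOn, (Finsupp.mapDomain_comapDomain f hf m (fun t ht => hc t (by simpa using ht))).symm⟩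
      obtain ⟨t, ht, htr⟩ := h1
      have h2 : (monomial m c : MvPolynomial τ K) = X t * monomial (m - Finsupp.single t 1) c := by
        rw [X, monomial_mul, one_mul, add_comm, tsub_add_cancel_of_le]
        rw [Finsupp.single_le_iff]; omega
      have h3 : killCompl hf (X t : MvPolynomial τ K) = 0 := by
        rw [killCompl, aeval_X, dif_neg htr]
      rw [coeff_monomial, if_neg (fun e => h ⟨η, e⟩), h2, map_mul, h3, zero_mul, coeff_zero]

theorem killCompl_ph {σ τ : Type*} [Fintype σ] [Fintype τ] {f : σ → τ} (hf : Function.Injective f) (κ : K) (g : SA K) :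
    killCompl hf (ph τ κ g) = ph σ κ g := by
  have : (killCompl hf).comp (ph τ κ) = ph σ κ := by
    apply MvPolynomial.algHom_ext
    intro j
    rw [AlgHom.comp_apply, ph_X, ph_X, map_smul, map_sum]
    congr 1
    have h1 : ∀ t, killCompl hf (X t ^ (j : ℕ) : MvPolynomial τ K) = if h : t ∈ Set.range f then
        (X ((Equiv.ofInjective f hf).symm ⟨t, h⟩) : MvPolynomial σ K) ^ (j : ℕ) else 0 := by
      intro t
      rw [map_pow, killCompl, aeval_X]
      split_ifs with h
      · rfl
      · rw [zero_pow j.ne_zero]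
    simp only [h1]
    symm
    apply Finset.sum_of_injOn f hf.injOn (by simp)
    · intro t _ ht
      rw [dif_neg]; simpa using ht
    · intro s _
      rw [dif_pos ⟨s, rfl⟩]
      congr 2
      rw [Equiv.eq_symm_apply]; rfl
  exact DFunLike.congr_fun this g

/-- coefficient of `m_κ` -/
def Mc (l : JPartition) : SA K →ₗ[K] K := lcoeff K (xexp l (plen l)) ∘ₗ (ph (Fin (plen l)) (1 : K)).toLinearMap

theorem Mc_apply (l : JPartition) (f : SA K) : Mc l f = coeff (xexp l (plen l)) (ph (Fin (plen l)) (1 : K) f) := rfl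

theorem xexp_mapDomain (l : JPartition) (N : ℕ) (h : plen l ≤ N) :
    (xexp l (plen l)).mapDomain (Fin.castLE h) = xexp l N := by
  ext j
  by_cases hj : (j : ℕ) < plen l
  · have : j = Fin.castLE h ⟨j, hj⟩ := by ext; rfl
    rw [this, Finsupp.mapDomain_apply (Fin.castLE_injective h)]
    rfl
  · rw [Finsupp.mapDomain_notin_range]
    · show 0 = (sortedParts l).getD (j : ℕ) 0
      rw [List.getD_eq_getElem?_getD, List.getElem?_eq_none (by rw [sortedParts_length]; omega)]; rfl
    · rintro ⟨i, rfl⟩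
      exact hj i.2

theorem Mc_eq (l : JPartition) (N : ℕ) (h : plen l ≤ N) (f : SA K) :
    coeff (xexp l N) (ph (Fin N) (1 : K) f) = Mc l f := by
  rw [Mc_apply, ← killCompl_ph (Fin.castLE_injective h), coeff_killCompl, xexp_mapDomain]

theorem Mc_all {N : ℕ} (η : Fin N →₀ ℕ) : ∃ l : JPartition, plen l ≤ N ∧ qp l = qe η ∧
    ∀ f : SA K, coeff η (ph (Fin N) (1 : K) f) = Mc l f := by
  obtain ⟨l, hl, σ, hσ⟩ := exists_part η
  have e : η.mapDomain σ = xexp l N := by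
    ext a
    have := Finsupp.mapDomain_apply σ.injective η (σ.symm a)
    rw [Equiv.apply_symm_apply] at this
    rw [this, hσ, Equiv.apply_symm_apply]
  refine ⟨l, hl, ?_, fun f => ?_⟩
  · rw [← qe_xexp l N hl, qe, qe, ← Equiv.sum_comp σ]
    exact (Finset.sum_congr rfl fun a _ => by rw [hσ]).symm
  · rw [← Mc_eq l N hl, ← e]
    have : ph (Fin N) (1 : K) f = rename σ (ph (Fin N) (1 : K) f) := by
      have : (rename σ : MvPolynomial (Fin N) K →ₐ[K] _).comp (ph (Fin N) (1:K)) = ph (Fin N) (1 : K) := by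
        apply MvPolynomial.algHom_ext
        intro j
        rw [AlgHom.comp_apply, ph_X, map_smul, map_sum]
        simp only [map_pow, rename_X]
        rw [Equiv.sum_comp σ (fun a => (X a : MvPolynomial (Fin N) K) ^ (j : ℕ))]
      exact (DFunLike.congr_fun this f).symm
    conv_rhs => rw [this]
    rw [coeff_rename_mapDomain _ σ.injective]

theorem Mc_inj {α : K} (hα : α ≠ 0) (f : SA K) (h : ∀ l, Mc l f = 0) : f = 0 := by
  obtain ⟨d, hd⟩ := exists_Le f
  apply ph_inj (ι := Fin d) hα one_ne_zero d (by simp) f hd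
  ext η
  obtain ⟨l, _, _, hl⟩ := Mc_all (K := K) η
  rw [hl, h, coeff_zero]

theorem Mc_size {f : SA K} {n : ℕ} (hf : f ∈ AH K 0 n) (l : JPartition) (h : Mc l f ≠ 0) : psize l = n := by
  have := ph_hom (ι := Fin (plen l)) (1 : K) hf h
  rw [← sum_xexp l (plen l) le_rfl, ← this]
  simp [Finsupp.weight_apply, Finsupp.sum_fintype]

/-- eigenvalue -/
def ei (α : K) (l : JPartition) : K := α ^ 2 * (qp l : K) + α * (zint (xexp l (plen l)) : K)

theorem Mc_I3 (α : K) (f : SA K) (l : JPartition) (h : ∀ m, Mc m f ≠ 0 → qp m ≤ qp l) :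
    Mc l (I3 α f) = ei α l * Mc l f := by
  rw [Mc_apply, coeff_I3, ← Mc_apply, qe_xexp _ _ le_rfl]; rfl
  intro η hη
  obtain ⟨m, _, hm, he⟩ := Mc_all (K := K) η
  rw [← hm, qe_xexp _ _ le_rfl]
  exact h m (by rwa [← he])

end mc
end JP

namespace JP
open MvPolynomial

section jack

theorem alpha_ne : alpha ≠ 0 := RatFunc.X_ne_zero

theorem zalpha_eq (m : Exp) : zalpha m = zg alpha m := by
  unfold zalpha zg
  congr 1
  rw [Finsupp.prod, map_prod]
  refine Finset.prod_congr rfl fun i _ => ?_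
  simp

theorem hall_eq (f g : SymA) : hall f g = hb alpha f g := by
  rw [hb_eq_sum]
  exact Finset.sum_congr rfl fun m _ => by rw [zalpha_eq]

theorem evalN_eq (N : ℕ) : evalN N = ph (Fin N) (1 : F) := by
  unfold evalN ph
  simp

theorem exists_embed : ∃ φ : F →+* ℝ, 0 < φ alpha := by
  have ht : Transcendental ℚ (liouvilleNumber (2 : ℕ)) := by
    have := transcendental_liouvilleNumber (m := 2) le_rfl
    intro h
    exact this ((IsFractionRing.isAlgebraic_iff ℤ ℚ ℝ).2 h)
  have hinj : Function.Injective (Polynomial.aeval (R := ℚ) (liouvilleNumber (2 : ℕ))).toRingHom :=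
    transcendental_iff_injective.1 ht
  refine ⟨IsFractionRing.lift (A := Polynomial ℚ) (K := F) hinj, ?_⟩
  have : IsFractionRing.lift (A := Polynomial ℚ) (K := F) hinj alpha = liouvilleNumber (2 : ℕ) := by
    rw [alpha, ← RatFunc.algebraMap_X, IsFractionRing.lift_algebraMap]
    simp
  rw [this]
  refine lt_of_le_of_ne ?_ ?_
  · unfold liouvilleNumber
    exact tsum_nonneg fun i => by positivity
  · intro h
    apply ht
    rw [← h]
    exact isAlgebraic_zero

theorem hb_aniso (f : SymA) (h : hb alpha f f = 0) : f = 0 := by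
  obtain ⟨φ, hφ⟩ := exists_embed
  have h1 := congrArg φ (hb_eq_sum alpha f f)
  rw [h, map_zero, map_sum] at h1
  have hz : ∀ m, 0 < φ (zg alpha m) := by
    intro m
    unfold zg
    rw [map_mul, map_pow, Finsupp.prod, map_prod]
    refine mul_pos (Finset.prod_pos fun i _ => ?_) (pow_pos hφ _)
    rw [map_mul, map_pow, map_natCast, map_natCast]
    have := i.pos
    positivity
  have hn : ∀ m ∈ f.support, 0 ≤ φ (coeff m f * coeff m f * zg alpha m) := by
    intro m _
    rw [map_mul, map_mul]
    exact mul_nonneg (mul_self_nonneg _) (hz m).le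
  have h2 := (Finset.sum_eq_zero_iff_of_nonneg hn).1 h1.symm
  by_contra hf
  obtain ⟨m, hm⟩ := MvPolynomial.support_nonempty.2 hf
  have h3 := h2 m hm
  rw [map_mul, map_mul] at h3
  have h4 : φ (coeff m f) ≠ 0 := by
    rw [Ne, map_eq_zero]; exact mem_support_iff.1 hm
  exact (mul_ne_zero (mul_ne_zero h4 h4) (hz m).ne') h3

theorem alpha_irr (a b : ℤ) (h : alpha ^ 2 * (a : F) + alpha * (b : F) = 0) : a = 0 := by
  have h1 : alpha * (a : F) + (b : F) = 0 := by
    have : alpha * (alpha * (a : F) + (b : F)) = 0 := by linear_combination h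
    exact (mul_eq_zero.1 this).resolve_left alpha_ne
  have h2 : algebraMap (Polynomial ℚ) F (Polynomial.X * Polynomial.C (a : ℚ) + Polynomial.C (b : ℚ)) = 0 := by
    rw [map_add, map_mul, RatFunc.algebraMap_X, RatFunc.algebraMap_C, RatFunc.algebraMap_C]
    simpa [alpha] using h1
  rw [map_eq_zero_iff _ (RatFunc.algebraMap_injective ℚ)] at h2
  have h3 := congrArg (fun p => Polynomial.coeff p 1) h2
  rw [Polynomial.coeff_add, Polynomial.coeff_X_mul, Polynomial.coeff_C, Polynomial.coeff_C] at h3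
  simpa using h3

variable {J : JPartition → SymA}

theorem J_ortho (hJ : IsJackFamily J) {l m : JPartition} (h : l ≠ m) : hb alpha (J l) (J m) = 0 := by
  rw [← hall_eq]; exact hJ.orthogonal l m h

theorem J_tri (hJ : IsJackFamily J) (l m : JPartition) (h : Mc m (J l) ≠ 0) : psize m = psize l ∧ (m = l ∨ qp m < qp l) := by
  by_cases hd : dominates m l
  · refine ⟨hd.1, ?_⟩
    by_cases hml : m = l
    · exact Or.inl hml
    · exact Or.inr (dom_q hd hml)
  · exfalso
    apply h
    rw [← Mc_eq m (psize l + psize m + plen m) (by omega), ← evalN_eq]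
    exact hJ.triangular l m hd

theorem J_mem (hJ : IsJackFamily J) (l : JPartition) : J l ∈ AH F 0 (psize l) := by
  set n := psize l
  set h : SymA := ∑ m ∈ (J l).support.filter (fun m => wg m = n), monomial m (coeff m (J l))
  set h' : SymA := ∑ m ∈ (J l).support.filter (fun m => ¬ wg m = n), monomial m (coeff m (J l))
  have hsum : J l = h + h' := by
    rw [Finset.sum_filter_add_sum_filter_not]
    exact (J l).as_sum
  have hh : h ∈ AH F 0 n := Submodule.sum_mem _ fun m hm => AH_monomial _ _ (by
    have := (Finset.mem_filter.1 hm).2; omega)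
  have hh' : ∀ κ, psize κ = n → Mc κ h' = 0 := by
    intro κ hκ
    rw [map_sum]
    refine Finset.sum_eq_zero fun m hm => ?_
    by_contra hc
    have := Mc_size (n := wg m) (AH_monomial _ _ (by omega)) κ hc
    exact (Finset.mem_filter.1 hm).2 (by omega)
  have h0 : h' = 0 := by
    apply Mc_inj alpha_ne
    intro κ
    by_cases hκ : psize κ = n
    · exact hh' κ hκ
    · have e1 : Mc κ (J l) = 0 := by
        by_contra hc
        exact hκ (J_tri hJ l κ hc).1
      have e2 : Mc κ h = 0 := by
        by_contra hc
        exact hκ (Mc_size hh κ hc)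
      rw [hsum, map_add, e2, zero_add] at e1
      exact e1
  rw [hsum, h0, add_zero]; exact hh

theorem J_ne (hJ : IsJackFamily J) (l : JPartition) : J l ≠ 0 := by
  intro h
  have := hJ.normalized l
  rw [h, coeff_zero] at this
  exact zero_ne_one this

theorem J_norm_ne (hJ : IsJackFamily J) (l : JPartition) : hb alpha (J l) (J l) ≠ 0 := fun h => J_ne hJ l (hb_aniso _ h)

theorem span_orth (hJ : IsJackFamily J) {S : Set JPartition} {l : JPartition} (hl : l ∉ S) {g : SymA}
    (hg : g ∈ Submodule.span F (J '' S)) : hb alpha (J l) g = 0 := by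
  induction hg using Submodule.span_induction with
  | mem x hx =>
    obtain ⟨m, hm, rfl⟩ := hx
    exact J_ortho hJ (fun e => hl (e ▸ hm))
  | zero => simp
  | add x y _ _ hx hy => rw [map_add, hx, hy, add_zero]
  | smul c x _ hx => rw [map_smul, hx, smul_zero]

theorem span_claim (hJ : IsJackFamily J) (n t : ℕ) : ∀ h : SymA, h ∈ AH F 0 n → (∀ κ, Mc κ h ≠ 0 → qp κ < t) →
    h ∈ Submodule.span F (J '' {m | psize m = n ∧ qp m < t}) := by
  induction t with
  | zero =>
    intro h hn hq
    have : h = 0 := Mc_inj alpha_ne h fun κ => by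
      by_contra hc; exact absurd (hq κ hc) (by omega)
    rw [this]; exact Submodule.zero_mem _
  | succ t ih =>
    intro h hn hq
    have hdiag : ∀ κ, psize κ = n → qp κ = t → Mc κ (J κ) ≠ 0 := by
      intro κ hκ ht hc
      have h1 := ih (J κ) (hκ ▸ J_mem hJ κ) (fun m hm => by
        rcases (J_tri hJ κ m hm).2 with e | e
        · subst e; exact absurd hc hm
        · omega)
      exact J_norm_ne hJ κ (span_orth hJ (by simp; omega) h1)
    set S : Finset JPartition := (finite_size n).toFinset.filter (fun κ => qp κ = t)
    have hS : ∀ κ, κ ∈ S ↔ psize κ = n ∧ qp κ = t := by intro κ; simp [S]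
    set g := ∑ κ ∈ S, (Mc κ h / Mc κ (J κ)) • J κ with hg
    have hgmem : g ∈ AH F 0 n := Submodule.sum_mem _ fun κ hκ => Submodule.smul_mem _ _
      (((hS κ).1 hκ).1 ▸ J_mem hJ κ)
    have hgspan : g ∈ Submodule.span F (J '' {m | psize m = n ∧ qp m < t + 1}) :=
      Submodule.sum_mem _ fun κ hκ => Submodule.smul_mem _ _ (Submodule.subset_span
        ⟨κ, ⟨((hS κ).1 hκ).1, by rw [((hS κ).1 hκ).2]; omega⟩, rfl⟩)
    have h1 : h - g ∈ Submodule.span F (J '' {m | psize m = n ∧ qp m < t}) := by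
      apply ih _ (Submodule.sub_mem _ hn hgmem)
      intro κ hκ
      have hκn := Mc_size (Submodule.sub_mem _ hn hgmem) κ hκ
      have hg2 : ∀ m ∈ S, m ≠ κ → Mc κ (J m) ≠ 0 → qp κ < t := by
        intro m hm hne h0
        rcases (J_tri hJ m κ h0).2 with e | e
        · exact absurd e.symm hne
        · rw [((hS m).1 hm).2] at e; exact e
      by_contra hlt
      apply hκ
      rw [map_sub, hg, map_sum]
      by_cases hqt : qp κ = t
      · have hκS := (hS κ).2 ⟨hκn, hqt⟩
        rw [Finset.sum_eq_single κ]
        · rw [map_smul, smul_eq_mul, div_mul_cancel₀ _ (hdiag κ hκn hqt), sub_self]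
        · intro m hm hne
          rw [map_smul]
          by_contra hc
          exact hlt (hg2 m hm hne (fun e => hc (by rw [e, smul_zero])))
        · intro hc; exact absurd hκS hc
      · have e1 : Mc κ h = 0 := by
          by_contra hc; have := hq κ hc; omega
        rw [e1, zero_sub, neg_eq_zero]
        refine Finset.sum_eq_zero fun m hm => ?_
        rw [map_smul]
        by_contra hc
        exact hlt (hg2 m hm (fun e => hqt (e ▸ ((hS m).1 hm).2)) (fun e => hc (by rw [e, smul_zero])))
    have h2 := Submodule.add_mem _ (Submodule.span_mono (Set.image_mono (by
      intro m hm; exact ⟨hm.1, by have := hm.2; omega⟩)) h1) hgspan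
    rwa [sub_add_cancel] at h2

theorem J_span (hJ : IsJackFamily J) {n : ℕ} {h : SymA} (hn : h ∈ AH F 0 n) : h ∈ Submodule.span F (J '' {m | psize m = n}) := by
  obtain ⟨t, ht⟩ : ∃ t, ∀ κ, psize κ = n → qp κ < t := by
    refine ⟨(finite_size n).toFinset.sup qp + 1, fun κ hκ => Nat.lt_succ_of_le (Finset.le_sup (f := qp) ?_)⟩
    simpa using hκ
  refine Submodule.span_mono (Set.image_mono ?_) (span_claim hJ n t h hn fun κ hκ => ht κ (Mc_size hn κ hκ))
  intro m hm; exact hm.1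

theorem J_eig (hJ : IsJackFamily J) (l : JPartition) : I3 alpha (J l) = ei alpha l • J l := by
  induction hq : qp l using Nat.strong_induction_on generalizing l with
  | _ q ih =>
  subst hq
  set g := I3 alpha (J l) - ei alpha l • J l with hg
  have hle : ∀ m, Mc m (J l) ≠ 0 → qp m ≤ qp l := fun m hm => by
    rcases (J_tri hJ l m hm).2 with e | e
    · rw [e]
    · omega
  have hgm : g ∈ AH F 0 (psize l) := Submodule.sub_mem _ (I3_low alpha 0 _ _ (J_mem hJ l)) (Submodule.smul_mem _ _ (J_mem hJ l))
  have h1 := span_claim hJ (psize l) (qp l) g hgm (fun κ hκ => by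
    by_contra hlt
    apply hκ
    rw [hg, map_sub, map_smul, Mc_I3 alpha (J l) κ (fun m hm => (hle m hm).trans (by omega)), smul_eq_mul]
    by_cases hκl : κ = l
    · subst hκl; ring
    · have : Mc κ (J l) = 0 := by
        by_contra hc
        rcases (J_tri hJ l κ hc).2 with e | e
        · exact hκl e
        · exact hlt e
      rw [this]; ring)
  have h2 : ∀ x ∈ Submodule.span F (J '' {m | psize m = psize l ∧ qp m < qp l}), hb alpha g x = 0 := by
    intro x hx
    induction hx using Submodule.span_induction with
    | mem x hx =>
      obtain ⟨m, hm, rfl⟩ := hx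
      have hne : l ≠ m := fun e => by subst e; exact absurd hm.2 (lt_irrefl _)
      rw [hg, map_sub, LinearMap.sub_apply, hb_I3, ih _ hm.2 m rfl, map_smul, map_smul, LinearMap.smul_apply,
        J_ortho hJ hne, smul_zero, smul_zero, sub_zero]
    | zero => simp
    | add x y _ _ hx hy => rw [map_add, hx, hy, add_zero]
    | smul c x _ hx => rw [map_smul, hx, smul_zero]
  exact sub_eq_zero.1 (hb_aniso g (h2 g h1))

end jack
end JP

namespace JP
open MvPolynomial

section rigid

/-- `λ` is determined by its size and its sum of squares -/
def Rigid (l : JPartition) : Prop := ∀ m, psize m = psize l → qp m = qp l → m = l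

theorem psize_zero : psize 0 = 0 := by simp [psize_eq]
theorem psize_cons (s : ℕ+) (l : JPartition) : psize (s ::ₘ l) = s + psize l := by simp [psize_eq]
theorem qp_zero : qp 0 = 0 := by simp [qp]
theorem qp_cons (s : ℕ+) (l : JPartition) : qp (s ::ₘ l) = s ^ 2 + qp l := by simp [qp]

theorem psize_eq_zero {l : JPartition} (h : psize l = 0) : l = 0 := by
  induction l using Multiset.induction with
  | empty => rfl
  | cons a s _ => rw [psize_cons] at h; have := a.pos; omega

theorem rigid_zero : Rigid 0 := by
  intro m hm _
  rw [psize_zero] at hm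
  exact psize_eq_zero hm

theorem qp_le (l : JPartition) (M : ℕ) (h : ∀ i ∈ l, (i : ℕ) ≤ M) : qp l ≤ psize l * M := by
  induction l using Multiset.induction with
  | empty => simp [qp_zero]
  | cons a s ih =>
    rw [qp_cons, psize_cons]
    have h1 := ih (fun i hi => h i (Multiset.mem_cons_of_mem hi))
    have h2 := h a (Multiset.mem_cons_self _ _)
    nlinarith

theorem part_le {l : JPartition} {i : ℕ+} (h : i ∈ l) : (i : ℕ) ≤ psize l := by
  obtain ⟨r, rfl⟩ := Multiset.exists_cons_of_mem h
  rw [psize_cons]; omega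

theorem rigid_cons {l : JPartition} (hl : Rigid l) (s : ℕ+)
    (hs : 3 * psize l + (psize l + 1) ^ 2 + 1 ≤ (s : ℕ)) : Rigid (s ::ₘ l) := by
  intro m hm hq
  rw [psize_cons] at hm
  rw [qp_cons] at hq
  have hsp := s.pos
  have hne : m.toFinset.Nonempty := by
    rw [Finset.nonempty_iff_ne_empty]
    intro h
    rw [Multiset.toFinset_eq_empty] at h
    rw [h, psize_zero] at hm; omega
  obtain ⟨M, hM, hmax⟩ := Finset.exists_max_image m.toFinset (fun i => (i : ℕ)) hne
  rw [Multiset.mem_toFinset] at hM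
  obtain ⟨r, rfl⟩ := Multiset.exists_cons_of_mem hM
  rw [psize_cons] at hm
  rw [qp_cons] at hq
  have hr1 := qp_le r M (fun i hi => hmax i (by rw [Multiset.mem_toFinset]; exact Multiset.mem_cons_of_mem hi))
  have hr2 := qp_le r (psize r) (fun i hi => part_le hi)
  have hQ := qp_le l (psize l) (fun i hi => part_le hi)
  rcases lt_trichotomy (M : ℕ) (s : ℕ) with h | h | h
  · exfalso
    generalize (M : ℕ) = M' at *
    generalize (s : ℕ) = s' at *
    generalize psize r = R at *
    generalize psize l = L at *
    generalize qp r = qr at *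
    generalize qp l = Q at *
    rcases le_total R M' with h1 | h1
    · obtain ⟨d, rfl⟩ : ∃ d, s' = M' + 1 + d := ⟨s' - M' - 1, by omega⟩
      obtain rfl : R = L + 1 + d := by omega
      obtain ⟨e, rfl⟩ : ∃ e, M' = L + 1 + d + e := ⟨M' - (L + 1 + d), by omega⟩
      nlinarith [Nat.zero_le (d * e), Nat.zero_le (d * L), Nat.zero_le (d * d)]
    · have h2 : 2 * M' ≤ s' + L := by omega
      have h3 : M' ^ 2 + qr ≤ M' * (s' + L) := by rw [← hm]; nlinarith
      have h4 : 2 * (s' ^ 2) ≤ (s' + L) ^ 2 := by nlinarith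
      have h5 : 3 * L < s' := by nlinarith
      nlinarith
  · have e : M = s := PNat.coe_injective h
    subst e
    rw [hl r (by omega) (by omega)]
  · exfalso
    have : ((s : ℕ) + 1) ^ 2 ≤ (M : ℕ) ^ 2 := Nat.pow_le_pow_left h 2
    nlinarith

end rigid
end JP

namespace JP
open MvPolynomial

section yd
variable {K : Type*} [Field K] [CharZero K]

/-- divided power `p_1^N/(α^N N!)` -/
def Yd (α : K) (N : ℕ) : SA K := ((α ^ N * N.factorial)⁻¹ : K) • X 1 ^ N

theorem Yd_AH (α : K) (N : ℕ) {k d : ℕ} {f : SA K} (hf : f ∈ AH K k d) : Yd α N * f ∈ AH K k (d + N) := by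
  have : ∀ N, X 1 ^ N * f ∈ AH K k (d + N) := by
    intro N
    induction N with
    | zero => simpa using hf
    | succ N ih =>
      rw [pow_succ', mul_assoc]
      apply AH_X_mul
      show _ ∈ AH K (k + 1) (d + N + 1)
      exact (AH_shift 1).2 ih
  rw [Yd, smul_mul_assoc]
  exact Submodule.smul_mem _ _ (this N)

theorem divpow {A : Type*} [CommRing A] [Algebra K A] (y : A) (Y : ℕ → A) (hY0 : Y 0 = 1)
    (hY : ∀ n : ℕ, ((n + 1 : ℕ) : K) • Y (n + 1) = y * Y n)
    (E : ℕ → A →ₗ[K] A) (hE : ∀ i f, E i (y * f) = y * E i f + ((i + 1 : ℕ) : K) • E (i + 1) f)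
    (N : ℕ) (f : A) : E 0 (Y N * f) = ∑ p ∈ Finset.HasAntidiagonal.antidiagonal N, Y p.1 * E p.2 f := by
  induction N generalizing f with
  | zero => simp [hY0]
  | succ N ih =>
    have hn : ((N + 1 : ℕ) : K) ≠ 0 := by exact_mod_cast Nat.succ_ne_zero N
    have h1 : ((N + 1 : ℕ) : K) • E 0 (Y (N + 1) * f) = ((N + 1 : ℕ) : K) •
        ∑ p ∈ Finset.HasAntidiagonal.antidiagonal (N + 1), Y p.1 * E p.2 f := by
      rw [← map_smul, ← smul_mul_assoc, hY, mul_comm y, mul_assoc, ih]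
      simp only [hE, mul_add, mul_smul_comm]
      rw [Finset.sum_add_distrib, Finset.smul_sum]
      have h2 : ∀ p ∈ Finset.HasAntidiagonal.antidiagonal (N + 1), ((N + 1 : ℕ) : K) • (Y p.1 * E p.2 f)
          = (p.1 : K) • (Y p.1 * E p.2 f) + (p.2 : K) • (Y p.1 * E p.2 f) := by
        intro p hp
        rw [← Finset.HasAntidiagonal.mem_antidiagonal.1 hp, ← add_smul]; push_cast; rfl
      rw [Finset.sum_congr rfl h2, Finset.sum_add_distrib]
      congr 1
      · rw [Finset.Nat.sum_antidiagonal_succ]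
        simp only [Nat.cast_zero, zero_smul, zero_add]
        refine Finset.sum_congr rfl fun p _ => ?_
        rw [← smul_mul_assoc, hY]; ring
      · rw [Finset.Nat.sum_antidiagonal_succ']
        simp only [Nat.cast_zero, zero_smul, zero_add]
    exact smul_right_injective A hn h1

theorem W_gt {α : K} (hα : α ≠ 0) (s k d : ℕ) (hk : s < k) (hd : d ≤ s + k) {f : SA K} (hf : f ∈ AH K 0 d) :
    W α (-α * s) 1 k f = 0 := by
  have h1 := W_low α (-α * s) 1 k 0 d f hf
  rw [zero_add] at h1
  apply ph_inj (ι := Fin s) (κ := -α) hα (neg_ne_zero.2 hα) s (by simp) _ (AH_Le (by omega) h1)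
  have h2 := ph_W hα (ι := Fin s) k f
  rw [Fintype.card_fin] at h2
  have e0 : esymm (Fin s) K k = 0 := by
    rw [esymm, Finset.powersetCard_eq_empty.2 (by simpa using hk), Finset.sum_empty]
  rw [h2, e0, map_zero, LinearMap.zero_apply]

theorem W_Yd {α : K} (hα : α ≠ 0) (s n d N : ℕ) (hn : n ≤ s) (hd : d + N = n + s) {f : SA K} (hf : f ∈ AH K 0 d) :
    W α (-α * s) 1 s (Yd α N * f) = ∑ p ∈ Finset.HasAntidiagonal.antidiagonal N,
      if p.2 ≤ s then Yd α p.1 * W α (-α * s) 1 (s - p.2) f else 0 := by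
  have hk : (-α) ≠ 0 := neg_ne_zero.2 hα
  rw [← sub_eq_zero]
  have hmem : W α (-α * s) 1 s (Yd α N * f) - ∑ p ∈ Finset.HasAntidiagonal.antidiagonal N,
      (if p.2 ≤ s then Yd α p.1 * W α (-α * s) 1 (s - p.2) f else 0) ∈ AH K s (n + s) := by
    refine Submodule.sub_mem _ ?_ (Submodule.sum_mem _ fun p hp => ?_)
    · have := W_low α (-α * s) 1 s 0 _ _ (Yd_AH α N hf)
      rwa [zero_add, hd] at this
    · have hp' := Finset.HasAntidiagonal.mem_antidiagonal.1 hp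
      split_ifs with h
      · have h1 := Yd_AH α p.1 (W_low α (-α * s) 1 (s - p.2) 0 d f hf)
        have h2 := (AH_shift p.2).2 h1
        have e1 : 0 + (s - p.2) + p.2 = s := by omega
        have e2 : d + p.1 + p.2 = n + s := by omega
        rwa [e1, e2] at h2
      · exact Submodule.zero_mem _
  apply ph_inj (ι := Fin s) (κ := -α) hα hk n (by simpa using hn) _ (AH_Le (by omega) hmem)
  rw [map_sub, map_sum, sub_eq_zero]
  have hW := fun k f => ph_W hα (ι := Fin s) k f
  simp only [Fintype.card_fin] at hW
  set y : MvPolynomial (Fin s) K := -∑ b, X b with hy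
  have hYd : ∀ N, ph (Fin s) (-α) (Yd α N) = ((N.factorial : K)⁻¹) • y ^ N := by
    intro N
    have e1 : ph (Fin s) (-α) (X 1) = α • y := by
      rw [ph_X, hy, smul_neg, neg_smul]; simp
    rw [Yd, map_smul, map_pow, e1, smul_pow, smul_smul]
    congr 1
    have := pow_ne_zero N hα
    have hN : (N.factorial : K) ≠ 0 := by exact_mod_cast N.factorial_ne_zero
    field_simp
  have key := divpow y (fun N => ((N.factorial : K)⁻¹) • y ^ N) (by simp)
    (fun n => by
      have hN : (n.factorial : K) ≠ 0 := by exact_mod_cast n.factorial_ne_zero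
      have hN' : ((n : K) + 1) ≠ 0 := by exact_mod_cast Nat.succ_ne_zero n
      beta_reduce
      rw [smul_smul, mul_smul_comm, ← pow_succ']
      congr 1
      rw [Nat.factorial_succ]; push_cast
      field_simp)
    (fun i => if i ≤ s then Psi (-1) (-α) (esymm (Fin s) K (s - i)) else 0)
    (fun i f => by
      beta_reduce
      by_cases hi : i ≤ s
      · rw [if_pos hi, hy, neg_mul, map_neg, Psi_xbar]
        by_cases hi' : i + 1 ≤ s
        · rw [if_pos hi']
          obtain ⟨k, hk⟩ : ∃ k, s - i = k + 1 := ⟨s - i - 1, by omega⟩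
          have hk' : s - (i + 1) = k := by omega
          rw [hk, hk', Eder_esymm, Fintype.card_fin]
          have : ((s : MvPolynomial (Fin s) K) - (k : MvPolynomial (Fin s) K)) * esymm (Fin s) K k
              = ((i + 1 : ℕ) : K) • esymm (Fin s) K k := by
            have h1 : (s : MvPolynomial (Fin s) K) = ((k + (i + 1) : ℕ) : MvPolynomial (Fin s) K) := by
              congr 1; omega
            rw [smul_eq_C_mul, h1]
            congr 1
            push_cast
            simp
          rw [this, map_smul, LinearMap.smul_apply]
          simp only [neg_smul, one_smul, neg_mul]
          abel
        · rw [if_neg hi']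
          have : s - i = 0 := by omega
          rw [this]
          simp
      · rw [if_neg hi, if_neg (by omega)]; simp) N (ph (Fin s) (-α) f)
  beta_reduce at key
  rw [if_pos (Nat.zero_le _), Nat.sub_zero, ← hYd, ← map_mul, ← hW] at key
  rw [key]
  refine Finset.sum_congr rfl fun p _ => ?_
  split_ifs with h
  · rw [map_mul, hYd, hW]
  · simp

end yd

section eps
variable (J : JPartition → SymA)

/-- evaluation functional -/
def eps (l : JPartition) : SymA →ₗ[F] F :=
  ∑ j ∈ Finset.range (psize l + 1), hb alpha (J l) ∘ₗ LinearMap.mulLeft F (Yd alpha j)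

theorem eps_apply (l : JPartition) (f : SymA) : eps J l f = ∑ j ∈ Finset.range (psize l + 1), hb alpha (J l) (Yd alpha j * f) := by
  simp [eps]

theorem hb_degree {k d k' d' : ℕ} {f g : SymA} (hf : f ∈ AH F k d) (hg : g ∈ AH F k' d') (h : d + k' ≠ d' + k) :
    hb alpha f g = 0 := by
  rw [hb_eq_sum]
  refine Finset.sum_eq_zero fun m hm => ?_
  have h1 := hf m (mem_support_iff.1 hm)
  by_cases h0 : coeff m g = 0
  · rw [h0]; ring
  · have h2 := hg m h0
    omega

variable {J} 

theorem eps_hom (hJ : IsJackFamily J) (l : JPartition) {k d : ℕ} {f : SymA} (hf : f ∈ AH F k d) :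
    eps J l f = if d ≤ psize l + k then hb alpha (J l) (Yd alpha (psize l + k - d) * f) else 0 := by
  rw [eps_apply]
  split_ifs with h
  · by_cases hk : k ≤ d
    · rw [Finset.sum_eq_single (psize l + k - d)]
      · intro j _ hj
        exact hb_degree (J_mem hJ l) (Yd_AH alpha j hf) (by omega)
      · intro hc
        simp at hc; omega
    · rw [AH_eq_zero (by omega) hf]; simp
  · refine Finset.sum_eq_zero fun j _ => hb_degree (J_mem hJ l) (Yd_AH alpha j hf) (by omega)

theorem hb_Yd (hJ : IsJackFamily J) (l : JPartition) : hb alpha (J l) (Yd alpha (psize l)) = 1 := by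
  have hα := pow_ne_zero (psize l) alpha_ne
  have e : Yd alpha (psize l) = monomial (Finsupp.single 1 (psize l)) ((alpha ^ (psize l) * (psize l).factorial)⁻¹ : F) := by
    rw [Yd, X_pow_eq_monomial, smul_monomial, smul_eq_mul, mul_one]
  rw [e, hb_monomial_right, hJ.normalized, zg]
  have hN : ((psize l).factorial : F) ≠ 0 := by exact_mod_cast (psize l).factorial_ne_zero
  rw [Finsupp.prod_single_index (by simp), Finsupp.sum_single_index (by simp)]
  field_simp
  simp

end eps
end JP

namespace JP
open MvPolynomial

section F1
variable {J : JPartition → SymA}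

theorem W_mem_n (s n : ℕ) {h : SymA} (hh : h ∈ AH F 0 (n + s)) : W alpha (-alpha * s) 1 s h ∈ AH F 0 n := by
  have := W_low alpha (-alpha * s) 1 s 0 (n + s) h hh
  exact (AH_shift s).1 this

theorem rho_eig (hJ : IsJackFamily J) (l : JPartition) (s : ℕ) (hs : psize l ≤ s) (m : JPartition)
    (hm : psize m = psize l + s) (h0 : hb alpha (J l) (W alpha (-alpha * s) 1 s (J m)) ≠ 0) :
    qp m = qp l + s ^ 2 := by
  have hJm : J m ∈ AH F 0 (psize l + s) := hm ▸ J_mem hJ m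
  have h1 := congrArg (hb alpha (J l)) (W_I3 alpha_ne s (psize l) hs hJm)
  rw [J_eig hJ m, map_smul, map_smul, map_add, map_smul, ← hb_I3, J_eig hJ l, map_smul, LinearMap.smul_apply] at h1
  simp only [smul_eq_mul] at h1
  have h2 : ei alpha m = ei alpha l + (alpha ^ 2 * s ^ 2 - alpha * (2 * psize l + s)) := by
    apply mul_right_cancel₀ h0
    rw [h1]; ring
  unfold ei at h2
  have h3 := alpha_irr ((qp m : ℤ) - qp l - s ^ 2)
    (zint (xexp m (plen m)) - zint (xexp l (plen l)) + (2 * psize l + s)) (by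
      push_cast
      linear_combination h2)
  zify
  linarith

theorem rho_eq (hJ : IsJackFamily J) (l : JPartition) (s : ℕ+) (hs : psize l ≤ s) (hr : Rigid (s ::ₘ l)) :
    ∃ c : F, ∀ h ∈ AH F 0 (psize l + s), hb alpha (J l) (W alpha (-alpha * (s : ℕ)) 1 s h) = c * hb alpha (J (s ::ₘ l)) h := by
  refine ⟨hb alpha (J l) (W alpha (-alpha * (s : ℕ)) 1 s (J (s ::ₘ l))) / hb alpha (J (s ::ₘ l)) (J (s ::ₘ l)), fun h hh => ?_⟩
  have h1 := J_span hJ hh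
  induction h1 using Submodule.span_induction with
  | mem x hx =>
    obtain ⟨m, hm, rfl⟩ := hx
    by_cases e : m = s ::ₘ l
    · subst e
      rw [div_mul_cancel₀ _ (J_norm_ne hJ _)]
    · rw [J_ortho hJ (Ne.symm e), mul_zero]
      by_contra h0
      exact e (hr m (by rw [psize_cons, hm]; omega) (by rw [qp_cons, rho_eig hJ l s hs m hm h0]; omega))
  | zero => simp
  | add x y hx' hy' hx hy =>
    have hx2 : x ∈ AH F 0 (psize l + s) := (Submodule.span_le.2 (by rintro _ ⟨m, hm, rfl⟩; exact hm ▸ J_mem hJ m)) hx'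
    have hy2 : y ∈ AH F 0 (psize l + s) := (Submodule.span_le.2 (by rintro _ ⟨m, hm, rfl⟩; exact hm ▸ J_mem hJ m)) hy'
    rw [map_add, map_add, map_add, hx hx2, hy hy2, mul_add]
  | smul c x hx' hx =>
    have hx2 : x ∈ AH F 0 (psize l + s) := (Submodule.span_le.2 (by rintro _ ⟨m, hm, rfl⟩; exact hm ▸ J_mem hJ m)) hx'
    rw [map_smul, map_smul, map_smul, hx hx2, smul_eq_mul, smul_eq_mul]; ring

theorem eps_Z_aux (hJ : IsJackFamily J) (l : JPartition) (s : ℕ+) (hs : psize l ≤ s) (c : F)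
    (hc : ∀ h ∈ AH F 0 (psize l + s), hb alpha (J l) (W alpha (-alpha * (s : ℕ)) 1 s h) = c * hb alpha (J (s ::ₘ l)) h)
    {d : ℕ} {f : SymA} (hf : f ∈ AH F 0 d) :
    eps J l (Zop alpha (-alpha * (s : ℕ)) 1 f) = c * eps J (s ::ₘ l) f := by
  set n := psize l with hn
  set G : ℕ → F := fun k => eps J l (W alpha (-alpha * (s : ℕ)) 1 k f) with hG
  have hGd : ∀ k, d < k → G k = 0 := by
    intro k hk
    simp only [hG]
    rw [AH_eq_zero (by omega) (W_low alpha (-alpha * (s : ℕ)) 1 k 0 d f hf), map_zero]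
  have hG1 : ∀ k, G k = if d ≤ n + k then hb alpha (J l) (Yd alpha (n + k - d) * W alpha (-alpha * (s : ℕ)) 1 k f) else 0 := by
    intro k
    simp only [hG]
    rw [eps_hom hJ l (W_low alpha (-alpha * (s : ℕ)) 1 k 0 d f hf), zero_add]
  have hGs : ∀ k : ℕ, (s : ℕ) < k → G k = 0 := by
    intro k hk
    rw [hG1]
    split_ifs with h
    · rw [W_gt alpha_ne s k d hk (by omega) hf, mul_zero, map_zero]
    · rfl
  have hZ : eps J l (Zop alpha (-alpha * (s : ℕ)) 1 f) = ∑ k ∈ Finset.range (s + 1), G k := by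
    rw [Zop_eq alpha (-alpha * (s : ℕ)) 1 (N := s + d + 1) (by omega) (AH_Le (e := d) (by omega) hf), map_sum]
    symm
    apply Finset.sum_subset
    · intro k hk; simp at hk ⊢; omega
    · intro k _ hk
      exact hGs k (by simp at hk; omega)
  rw [hZ, eps_hom hJ (s ::ₘ l) hf, psize_cons]
  split_ifs with h
  · set N := (s : ℕ) + psize l + 0 - d with hN
    have hdN : d + N = n + s := by omega
    rw [← hc _ (by have := Yd_AH alpha N hf; rwa [hdN] at this), W_Yd alpha_ne s n d N hs hdN hf, map_sum,
      ← Finset.Nat.sum_antidiagonal_swap, Finset.Nat.sum_antidiagonal_eq_sum_range_succ_mk, ← Finset.sum_range_reflect]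
    have h1 : ∀ i ∈ Finset.range (s + 1), G (s + 1 - 1 - i) = if i ≤ N then
        hb alpha (J l) (Yd alpha (N - i) * W alpha (-alpha * (s : ℕ)) 1 (s - i) f) else 0 := by
      intro i hi
      have hi' : i < s + 1 := by simpa using hi
      rw [hG1]
      have e1 : (s : ℕ) + 1 - 1 - i = s - i := by omega
      rw [e1]
      by_cases hiN : i ≤ N
      · rw [if_pos hiN, if_pos (by omega)]
        have e2 : n + ((s : ℕ) - i) - d = N - i := by omega
        rw [e2]
      · rw [if_neg hiN, if_neg (by omega)]
    rw [Finset.sum_congr rfl h1, ← Finset.sum_filter]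
    have h2 : ∀ i ∈ Finset.range (N + 1), hb alpha (J l) (if i ≤ (s : ℕ) then Yd alpha (N - i) * W alpha (-alpha * (s : ℕ)) 1 (s - i) f else 0)
       = if i ≤ (s : ℕ) then hb alpha (J l) (Yd alpha (N - i) * W alpha (-alpha * (s : ℕ)) 1 (s - i) f) else 0 := by
      intro i _
      split_ifs
      · rfl
      · exact map_zero _
    have h3 : Finset.filter (fun i => i ≤ N) (Finset.range ((s : ℕ) + 1)) = Finset.filter (fun i => i ≤ (s : ℕ)) (Finset.range (N + 1)) := by
      ext i; simp; omega
    rw [h3, Finset.sum_filter]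
    exact (Finset.sum_congr rfl h2).symm
  · rw [mul_zero]
    refine Finset.sum_eq_zero fun k hk => ?_
    have hk' : k < s + 1 := by simpa using hk
    rw [hG1, if_neg (by omega)]

theorem eps_Z (hJ : IsJackFamily J) (l : JPartition) (hl : Rigid l) (s : ℕ+)
    (hs : 3 * psize l + (psize l + 1) ^ 2 + 1 ≤ (s : ℕ)) (f : SymA) :
    eps J l (Zop alpha (-alpha * (s : ℕ)) 1 f) = eps J (s ::ₘ l) f := by
  have hs' : psize l ≤ s := by nlinarith
  obtain ⟨c, hc⟩ := rho_eq hJ l s hs' (rigid_cons hl s hs)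
  have h1 : (1 : SymA) ∈ AH F 0 0 := by
    have := AH_monomial (K := F) (k := 0) (d := 0) 0 1 (by simp [wg_zero])
    simpa using this
  have e1 : ∀ m : JPartition, eps J m 1 = 1 := by
    intro m
    rw [eps_hom hJ m h1, if_pos (by omega)]
    simp [hb_Yd hJ]
  have hc1 : c = 1 := by
    have h2 := eps_Z_aux hJ l s hs' c hc h1
    rw [e1, mul_one, Zop_eq alpha _ 1 (N := 1) (d := 0) (by omega) (AH_Le (by omega) h1)] at h2
    simp [W_zero, e1] at h2
    exact h2.symm
  have : eps J l ∘ₗ Zop alpha (-alpha * (s : ℕ)) 1 = eps J (s ::ₘ l) := by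
    apply lin_ext
    intro m
    have := eps_Z_aux hJ l s hs' c hc (AH_monomial (K := F) (k := 0) m 1 rfl)
    rw [hc1, one_mul] at this
    exact this
  exact LinearMap.congr_fun this f

end F1
end JP

namespace JP
open MvPolynomial

section top
variable {K : Type*} [Field K] [CharZero K]

theorem coeff_pderiv_add (j : ℕ+) (m : ℕ+ →₀ ℕ) (f : SA K) :
    coeff m (pderiv j f) = ((m j : K) + 1) * coeff (m + Finsupp.single j 1) f := by
  have : lcoeff K m ∘ₗ (pderiv j : Derivation K (SA K) (SA K)).toLinearMap
      = ((m j : K) + 1) • lcoeff K (m + Finsupp.single j 1) := by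
    apply lin_ext
    intro m'
    simp only [LinearMap.comp_apply, LinearMap.smul_apply, lcoeff_apply, smul_eq_mul]
    show coeff m (pderiv j (monomial m' 1)) = _
    rw [pderiv_monomial, coeff_monomial, coeff_monomial]
    by_cases h : m' = m + Finsupp.single j 1
    · subst h
      simp
    · rw [if_neg h, mul_zero]
      by_cases h0 : m' j = 0
      · simp [h0]
      · rw [if_neg]
        rintro rfl
        apply h
        ext i
        by_cases hi : j = i
        · subst hi; simp; omega
        · simp [Finsupp.single_apply, hi]
  exact LinearMap.congr_fun this f

theorem Xop_zero_of_gt (α : K) {ℓ d : ℕ} (h : d < ℓ) {f : SA K} (hf : f ∈ Le K d) : Xop α ℓ f = 0 := by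
  rw [Xop_eq α ℓ (Nat.lt_succ_self d) hf]
  refine Finset.sum_eq_zero fun k hk => ?_
  rw [Xc, bdc_gt _ _ _ (by simp at hk; omega)]; simp

theorem Xop_Le (α : K) {ℓ d e : ℕ} (h : d ≤ e + ℓ) {f : SA K} (hf : f ∈ Le K d) : Xop α ℓ f ∈ Le K e := by
  rw [Xop_eq α ℓ (Nat.lt_succ_self d) hf]
  refine Submodule.sum_mem _ fun k hk => ?_
  by_cases hk' : k < ℓ
  · rw [Xc, bdc_gt _ _ _ hk']; simp
  · exact low_Le (Xc_low α ℓ k) (by omega) hf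

theorem Xop_top {α : K} (hα : α ≠ 0) {D : ℕ} {f : SA K} (hf : f ∈ Le K D) (j : ℕ+) (m : ℕ+ →₀ ℕ)
    (hm : wg m + j = D) : coeff m (Xop α j f) = (-1) ^ (j : ℕ) * (((m j : K) + 1) * coeff (m + Finsupp.single j 1) f) := by
  rw [Xop_eq α j (Nat.lt_succ_self D) hf, coeff_sum, Finset.sum_eq_single (j : ℕ)]
  · rw [Xc, LinearMap.smul_apply, bdc_self hα, smul_smul, coeff_smul, coeff_pderiv_add, smul_eq_mul]
    congr 1
    have : ((j : ℕ) : K) ≠ 0 := by exact_mod_cast j.ne_zero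
    field_simp
  · intro k _ hk
    by_cases hk' : k < j
    · rw [Xc, bdc_gt _ _ _ hk']; simp
    · by_contra h
      by_cases hD : D < k
      · rw [low_Le_zero (Xc_low α j k) hD hf] at h; simp at h
      · have := low_Le (Xc_low α j k) (e := D - k) (by omega) hf m h
        omega
  · intro h
    exfalso; apply h; simp; omega

/-- detect degree from the operators `Xop` -/
theorem Le_of_Xop {α : K} (hα : α ≠ 0) {d : ℕ} {f : SA K}
    (h : ∀ j : ℕ+, ∀ m, coeff m (Xop α j f) ≠ 0 → wg m + j ≤ d) : f ∈ Le K d := by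
  obtain ⟨D, hD⟩ := exists_Le f
  have key : ∀ D, f ∈ Le K (d + D) → f ∈ Le K d := by
    intro D
    induction D with
    | zero => exact fun h => h
    | succ D ih =>
      intro hD
      apply ih
      intro m hm
      have h1 := hD m hm
      by_contra h2
      have h3 : wg m = d + (D + 1) := by omega
      have hm0 : m ≠ 0 := by
        rintro rfl
        rw [wg_zero] at h3; omega
      obtain ⟨j, hj⟩ := Finsupp.ne_iff.1 hm0
      simp at hj
      have hle : Finsupp.single j 1 ≤ m := by
        rw [Finsupp.single_le_iff]; omega
      have e : m - Finsupp.single j 1 + Finsupp.single j 1 = m := tsub_add_cancel_of_le hle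
      have h4 : wg (m - Finsupp.single j 1) + j = d + (D + 1) := by
        have := wg_add (m - Finsupp.single j 1) (Finsupp.single j 1)
        rw [e, wg_single] at this; omega
      have h5 := Xop_top hα hD j _ h4
      have h6 := h j (m - Finsupp.single j 1) (by
        rw [h5, e]
        refine mul_ne_zero (pow_ne_zero _ (by norm_num)) (mul_ne_zero ?_ hm)
        exact Nat.cast_add_one_ne_zero _)
      omega
  exact key D (Le_mono (by omega) hD)

end top

section chi
variable {J : JPartition → SymA}

def ZL : List F → Module.End F SymA
  | [] => 1
  | a :: L => Zop alpha a 1 ∘ₗ ZL L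

theorem ZL_append (L L' : List F) (f : SymA) : ZL (L ++ L') f = ZL L (ZL L' f) := by
  induction L with
  | nil => rfl
  | cons a L ih => simp only [List.cons_append, ZL, LinearMap.comp_apply, ih]

theorem ZL_replicate (a : F) (m : ℕ) (f : SymA) : ZL (List.replicate m a) f = Zop alpha a m f := by
  induction m with
  | zero => simp [ZL, Zop_zero alpha_ne]
  | succ m ih =>
    rw [List.replicate_succ, ZL, LinearMap.comp_apply, ih, Zop_add alpha_ne]
    congr 1; push_cast; rw [add_comm]

theorem chi_mult (hJ : IsJackFamily J) (st : SymA →ₗ[F] SymA →ₗ[F] SymA)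
    (hst : ∀ l f h, eps J l (st f h) = eps J l f * eps J l h) (L : List F) :
    ∀ l, Rigid l → ∀ f h, eps J l (ZL L (st f h)) = eps J l (ZL L f) * eps J l (ZL L h) := by
  induction L with
  | nil => intro l _ f h; exact hst l f h
  | cons a L ih =>
    intro l hl f h
    have hp : PolyF (fun u : F => eps J l (Zop alpha u 1 (ZL L (st f h))) -
        LinearMap.mul F F (eps J l (Zop alpha u 1 (ZL L f))) (eps J l (Zop alpha u 1 (ZL L h)))) :=
      PolyF.sub (PolyF.lin _ (Zop_poly_u alpha 1 _)) (PolyF.bilin _ (PolyF.lin _ (Zop_poly_u alpha 1 _)) (PolyF.lin _ (Zop_poly_u alpha 1 _)))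
    have := hp.vanish (infinite_negs alpha_ne (3 * psize l + (psize l + 1) ^ 2 + 1)) (by
      rintro _ ⟨n, rfl⟩
      obtain ⟨s, hs⟩ : ∃ s : ℕ+, (s : ℕ) = n + (3 * psize l + (psize l + 1) ^ 2 + 1) :=
        ⟨⟨n + (3 * psize l + (psize l + 1) ^ 2 + 1), by omega⟩, rfl⟩
      beta_reduce
      rw [← hs]
      simp only [eps_Z hJ l hl s (by omega)]
      rw [ih _ (rigid_cons hl s (by omega)), LinearMap.mul_apply', sub_self]) a
    simp only [LinearMap.mul_apply', sub_eq_zero] at this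
    exact this

def chi (J : JPartition → SymA) (L : List F) : SymA →ₗ[F] F := eps J 0 ∘ₗ ZL L

theorem chi_Z (L : List F) (a : F) (m : ℕ) (f : SymA) : chi J L (Zop alpha a m f) = chi J (L ++ List.replicate m a) f := by
  simp only [chi, LinearMap.comp_apply]
  rw [ZL_append, ZL_replicate]

theorem chi_der (hJ : IsJackFamily J) (st : SymA →ₗ[F] SymA →ₗ[F] SymA)
    (hst : ∀ l f h, eps J l (st f h) = eps J l f * eps J l h) (L : List F) (a : F) (f h : SymA) :
    chi J L (XU alpha a (st f h) - (st (XU alpha a f) h + st f (XU alpha a h))) = 0 := by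
  have hm : ∀ L f h, chi J L (st f h) = chi J L f * chi J L h := fun L => chi_mult hJ st hst L 0 rigid_zero
  obtain ⟨g1, hg1, e1⟩ := Zop_expand alpha a (st f h)
  obtain ⟨g2, hg2, e2⟩ := Zop_expand alpha a f
  obtain ⟨g3, hg3, e3⟩ := Zop_expand alpha a h
  set c := chi J L with hc
  let B := LinearMap.mul F F
  have hp : PolyF (fun t : F => c (g1 t) - (B (c (g2 t)) (c h + t ^ 1 • c (XU alpha a h) + t ^ 2 • c (g3 t)) +
      (c (XU alpha a f) * c (XU alpha a h) + t ^ 1 • (c (XU alpha a f) * c (g3 t)) + c f * c (g3 t)))) := by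
    refine PolyF.sub (PolyF.lin _ hg1) (PolyF.add (PolyF.bilin _ (PolyF.lin _ hg2) (PolyF.add (PolyF.add (PolyF.const _) (PolyF.pow_smul_const _ _)) (PolyF.pow_smul 2 (PolyF.lin _ hg3)))) ?_)
    exact PolyF.add (PolyF.add (PolyF.const _) (PolyF.pow_smul 1 (PolyF.lin (B (c (XU alpha a f)) ∘ₗ c) hg3))) (PolyF.lin (B (c f) ∘ₗ c) hg3)
  refine PolyF.linear_coeff hp infinite_nat ?_
  rintro _ ⟨m, rfl⟩
  have h1 : c (Zop alpha a m (st f h)) = c (Zop alpha a m f) * c (Zop alpha a m h) := by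
    rw [hc, chi_Z, chi_Z, chi_Z, hm]
  have h0 : ∀ f h, c (st f h) = c f * c h := hm L
  rw [e1, e2, e3] at h1
  simp only [map_add, map_smul, map_sub, smul_eq_mul, h0, LinearMap.mul_apply', B] at h1 ⊢
  linear_combination h1

theorem chi_XU (f : SymA) (hf : ∀ L, chi J L f = 0) (a : F) : ∀ L, chi J L (XU alpha a f) = 0 := by
  intro L
  obtain ⟨g, hg, e⟩ := Zop_expand alpha a f
  refine PolyF.linear_coeff (PolyF.lin (chi J L) hg) infinite_nat ?_
  rintro _ ⟨m, rfl⟩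
  have h1 : chi J L (Zop alpha a m f) = 0 := by rw [chi_Z, hf]
  rw [e] at h1
  simpa [hf] using h1

theorem chi_Xop (f : SymA) (hf : ∀ L, chi J L f = 0) (ℓ : ℕ) : ∀ L, chi J L (Xop alpha ℓ f) = 0 := by
  intro L
  obtain ⟨d, hd⟩ := exists_Le f
  by_cases h : ℓ < d + 1
  · refine poly_vanish (d + 1) (fun ℓ => chi J L (Xop alpha ℓ f)) _ (infinite_nat (K := F)) ?_ ℓ h
    intro u _
    have := chi_XU f hf u L
    rw [XU_Xop alpha u hd, map_sum] at this
    simpa using this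
  · rw [Xop_zero_of_gt alpha (by omega) hd, map_zero]

theorem eps_zero_one (hJ : IsJackFamily J) : eps J 0 1 = 1 := by
  have h1 : (1 : SymA) ∈ AH F 0 0 := by
    have := AH_monomial (K := F) (k := 0) (d := 0) 0 1 (by simp [wg_zero])
    simpa using this
  rw [eps_hom hJ 0 h1, if_pos (by omega)]
  simp [hb_Yd hJ]

theorem chi_inj (hJ : IsJackFamily J) (d : ℕ) : ∀ f : SymA, f ∈ Le F d → (∀ L, chi J L f = 0) → f = 0 := by
  induction d using Nat.strong_induction_on with
  | _ d ih =>
    intro f hf h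
    have h0 : f ∈ Le F 0 := by
      apply Le_of_Xop alpha_ne
      intro j m hm
      exfalso; apply hm
      have : Xop alpha j f = 0 := by
        by_cases hj : d < j
        · exact Xop_zero_of_gt alpha hj hf
        · have := j.pos
          exact ih (d - j) (by omega) _ (Xop_Le alpha (by omega) hf) (chi_Xop f h j)
      rw [this, coeff_zero]
    have h1 : f = coeff 0 f • (1 : SymA) := by
      ext m
      rw [coeff_smul, coeff_one]
      by_cases hm : 0 = m
      · subst hm; simp
      · rw [if_neg hm, smul_zero]
        by_contra h2
        have := h0 m h2
        have := wg_pos (Ne.symm hm)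
        omega
    have h2 := h []
    rw [h1] at h2
    simp only [chi, LinearMap.comp_apply, ZL, Module.End.one_apply, map_smul, eps_zero_one hJ, smul_eq_mul, mul_one] at h2
    rw [h1, h2, zero_smul]

theorem XU_der (hJ : IsJackFamily J) (st : SymA →ₗ[F] SymA →ₗ[F] SymA)
    (hst : ∀ l f h, eps J l (st f h) = eps J l f * eps J l h) (a : F) (f h : SymA) :
    XU alpha a (st f h) - (st (XU alpha a f) h + st f (XU alpha a h)) = 0 := by
  obtain ⟨d, hd⟩ := exists_Le (XU alpha a (st f h) - (st (XU alpha a f) h + st f (XU alpha a h)))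
  exact chi_inj hJ d _ hd fun L => chi_der hJ st hst L a f h

theorem Xop_der (hJ : IsJackFamily J) (st : SymA →ₗ[F] SymA →ₗ[F] SymA)
    (hst : ∀ l f h, eps J l (st f h) = eps J l f * eps J l h) (ℓ : ℕ) (f h : SymA) :
    Xop alpha ℓ (st f h) = st (Xop alpha ℓ f) h + st f (Xop alpha ℓ h) := by
  obtain ⟨d1, hd1⟩ := exists_Le f
  obtain ⟨d2, hd2⟩ := exists_Le h
  obtain ⟨d3, hd3⟩ := exists_Le (st f h)
  set d := d1 + d2 + d3 + ℓ with hd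
  have h1 := Le_mono (show d1 ≤ d by omega) hd1
  have h2 := Le_mono (show d2 ≤ d by omega) hd2
  have h3 := Le_mono (show d3 ≤ d by omega) hd3
  rw [← sub_eq_zero]
  refine poly_vanish (d + 1) (fun ℓ => Xop alpha ℓ (st f h) - (st (Xop alpha ℓ f) h + st f (Xop alpha ℓ h))) _ (infinite_nat (K := F)) ?_ ℓ (by omega)
  intro u _
  have := XU_der hJ st hst u f h
  rw [XU_Xop alpha u h1, XU_Xop alpha u h2, XU_Xop alpha u h3] at this
  simp only [map_sum, LinearMap.sum_apply, map_smul, LinearMap.smul_apply] at this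
  rw [← this, ← Finset.sum_add_distrib, ← Finset.sum_sub_distrib]
  refine Finset.sum_congr rfl fun i _ => ?_
  rw [smul_sub, smul_add]

theorem st_Le (hJ : IsJackFamily J) (st : SymA →ₗ[F] SymA →ₗ[F] SymA)
    (hst : ∀ l f h, eps J l (st f h) = eps J l f * eps J l h) (n : ℕ) :
    ∀ a b, a + b = n → ∀ f h, f ∈ Le F a → h ∈ Le F b → st f h ∈ Le F n := by
  induction n using Nat.strong_induction_on with
  | _ n ih =>
    intro a b hab f h hf hh
    apply Le_of_Xop alpha_ne
    intro j m hm
    have hj := j.pos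
    rw [Xop_der hJ st hst, coeff_add] at hm
    have hm' : coeff m (st (Xop alpha j f) h) ≠ 0 ∨ coeff m (st f (Xop alpha j h)) ≠ 0 := by
      by_contra hc
      push Not at hc
      exact hm (by rw [hc.1, hc.2, add_zero])
    rcases hm' with hm' | hm'
    · by_cases hja : a < j
      · rw [Xop_zero_of_gt alpha hja hf] at hm'; simp at hm'
      · have := ih (n - j) (by omega) (a - j) b (by omega) _ _ (Xop_Le alpha (by omega) hf) hh m hm'
        omega
    · by_cases hjb : b < j
      · rw [Xop_zero_of_gt alpha hjb hh] at hm'; simp at hm'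
      · have := ih (n - j) (by omega) a (b - j) (by omega) _ _ hf (Xop_Le alpha (by omega) hh) m hm'
        omega

end chi
end JP

namespace JP
open MvPolynomial

section star

theorem toExp_apply (l : JPartition) (i : ℕ+) : toExp l i = Multiset.count i l := by
  unfold toExp
  rw [Finsupp.finset_sum_apply]
  simp only [Finsupp.single_apply]
  rw [Finset.sum_ite_eq' l.toFinset i (fun j => Multiset.count j l)]
  split_ifs with h
  · rfl
  · symm; rw [Multiset.count_eq_zero]; simpa using h

theorem toExp_add (l m : JPartition) : toExp (l + m) = toExp l + toExp m := by
  ext i; simp [toExp_apply]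

theorem toExp_inj : Function.Injective toExp := by
  intro l m h
  ext i
  rw [← toExp_apply, h, toExp_apply]

theorem toExp_surj : Function.Surjective toExp := by
  intro m
  refine ⟨Multiset.toFinsupp.symm m, ?_⟩
  ext i
  rw [toExp_apply]
  simp

/-- inverse of toExp -/
def P (m : Exp) : JPartition := Function.surjInv toExp_surj m

theorem toExp_P (m : Exp) : toExp (P m) = m := Function.surjInv_eq toExp_surj m
theorem P_toExp (l : JPartition) : P (toExp l) = l := toExp_inj (toExp_P _)

theorem toExp_replicate (k : ℕ) (s : ℕ+) : toExp (Multiset.replicate k s) = Finsupp.single s k := by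
  ext i
  rw [toExp_apply, Multiset.count_replicate, Finsupp.single_apply]

theorem wg_toExp (l : JPartition) : wg (toExp l) = psize l := by
  induction l using Multiset.induction with
  | empty =>
    have : toExp 0 = 0 := by ext i; simp [toExp_apply]
    rw [this, wg_zero, psize_zero]
  | cons s l ih =>
    have : toExp (s ::ₘ l) = Finsupp.single s 1 + toExp l := by
      rw [← toExp_replicate, ← toExp_add]; rfl
    rw [this, wg_add, wg_single, ih, psize_cons]; omega

/-- dual power sums -/
def em (m : Exp) : SymA := monomial m (zg alpha m)⁻¹

theorem em_AH (m : Exp) : em m ∈ AH F 0 (wg m) := AH_monomial _ _ rfl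

theorem mono_em (m : Exp) : monomial m (1 : F) = zg alpha m • em m := by
  rw [em, smul_monomial, smul_eq_mul, mul_inv_cancel₀ (zg_ne_zero alpha_ne m)]

theorem zg_add_one (m : Exp) (N : ℕ) : zg alpha (m + Finsupp.single 1 N) * (m 1).factorial
    = zg alpha m * (alpha ^ N * (m 1 + N).factorial) := by
  induction N with
  | zero => simp
  | succ N ih =>
    rw [Finsupp.single_add, ← add_assoc, zg_add]
    simp only [Finsupp.add_apply, Finsupp.single_eq_same, ← add_assoc, Nat.factorial_succ, PNat.one_coe]
    push_cast
    linear_combination alpha * ((m 1 : F) + N + 1) * ih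

variable {J : JPartition → SymA}

theorem eps_em (hJ : IsJackFamily J) (mu l : JPartition) : eps J l (em (toExp mu)) = theta J mu l := by
  rw [eps_hom hJ l (em_AH _), wg_toExp, theta]
  by_cases h : psize mu ≤ psize l
  · rw [if_pos (by omega), if_neg (by omega)]
    have e : psize l + 0 - psize mu = psize l - psize mu := by omega
    rw [e]
    set N := psize l - psize mu with hN
    set m := toExp mu with hm
    have h1 : Yd alpha N * em m = monomial (m + Finsupp.single 1 N) ((alpha ^ N * N.factorial)⁻¹ * (zg alpha m)⁻¹) := by
      rw [Yd, em, X_pow_eq_monomial, smul_monomial, monomial_mul, add_comm, smul_eq_mul, mul_one]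
    have h2 : toExp (addOnes mu N) = m + Finsupp.single 1 N := by
      rw [addOnes, toExp_add, toExp_replicate]
    have h3 : pmult mu 1 = m 1 := by rw [hm, toExp_apply]; rfl
    rw [h1, hb_monomial_right, h2, h3]
    congr 1
    have h4 := zg_add_one m N
    have h5 : ((N + m 1).choose (m 1) : F) * (m 1).factorial * N.factorial = (m 1 + N).factorial := by
      rw [add_comm N]
      have := Nat.add_choose_mul_factorial_mul_factorial (m 1) N
      rw [← Nat.choose_symm_add] at this
      exact_mod_cast this
    have z1 := zg_ne_zero alpha_ne m
    have z2 : ((m 1).factorial : F) ≠ 0 := by exact_mod_cast Nat.factorial_ne_zero _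
    have z3 : (N.factorial : F) ≠ 0 := by exact_mod_cast Nat.factorial_ne_zero _
    have z4 : alpha ^ N ≠ 0 := pow_ne_zero _ alpha_ne
    rw [← h5] at h4
    have h6 : zg alpha (m + Finsupp.single 1 N) = zg alpha m * (alpha ^ N * (((N + m 1).choose (m 1) : F) * N.factorial)) := by
      apply mul_right_cancel₀ z2
      rw [h4]; ring
    rw [h6]
    field_simp
  · rw [if_neg (by omega), if_pos (by omega)]

variable {g : JPartition → JPartition → JPartition → F}

/-- star product -/
def st (hf : ∀ mu nu : JPartition, {pi : JPartition | g pi mu nu ≠ 0}.Finite) : SymA →ₗ[F] SymA →ₗ[F] SymA :=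
  (basisMonomials ℕ+ F).constr F fun m => (basisMonomials ℕ+ F).constr F fun m' =>
    (zg alpha m * zg alpha m') • ∑ pi ∈ (hf (P m) (P m')).toFinset, g pi (P m) (P m') • em (toExp pi)

theorem st_mono (hf : ∀ mu nu : JPartition, {pi : JPartition | g pi mu nu ≠ 0}.Finite) (m m' : Exp) :
    st hf (monomial m 1) (monomial m' 1) = (zg alpha m * zg alpha m') • ∑ pi ∈ (hf (P m) (P m')).toFinset, g pi (P m) (P m') • em (toExp pi) := by
  have h : ∀ m : Exp, monomial m (1 : F) = basisMonomials ℕ+ F m := fun m => by simp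
  rw [h m, h m', st, Module.Basis.constr_basis, Module.Basis.constr_basis]

theorem st_em (hf : ∀ mu nu : JPartition, {pi : JPartition | g pi mu nu ≠ 0}.Finite) (mu nu : JPartition) :
    st hf (em (toExp mu)) (em (toExp nu)) = ∑ pi ∈ (hf mu nu).toFinset, g pi mu nu • em (toExp pi) := by
  have h := st_mono hf (toExp mu) (toExp nu)
  simp only [mono_em, map_smul, LinearMap.smul_apply, smul_smul, P_toExp] at h
  have hz : zg alpha (toExp nu) * zg alpha (toExp mu) ≠ 0 := mul_ne_zero (zg_ne_zero alpha_ne _) (zg_ne_zero alpha_ne _)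
  rw [mul_comm (zg alpha (toExp mu))] at h
  first
    | exact smul_right_injective SymA hz h
    | (rw [mul_comm (zg alpha (toExp mu))] at h; exact smul_right_injective SymA hz h)

theorem coeff_st_em (hf : ∀ mu nu : JPartition, {pi : JPartition | g pi mu nu ≠ 0}.Finite) (mu nu pi : JPartition) :
    coeff (toExp pi) (st hf (em (toExp mu)) (em (toExp nu))) = g pi mu nu * (zg alpha (toExp pi))⁻¹ := by
  rw [st_em, coeff_sum]
  simp only [coeff_smul, em, coeff_monomial, smul_eq_mul]
  rw [Finset.sum_eq_single pi]
  · simp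
  · intro b _ hb
    rw [if_neg (fun h => hb (toExp_inj h)), mul_zero]
  · intro h
    have : g pi mu nu = 0 := by simpa using h
    rw [this, zero_mul]

theorem st_eps (hJ : IsJackFamily J) (hg : IsStructCoeffs J g) (l : JPartition) (f h : SymA) :
    eps J l (st hg.1 f h) = eps J l f * eps J l h := by
  have key : ∀ m m', eps J l (st hg.1 (monomial m 1) (monomial m' 1)) = eps J l (monomial m 1) * eps J l (monomial m' 1) := by
    intro m m'
    obtain ⟨mu, rfl⟩ := toExp_surj m
    obtain ⟨nu, rfl⟩ := toExp_surj m'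
    have h1 : eps J l (st hg.1 (em (toExp mu)) (em (toExp nu))) = eps J l (em (toExp mu)) * eps J l (em (toExp nu)) := by
      rw [st_em, map_sum, eps_em hJ, eps_em hJ, hg.2 mu nu l,
        finsum_eq_sum_of_support_subset (s := (hg.1 mu nu).toFinset)]
      · refine Finset.sum_congr rfl fun pi _ => ?_
        rw [map_smul, eps_em hJ, smul_eq_mul]
      · intro pi hpi
        simp only [Function.mem_support] at hpi
        simpa using left_ne_zero_of_mul hpi
    simp only [mono_em, map_smul, LinearMap.smul_apply, h1, smul_eq_mul]
    ring
  have k2 : ∀ m h, eps J l (st hg.1 (monomial m 1) h) = eps J l (monomial m 1) * eps J l h := by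
    intro m h
    have : eps J l ∘ₗ st hg.1 (monomial m 1) = eps J l (monomial m 1) • eps J l := lin_ext fun m' => key m m'
    exact LinearMap.congr_fun this h
  have : eps J l ∘ₗ (st hg.1).flip h = eps J l h • eps J l := lin_ext fun m => by
    simp only [LinearMap.comp_apply, LinearMap.flip_apply, LinearMap.smul_apply, k2, smul_eq_mul]; ring
  have := LinearMap.congr_fun this f
  simp only [LinearMap.comp_apply, LinearMap.flip_apply, LinearMap.smul_apply, smul_eq_mul] at this
  rw [this, mul_comm]

end star
end JP

namespace JP
open MvPolynomial

section conn

/-- locally finite sum of linear maps -/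
def lsumf {ι : Type*} (φ : ι → PY →ₗ[F] PY) (h : ∀ f, {i | φ i f ≠ 0}.Finite) : PY →ₗ[F] PY where
  toFun f := ∑ᶠ i, φ i f
  map_add' f g := by
    simp only [map_add]
    exact finsum_add_distrib (h f) (h g)
  map_smul' c f := by
    simp only [map_smul, RingHom.id_apply]
    exact (smul_finsum' c (h f)).symm

theorem finV {ι : Type*} (c : ι → ℕ+ ⊕ ℕ) (hc : Function.Injective c) (f : PY) :
    {i | pderiv (c i) f ≠ 0}.Finite := by
  refine (f.vars.finite_toSet.preimage hc.injOn).subset fun i hi => ?_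
  by_contra h
  exact hi (pderiv_eq_zero_of_notMem_vars h)

def pdL (v : ℕ+ ⊕ ℕ) : PY →ₗ[F] PY := (pderiv v : Derivation F PY PY).toLinearMap
theorem pdL_apply (v : ℕ+ ⊕ ℕ) (f : PY) : pdL v f = pderiv v f := rfl
def mL (f : PY) : PY →ₗ[F] PY := LinearMap.mulLeft F f

def YpL : PY →ₗ[F] PY := lsumf (fun j : ℕ => mL (yv (j + 1)) ∘ₗ pdL (Sum.inr j)) fun f => by
  refine (finV (fun j : ℕ => Sum.inr j) Sum.inr_injective f).subset fun j hj h => hj ?_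
  simp [pdL_apply, h]

theorem YpL_eq (f : PY) : Yplus f = YpL f := rfl

theorem inr_pnat_inj : Function.Injective (fun i : ℕ+ => (Sum.inr (i : ℕ) : ℕ+ ⊕ ℕ)) :=
  Sum.inr_injective.comp PNat.coe_injective

theorem inr_sub_inj : Function.Injective (fun i : ℕ+ => (Sum.inr ((i : ℕ) - 1) : ℕ+ ⊕ ℕ)) := by
  intro a b h
  have h1 := Sum.inr_injective h
  apply PNat.coe_injective
  have := a.pos; have := b.pos
  omega

theorem inr_add_sub_inj (i : ℕ+) : Function.Injective (fun j : ℕ+ => (Sum.inr ((i : ℕ) + (j : ℕ) - 1) : ℕ+ ⊕ ℕ)) := by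
  intro a b h
  have h1 := Sum.inr_injective h
  apply PNat.coe_injective
  have := a.pos; have := b.pos
  omega

def ThL : PY →ₗ[F] PY := lsumf (fun i : ℕ+ => mL (pv i) ∘ₗ pdL (Sum.inr (i : ℕ))) fun f => by
  refine (finV _ inr_pnat_inj f).subset fun j hj h => hj ?_
  simp [pdL_apply, h]

theorem ThL_eq (f : PY) : ThetaY f = ThL f := rfl

def G1i (i : ℕ+) : PY →ₗ[F] PY := lsumf (fun j : ℕ+ => ((j : ℕ) : F) • (mL (yv ((i : ℕ) + (j : ℕ))) ∘ₗ pdL (Sum.inl j) ∘ₗ pdL (Sum.inr ((i : ℕ) - 1)))) fun f => by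
  refine (finV (fun j : ℕ+ => Sum.inl j) Sum.inl_injective (pderiv (Sum.inr ((i : ℕ) - 1)) f)).subset fun j hj h => hj ?_
  simp [pdL_apply, h]

theorem G1i_zero (i : ℕ+) (f : PY) (h : pderiv (Sum.inr ((i : ℕ) - 1)) f = 0) : G1i i f = 0 := by
  simp only [G1i, lsumf, LinearMap.coe_mk, AddHom.coe_mk, LinearMap.smul_apply, LinearMap.comp_apply, pdL_apply, h, map_zero, smul_zero, finsum_zero]

def G1 : PY →ₗ[F] PY := lsumf G1i fun f =>
  (finV _ inr_sub_inj f).subset fun i hi h => hi (G1i_zero i f h)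

def G2i (i : ℕ+) : PY →ₗ[F] PY := lsumf (fun j : ℕ+ => mL (yv (i : ℕ) * pv j) ∘ₗ pdL (Sum.inr ((i : ℕ) + (j : ℕ) - 1))) fun f => by
  refine (finV _ (inr_add_sub_inj i) f).subset fun j hj h => hj ?_
  simp [pdL_apply, h]

def G2 : PY →ₗ[F] PY := lsumf G2i fun f => by
  obtain ⟨N, hN⟩ := (finV (fun j : ℕ => Sum.inr j) Sum.inr_injective f).bddAbove
  refine (Set.finite_Iic (Nat.succPNat N)).subset fun i hi => ?_
  by_contra h
  have h' : N + 1 < i := by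
    have : ¬ (i ≤ Nat.succPNat N) := h
    rw [← PNat.coe_le_coe] at this
    simpa using this
  apply hi
  have h2 : ∀ j : ℕ+, pderiv (Sum.inr ((i : ℕ) + (j : ℕ) - 1)) f = 0 := by
    intro j
    by_contra h3
    have := hN h3
    have := j.pos
    omega
  simp only [G2i, lsumf, LinearMap.coe_mk, AddHom.coe_mk, LinearMap.smul_apply, LinearMap.comp_apply, pdL_apply, h2, map_zero, smul_zero, finsum_zero]

def G3 : PY →ₗ[F] PY := lsumf (fun i : ℕ+ => ((i : ℕ) : F) • (mL (yv ((i : ℕ) + 1)) ∘ₗ pdL (Sum.inr (i : ℕ)))) fun f => by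
  refine (finV _ inr_pnat_inj f).subset fun j hj h => hj ?_
  simp [pdL_apply, h]

def GamL : PY →ₗ[F] PY := alpha • G1 + G2 + (alpha - 1) • G3

theorem GamL_eq (f : PY) : GammaY f = GamL f := rfl

theorem vext {M : Type*} [AddCommMonoid M] [Module F M] {A B : VV F →ₗ[F] M}
    (h : ∀ i f, A (Polynomial.monomial i f) = B (Polynomial.monomial i f)) : A = B := by
  refine LinearMap.ext fun v => ?_
  induction v using Polynomial.induction_on' with
  | add p q hp hq => rw [map_add, map_add, hp, hq]
  | monomial i f => exact h i f

/-- embedding `f X^i ↦ y_i f` -/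
def io : VV F →ₗ[F] PY := Polynomial.lsum fun i => mL (yv i) ∘ₗ (rename Sum.inl : SymA →ₐ[F] PY).toLinearMap

theorem io_monomial (i : ℕ) (f : SymA) : io (Polynomial.monomial i f) = yv i * rename Sum.inl f := by
  simp [io, mL]

theorem pd_inr_ren (i : ℕ) (f : SymA) : pderiv (Sum.inr i) (rename Sum.inl f : PY) = 0 := by
  apply pderiv_eq_zero_of_notMem_vars
  intro h
  have := vars_rename (Sum.inl : ℕ+ → ℕ+ ⊕ ℕ) f h
  simp at this

theorem pd_inr (i j : ℕ) (f : SymA) : pderiv (Sum.inr j) (yv i * rename Sum.inl f : PY) = if i = j then rename Sum.inl f else 0 := by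
  rw [Derivation.leibniz, pd_inr_ren, smul_zero, zero_add, yv, pderiv_X]
  by_cases h : i = j
  · subst h; simp
  · simp [h, Pi.single_apply, Ne.symm h]

theorem pd_inl (j : ℕ+) (f : SymA) : pderiv (Sum.inl j) (rename Sum.inl f : PY) = rename Sum.inl (pderiv j f) :=
  pderiv_rename Sum.inl_injective j f

theorem Yp_mono (i : ℕ) (f : SymA) : YpL (yv i * rename Sum.inl f) = yv (i + 1) * rename Sum.inl f := by
  show ∑ᶠ j : ℕ, yv (j + 1) * pderiv (Sum.inr j) (yv i * rename Sum.inl f : PY) = _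
  simp only [pd_inr]
  rw [finsum_eq_single _ i]
  · simp
  · intro j hj; simp [Ne.symm hj]

theorem io_mX (v : VV F) : YpL (io v) = io (mX v) := by
  have : YpL ∘ₗ io = io ∘ₗ mX := by
    apply vext
    intro i f
    simp only [LinearMap.comp_apply]
    show YpL (io (Polynomial.monomial i f)) = io (mX (Polynomial.monomial i f))
    have e : mX (Polynomial.monomial i f) = Polynomial.monomial (i + 1) f := by
      simp [mX, Polynomial.X_mul_monomial]
    rw [e, io_monomial, io_monomial, Yp_mono]
  exact LinearMap.congr_fun this v

theorem dl_sum (f : SymA) : dl alpha f = ∑ j ∈ f.vars, Polynomial.monomial (j : ℕ) ((alpha * (j : ℕ)) • pderiv j f) := by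
  ext1 n
  rw [Polynomial.finsetSum_coeff]
  simp only [Polynomial.coeff_monomial]
  by_cases hn : n = 0
  · subst hn
    rw [dl_coeff_zero, Finset.sum_eq_zero]
    intro j _; rw [if_neg j.ne_zero]
  · obtain ⟨j, rfl⟩ : ∃ j : ℕ+, (j : ℕ) = n := ⟨⟨n, Nat.pos_of_ne_zero hn⟩, rfl⟩
    rw [dl_coeff, Finset.sum_eq_single j]
    · simp
    · intro b _ hb
      rw [if_neg fun h => hb (PNat.coe_injective h)]
    · intro h
      rw [if_pos rfl, pderiv_eq_zero_of_notMem_vars h, smul_zero]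

theorem G1_mono (i : ℕ) (f : SymA) : alpha • G1 (yv i * rename Sum.inl f) = io (Polynomial.X ^ (i + 1) * dl alpha f) := by
  have h1 : G1 (yv i * rename Sum.inl f) = G1i (Nat.succPNat i) (yv i * rename Sum.inl f) := by
    show ∑ᶠ k : ℕ+, G1i k (yv i * rename Sum.inl f) = _
    apply finsum_eq_single
    intro k hk
    apply G1i_zero
    rw [pd_inr, if_neg]
    rintro rfl
    apply hk
    apply PNat.coe_injective
    have := k.pos
    simp; omega
  rw [h1]
  have h2 : G1i (Nat.succPNat i) (yv i * rename Sum.inl f) = ∑ j ∈ f.vars, ((j : ℕ) : F) • (yv (i + 1 + j) * rename Sum.inl (pderiv j f)) := by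
    show ∑ᶠ j : ℕ+, ((j : ℕ) : F) • (yv ((Nat.succPNat i : ℕ) + (j : ℕ)) * pderiv (Sum.inl j) (pderiv (Sum.inr ((Nat.succPNat i : ℕ) - 1)) (yv i * rename Sum.inl f : PY))) = _
    simp only [pd_inr, Nat.succPNat_coe, Nat.succ_sub_one, if_true, pd_inl, Nat.succ_eq_add_one, Nat.add_sub_cancel]
    apply finsum_eq_sum_of_support_subset
    intro j hj
    by_contra h
    apply hj
    beta_reduce
    rw [pderiv_eq_zero_of_notMem_vars (by simpa using h)]
    simp
  rw [h2, dl_sum, Finset.mul_sum, map_sum, Finset.smul_sum]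
  refine Finset.sum_congr rfl fun j _ => ?_
  rw [Polynomial.X_pow_mul_monomial, io_monomial, map_smul, smul_smul, mul_smul_comm, add_comm (j : ℕ)]

theorem G2_mono (i : ℕ) (f : SymA) : G2 (yv i * rename Sum.inl f) =
    ∑ k ∈ Finset.range i, yv (k + 1) * pv (Nat.succPNat (i - 1 - k)) * rename Sum.inl f := by
  have h1 : ∀ k : ℕ+, G2i k (yv i * rename Sum.inl f) = if (k : ℕ) ≤ i then yv k * pv (Nat.succPNat (i - k)) * rename Sum.inl f else 0 := by
    intro k
    have hk := k.pos
    show ∑ᶠ j : ℕ+, yv (k : ℕ) * pv j * pderiv (Sum.inr ((k : ℕ) + (j : ℕ) - 1)) (yv i * rename Sum.inl f : PY) = _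
    simp only [pd_inr]
    split_ifs with h
    · rw [finsum_eq_single _ (Nat.succPNat (i - k))]
      · rw [if_pos]
        simp; omega
      · intro j hj
        rw [if_neg, mul_zero]
        intro h'
        apply hj
        apply PNat.coe_injective
        have := j.pos
        simp; omega
    · refine (finsum_congr fun j : ℕ+ => ?_).trans finsum_zero
      have := j.pos
      rw [if_neg (by omega), mul_zero]
  show ∑ᶠ k : ℕ+, G2i k (yv i * rename Sum.inl f) = _
  simp only [h1]
  rw [finsum_eq_sum_of_support_subset (s := (Finset.range i).image Nat.succPNat)]
  · rw [Finset.sum_image (fun a _ b _ h => Nat.succPNat_injective h)]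
    refine Finset.sum_congr rfl fun k hk => ?_
    have hk' : k < i := by simpa using hk
    rw [if_pos (by simp; omega)]
    have e : i - (Nat.succPNat k : ℕ) = i - 1 - k := by simp; omega
    rw [e]; rfl
  · intro k hk
    simp only [Function.mem_support, ne_eq, ite_eq_right_iff, not_forall] at hk
    obtain ⟨hk, _⟩ := hk
    have := k.pos
    simp only [Finset.coe_image, Set.mem_image, Finset.coe_range, Set.mem_Iio]
    refine ⟨(k : ℕ) - 1, by omega, ?_⟩
    apply PNat.coe_injective; simp; omega

theorem G3_mono (i : ℕ) (f : SymA) : G3 (yv i * rename Sum.inl f) = (i : F) • (yv (i + 1) * rename Sum.inl f) := by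
  show ∑ᶠ k : ℕ+, ((k : ℕ) : F) • (yv ((k : ℕ) + 1) * pderiv (Sum.inr (k : ℕ)) (yv i * rename Sum.inl f : PY)) = _
  simp only [pd_inr]
  by_cases hi : i = 0
  · subst hi
    rw [Nat.cast_zero, zero_smul]
    refine (finsum_congr fun j : ℕ+ => ?_).trans finsum_zero
    rw [if_neg j.ne_zero.symm, mul_zero, smul_zero]
  · obtain ⟨j, rfl⟩ : ∃ j : ℕ+, (j : ℕ) = i := ⟨⟨i, Nat.pos_of_ne_zero hi⟩, rfl⟩
    rw [finsum_eq_single _ j]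
    · simp
    · intro b hb
      rw [if_neg (fun h => hb (PNat.coe_injective h.symm)), mul_zero, smul_zero]

theorem io_G (v : VV F) : GamL (io v) = io ((mX ∘ₗ Lop alpha) v) := by
  have : GamL ∘ₗ io = io ∘ₗ mX ∘ₗ Lop alpha := by
    apply vext
    intro i f
    simp only [LinearMap.comp_apply]
    show GamL (io (Polynomial.monomial i f)) = io (mX (Lop alpha (Polynomial.monomial i f)))
    have e : ∀ x, GamL x = alpha • G1 x + G2 x + (alpha-1) • G3 x := fun _ => rfl
    rw [io_monomial, Lop_monomial, e, G1_mono, G2_mono, G3_mono]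
    rw [map_add, map_add, map_add, map_add]
    refine congrArg₂ (· + ·) (congrArg₂ (· + ·) ?_ ?_) ?_
    · rw [mX, LinearMap.mulLeft_apply, ← mul_assoc, ← pow_succ']
    · rw [map_sum, map_sum, ← Finset.sum_range_reflect]
      refine Finset.sum_congr rfl fun k hk => ?_
      have hk' : k < i := by simpa using hk
      have e : i - 1 - (i - 1 - k) = k := by omega
      rw [mX, LinearMap.mulLeft_apply, Polynomial.X_mul_monomial, io_monomial, map_mul, rename_X, e, mul_assoc]; rfl
    · rw [mX, LinearMap.mulLeft_apply, Polynomial.X_mul_monomial, io_monomial, map_smul, smul_smul, mul_smul_comm]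
  exact LinearMap.congr_fun this v

theorem drop_Th (v : VV F) : dropY (ThL (io v)) = Th v := by
  have hd : ∀ f : SymA, dropY (rename Sum.inl f) = f := by
    intro f
    have : dropY.comp (rename Sum.inl) = AlgHom.id F SymA := by
      apply MvPolynomial.algHom_ext
      intro i
      simp [dropY]
    exact congrArg (fun φ : SymA →ₐ[F] SymA => φ f) this
  have : dropY.toLinearMap ∘ₗ ThL ∘ₗ io = Th := by
    apply vext
    intro i f
    simp only [LinearMap.comp_apply]
    show dropY (ThL (io (Polynomial.monomial i f))) = Th (Polynomial.monomial i f)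
    rw [io_monomial]
    have h1 : ThL (yv i * rename Sum.inl f) = ∑ᶠ k : ℕ+, pv k * pderiv (Sum.inr (k : ℕ)) (yv i * rename Sum.inl f : PY) := rfl
    rw [h1]
    simp only [pd_inr]
    by_cases hi : i = 0
    · subst hi
      rw [Th_monomial_zero]
      have : (fun k : ℕ+ => pv k * (if 0 = (k : ℕ) then (rename Sum.inl f : PY) else 0)) = fun _ => 0 := by
        funext j
        rw [if_neg j.ne_zero.symm, mul_zero]
      rw [this, finsum_zero, map_zero]
    · obtain ⟨j, rfl⟩ : ∃ j : ℕ+, (j : ℕ) = i := ⟨⟨i, Nat.pos_of_ne_zero hi⟩, rfl⟩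
      rw [finsum_eq_single _ j]
      · rw [if_pos rfl, map_mul, hd, Th_monomial]
        simp [pv, dropY]
      · intro b hb
        rw [if_neg (fun h => hb (PNat.coe_injective h.symm)), mul_zero]
  exact LinearMap.congr_fun this v

end conn

section words
variable {R : Type*} [Ring R]
def wl (a b : R) : List Bool → R
  | [] => 1
  | x :: w => (if x then b else a) * wl a b w

theorem wl_sum (a b : R) (n ℓ : ℕ) :
    ∑ s ∈ Finset.univ.filter (fun s : Fin n → Bool => (Finset.univ.filter fun i => s i = true).card = ℓ), wl a b (List.ofFn s)
      = cf a b n ℓ := by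
  induction n generalizing ℓ with
  | zero => 
    rw [cf_zero, Finset.sum_filter, Fintype.sum_unique]
    by_cases h : ℓ = 0
    · subst h; simp [wl]
    · have h' : ¬ (0 = ℓ) := fun e => h e.symm
      simp [h, h']
  | succ n ih =>
    have hc : ∀ (x : Bool) (s : Fin n → Bool), (Finset.univ.filter fun i => (Fin.cons x s : Fin (n+1) → Bool) i = true).card
        = (if x = true then 1 else 0) + (Finset.univ.filter fun i => s i = true).card := by
      intro x s
      rw [Fin.card_filter_univ_succ]
      simp only [Fin.cons_zero, Fin.cons_succ]
      split_ifs <;> omega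
    have hw : ∀ (x : Bool) (s : Fin n → Bool), wl a b (List.ofFn (Fin.cons x s : Fin (n+1) → Bool)) = (if x then b else a) * wl a b (List.ofFn s) := by
      intro x s
      rw [List.ofFn_cons, wl]
    rw [Finset.sum_filter, ← (Fin.consEquiv (fun _ => Bool)).sum_comp, Fintype.sum_prod_type, Fintype.sum_bool]
    have h1 : ∀ (x : Bool) (s : Fin n → Bool), (Fin.consEquiv (fun _ => Bool)) (x, s) = (Fin.cons x s : Fin (n+1) → Bool) := fun _ _ => rfl
    simp only [h1, hc, hw]
    cases ℓ with
    | zero =>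
      rw [cf_succ_zero, ← ih, Finset.sum_filter, Finset.mul_sum, Finset.sum_eq_zero, zero_add]
      · refine Finset.sum_congr rfl fun s _ => ?_
        by_cases h : (Finset.univ.filter fun i => s i = true).card = 0
        · rw [if_pos h, if_pos (by rw [h]; rfl)]; rfl
        · rw [if_neg h, if_neg (by simpa using h), mul_zero]
      · intro s _
        rw [if_neg]
        simp only [if_true]; omega
    | succ ℓ =>
      rw [cf_succ_succ, ← ih, ← ih, Finset.sum_filter, Finset.sum_filter, Finset.mul_sum, Finset.mul_sum, add_comm]
      congr 1
      · refine Finset.sum_congr rfl fun s _ => ?_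
        rw [mul_ite, mul_zero, if_neg Bool.false_ne_true, zero_add]; rfl
      · refine Finset.sum_congr rfl fun s _ => ?_
        rw [mul_ite, mul_zero]
        simp only [if_true]
        rw [add_comm 1]
        simp only [Nat.add_right_cancel_iff]
end words

section conn2

theorem word_io (w : List Bool) (v : VV F) : wordOp w (io v) = io (wl (R := Module.End F (VV F)) (mX ∘ₗ Lop alpha) mX w v) := by
  induction w with
  | nil => rfl
  | cons x w ih =>
    rw [wordOp, ih, wl]
    cases x with
    | true => exact (YpL_eq _).trans (io_mX _)
    | false => exact (GamL_eq _).trans (io_G _)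

theorem Bc_eq (n ℓ : ℕ) (f : SymA) : Bc n ℓ f = Bo alpha n ℓ f := by
  have h : alpha⁻¹ • (yv 0 * rename Sum.inl f) = io (alpha⁻¹ • Cl f) := by
    rw [map_smul]
    congr 1
    exact (io_monomial 0 f).symm
  rw [Bc, h]
  simp only [word_io]
  rw [← map_sum, ThL_eq, drop_Th, ← LinearMap.sum_apply, wl_sum]
  simp only [Bo, LinearMap.smul_apply, LinearMap.comp_apply, map_smul]

theorem Bmat_eq (n ℓ : ℕ) (m m' : Exp) : coeff m' (bdc alpha n ℓ (em m)) = Bmat n ℓ m m' * (zg alpha m')⁻¹ := by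
  have h := hb_Bo alpha n ℓ (monomial m' 1) (em m)
  rw [em, hb_monomial_right, hb_monomial, inv_mul_cancel₀ (zg_ne_zero alpha_ne m), one_mul, one_mul] at h
  rw [Bmat, Bc_eq, h, em, mul_comm, ← mul_assoc, inv_mul_cancel₀ (zg_ne_zero alpha_ne m'), one_mul]

end conn2
end JP

namespace JP
open MvPolynomial

section final

/-- dual coordinate of `em`. -/
def Ed (pi : JPartition) : SymA →ₗ[F] F := zg alpha (toExp pi) • lcoeff F (toExp pi)

theorem Ed_apply (pi : JPartition) (f : SymA) : Ed pi f = zg alpha (toExp pi) * coeff (toExp pi) f := rfl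

theorem Ed_fin (f : SymA) : {pi : JPartition | Ed pi f ≠ 0}.Finite := by
  refine Set.Finite.subset (f.support.finite_toSet.preimage toExp_inj.injOn) ?_
  intro pi hpi
  have : coeff (toExp pi) f ≠ 0 := by
    intro h
    apply hpi
    rw [Ed_apply, h, mul_zero]
  simpa using this

theorem Ed_exp (φ : SymA →ₗ[F] F) (f : SymA) : φ f = ∑ᶠ pi : JPartition, Ed pi f * φ (em (toExp pi)) := by
  have h1 : φ f = ∑ m ∈ f.support, Ed (P m) f * φ (em m) := by
    conv_lhs => rw [as_sum_smul f]
    rw [map_sum]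
    refine Finset.sum_congr rfl fun m _ => ?_
    rw [mono_em, map_smul, map_smul, smul_eq_mul, smul_eq_mul, Ed_apply, toExp_P]
    ring
  rw [h1, finsum_eq_sum_of_support_subset _ (s := f.support.image P)]
  · rw [Finset.sum_image]
    · simp only [toExp_P]
    · intro a _ b _ h
      rw [← toExp_P a, ← toExp_P b, h]
  · intro pi hpi
    have : coeff (toExp pi) f ≠ 0 := by
      intro h
      apply hpi
      show Ed pi f * _ = 0
      rw [Ed_apply, h, mul_zero, zero_mul]
    rw [Finset.coe_image]
    exact ⟨toExp pi, by simpa using this, P_toExp pi⟩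

theorem Ed_bdc (n ℓ : ℕ) (mu pi : JPartition) : Ed pi (bdc alpha n ℓ (em (toExp mu))) = Bmat n ℓ (toExp mu) (toExp pi) := by
  rw [Ed_apply, Bmat_eq, mul_comm, mul_assoc, inv_mul_cancel₀ (zg_ne_zero alpha_ne _), mul_one]

theorem Bmat_size {n ℓ : ℕ} {mu pi : JPartition} (h : Bmat n ℓ (toExp mu) (toExp pi) ≠ 0) : psize pi + n = psize mu := by
  rw [← Ed_bdc, Ed_apply] at h
  have h2 := bdc_low alpha n ℓ 0 _ _ (em_AH (toExp mu)) (toExp pi) (right_ne_zero_of_mul h)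
  rw [wg_toExp, wg_toExp] at h2
  omega

theorem Bmat_fin (n ℓ : ℕ) (mu : JPartition) : {pi : JPartition | Bmat n ℓ (toExp mu) (toExp pi) ≠ 0}.Finite := by
  simp only [← Ed_bdc]
  exact Ed_fin _

variable {J : JPartition → SymA} {g : JPartition → JPartition → JPartition → F}

theorem Ed_st (hf : ∀ mu nu : JPartition, {pi : JPartition | g pi mu nu ≠ 0}.Finite) (mu nu pi : JPartition) :
    Ed pi (st hf (em (toExp mu)) (em (toExp nu))) = g pi mu nu := by
  rw [Ed_apply, coeff_st_em, mul_comm, mul_assoc, inv_mul_cancel₀ (zg_ne_zero alpha_ne _), mul_one]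

theorem em_Le (mu : JPartition) : em (toExp mu) ∈ Le F (psize mu) := by
  rw [← wg_toExp]
  exact AH_Le (by omega) (em_AH _)

theorem g_size (hJ : IsJackFamily J) (hg : IsStructCoeffs J g) {pi mu nu : JPartition} (h : g pi mu nu ≠ 0) :
    psize pi ≤ psize mu + psize nu := by
  rw [← Ed_st hg.1, Ed_apply] at h
  have := st_Le hJ (st hg.1) (st_eps hJ hg) _ _ _ rfl _ _ (em_Le mu) (em_Le nu) (toExp pi) (right_ne_zero_of_mul h)
  rwa [wg_toExp] at this

theorem Xop_range (ℓ : ℕ) {d N : ℕ} (h : d < N) {f : SymA} (hf : f ∈ Le F d) (φ : SymA →ₗ[F] F) :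
    φ (Xop alpha ℓ f) = ∑ n ∈ Finset.range N, ((-1 : F) ^ n / (n : F)) * φ (bdc alpha n ℓ f) := by
  rw [Xop_eq alpha ℓ h hf, map_sum]
  refine Finset.sum_congr rfl fun n _ => ?_
  rw [Xc, LinearMap.smul_apply, map_smul, smul_eq_mul]

theorem key (hJ : IsJackFamily J) (hg : IsStructCoeffs J g) (pi mu nu : JPartition) (ℓ k : ℕ)
    (hk : psize pi + k = psize mu + psize nu) :
    (∑ n ∈ Finset.Icc 1 k, ((-1 : F) ^ n / (n : F)) *
        ((∑ᶠ mu' : JPartition, Bmat n ℓ (toExp mu) (toExp mu') * g pi mu' nu)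
          + ∑ᶠ nu' : JPartition, Bmat n ℓ (toExp nu) (toExp nu') * g pi mu nu'))
    = ∑ n ∈ Finset.Icc 1 k, ((-1 : F) ^ n / (n : F)) *
        ∑ᶠ rho : JPartition, g rho mu nu * Bmat n ℓ (toExp rho) (toExp pi) := by
  have hd := congrArg (Ed pi) (Xop_der hJ (st hg.1) (st_eps hJ hg) ℓ (em (toExp mu)) (em (toExp nu)))
  have hN : psize mu + psize nu < psize mu + psize nu + 1 := by omega
  rw [map_add, Xop_range ℓ hN (st_Le hJ (st hg.1) (st_eps hJ hg) _ _ _ rfl _ _ (em_Le mu) (em_Le nu)) (Ed pi)] at hd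
  have e1 := Xop_range ℓ (N := psize mu + psize nu + 1) (by omega) (em_Le mu)
    (Ed pi ∘ₗ (st hg.1).flip (em (toExp nu)))
  have e2 := Xop_range ℓ (N := psize mu + psize nu + 1) (by omega) (em_Le nu)
    (Ed pi ∘ₗ (st hg.1) (em (toExp mu)))
  simp only [LinearMap.comp_apply, LinearMap.flip_apply] at e1 e2
  rw [e1, e2, ← Finset.sum_add_distrib] at hd
  have a0 : ∀ n, Ed pi (bdc alpha n ℓ (st hg.1 (em (toExp mu)) (em (toExp nu)))) =
      ∑ᶠ rho : JPartition, g rho mu nu * Bmat n ℓ (toExp rho) (toExp pi) := by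
    intro n
    have := Ed_exp (Ed pi ∘ₗ bdc alpha n ℓ) (st hg.1 (em (toExp mu)) (em (toExp nu)))
    simp only [LinearMap.comp_apply, Ed_st, Ed_bdc] at this
    exact this
  have a1 : ∀ n, Ed pi (st hg.1 (bdc alpha n ℓ (em (toExp mu))) (em (toExp nu))) =
      ∑ᶠ mu' : JPartition, Bmat n ℓ (toExp mu) (toExp mu') * g pi mu' nu := by
    intro n
    have := Ed_exp (Ed pi ∘ₗ (st hg.1).flip (em (toExp nu))) (bdc alpha n ℓ (em (toExp mu)))
    simp only [LinearMap.comp_apply, LinearMap.flip_apply, Ed_st, Ed_bdc] at this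
    exact this
  have a2 : ∀ n, Ed pi (st hg.1 (em (toExp mu)) (bdc alpha n ℓ (em (toExp nu)))) =
      ∑ᶠ nu' : JPartition, Bmat n ℓ (toExp nu) (toExp nu') * g pi mu nu' := by
    intro n
    have := Ed_exp (Ed pi ∘ₗ (st hg.1) (em (toExp mu))) (bdc alpha n ℓ (em (toExp nu)))
    simp only [LinearMap.comp_apply, Ed_st, Ed_bdc] at this
    exact this
  simp only [a0, a1, a2, ← mul_add] at hd
  have hs : Finset.Icc 1 k ⊆ Finset.range (psize mu + psize nu + 1) := by
    intro n hn
    rw [Finset.mem_Icc] at hn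
    rw [Finset.mem_range]
    omega
  rw [Finset.sum_subset hs, Finset.sum_subset hs]
  · exact hd.symm
  · intro n _ hn
    by_cases h0 : n = 0
    · subst h0; simp
    have hn' : k < n := by
      by_contra hc
      exact hn (Finset.mem_Icc.2 ⟨by omega, by omega⟩)
    rw [(finsum_congr fun rho => ?_).trans finsum_zero, mul_zero]
    by_contra hc
    have h1 := g_size hJ hg (left_ne_zero_of_mul hc)
    have h2 := Bmat_size (right_ne_zero_of_mul hc)
    omega
  · intro n _ hn
    by_cases h0 : n = 0
    · subst h0; simp
    have hn' : k < n := by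
      by_contra hc
      exact hn (Finset.mem_Icc.2 ⟨by omega, by omega⟩)
    rw [(finsum_congr fun rho => ?_).trans finsum_zero, (finsum_congr fun rho => ?_).trans finsum_zero, add_zero, mul_zero]
    · by_contra hc
      have h1 := g_size hJ hg (right_ne_zero_of_mul hc)
      have h2 := Bmat_size (left_ne_zero_of_mul hc)
      omega
    · by_contra hc
      have h1 := g_size hJ hg (right_ne_zero_of_mul hc)
      have h2 := Bmat_size (left_ne_zero_of_mul hc)
      omega

/-- `GopCoef` as a linear map. -/
def gopL (hf : ∀ mu nu : JPartition, {pi : JPartition | g pi mu nu ≠ 0}.Finite) (mu nu : JPartition) (k : ℕ) : SymA →ₗ[F] F :=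
  ∑ pi ∈ (hf mu nu).toFinset, (if psize pi + k = psize mu + psize nu then g pi mu nu else 0) • lcoeff F (toExp pi)

theorem gopL_eq (hf : ∀ mu nu : JPartition, {pi : JPartition | g pi mu nu ≠ 0}.Finite) (mu nu : JPartition) (k : ℕ) (f : SymA) :
    GopCoef g f mu nu k = gopL hf mu nu k f := by
  rw [GopCoef, finsum_eq_sum_of_support_subset _ (s := (hf mu nu).toFinset), gopL, LinearMap.sum_apply]
  · refine Finset.sum_congr rfl fun pi _ => ?_
    rw [LinearMap.smul_apply, smul_eq_mul, ite_mul, zero_mul]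
    rfl
  · intro pi hpi
    rw [Set.Finite.coe_toFinset]
    intro h
    apply hpi
    beta_reduce
    rw [h, zero_mul, ite_self]

theorem GopCoef_mono (pi mu nu : JPartition) (k : ℕ) :
    GopCoef g (monomial (toExp pi) 1) mu nu k = if psize pi + k = psize mu + psize nu then g pi mu nu else 0 := by
  rw [GopCoef, finsum_eq_single _ pi]
  · rw [coeff_monomial, if_pos rfl, mul_one]
  · intro b hb
    rw [coeff_monomial, if_neg (fun h => hb (toExp_inj h).symm), mul_zero, ite_self]

theorem main_mono (hJ : IsJackFamily J) (hg : IsStructCoeffs J g) (pi mu nu : JPartition) (ℓ k : ℕ) :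
    (∑ n ∈ Finset.Icc 1 k, ((-1 : F) ^ n / (n : F)) *
        ((∑ᶠ mu' : JPartition, Bmat n ℓ (toExp mu) (toExp mu') * GopCoef g (monomial (toExp pi) 1) mu' nu (k - n))
          + ∑ᶠ nu' : JPartition, Bmat n ℓ (toExp nu) (toExp nu') * GopCoef g (monomial (toExp pi) 1) mu nu' (k - n)))
    = ∑ n ∈ Finset.Icc 1 k, ((-1 : F) ^ n / (n : F)) *
        GopCoef g (Bc n ℓ (monomial (toExp pi) 1)) mu nu (k - n) := by
  simp only [GopCoef_mono]
  have hR : ∀ n, GopCoef g (Bc n ℓ (monomial (toExp pi) 1)) mu nu (k - n) =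
      ∑ᶠ rho : JPartition, if psize rho + (k - n) = psize mu + psize nu then g rho mu nu * Bmat n ℓ (toExp rho) (toExp pi) else 0 := fun _ => rfl
  simp only [hR]
  by_cases hk : psize pi + k = psize mu + psize nu
  · refine Eq.trans (Finset.sum_congr rfl fun n hn => ?_) ((key hJ hg pi mu nu ℓ k hk).trans (Finset.sum_congr rfl fun n hn => ?_))
    · rw [Finset.mem_Icc] at hn
      congr 2
      · refine finsum_congr fun mu' => ?_
        by_cases hB : Bmat n ℓ (toExp mu) (toExp mu') = 0
        · rw [hB, zero_mul, zero_mul]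
        · have := Bmat_size hB
          rw [if_pos (by omega)]
      · refine finsum_congr fun mu' => ?_
        by_cases hB : Bmat n ℓ (toExp nu) (toExp mu') = 0
        · rw [hB, zero_mul, zero_mul]
        · have := Bmat_size hB
          rw [if_pos (by omega)]
    · rw [Finset.mem_Icc] at hn
      congr 1
      refine finsum_congr fun rho => ?_
      by_cases hB : Bmat n ℓ (toExp rho) (toExp pi) = 0
      · rw [hB, mul_zero, ite_self]
      · have := Bmat_size hB
        rw [if_pos (by omega)]
  · refine Finset.sum_congr rfl fun n hn => ?_
    rw [Finset.mem_Icc] at hn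
    congr 1
    rw [(finsum_congr fun rho => ?_).trans finsum_zero, (finsum_congr fun rho => ?_).trans finsum_zero,
      (finsum_congr fun rho => ?_).trans finsum_zero, add_zero]
    · by_cases hB : Bmat n ℓ (toExp rho) (toExp pi) = 0
      · rw [hB, mul_zero, ite_self]
      · have := Bmat_size hB
        rw [if_neg (by omega)]
    · by_cases hB : Bmat n ℓ (toExp nu) (toExp rho) = 0
      · rw [hB, zero_mul]
      · have := Bmat_size hB
        rw [if_neg (by omega), mul_zero]
    · by_cases hB : Bmat n ℓ (toExp mu) (toExp rho) = 0
      · rw [hB, zero_mul]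
      · have := Bmat_size hB
        rw [if_neg (by omega), mul_zero]

theorem main (hJ : IsJackFamily J) (hg : IsStructCoeffs J g) (f : SymA) (mu nu : JPartition) (ℓ k : ℕ) :
    (∑ n ∈ Finset.Icc 1 k, ((-1 : F) ^ n / (n : F)) *
        ((∑ᶠ mu' : JPartition, Bmat n ℓ (toExp mu) (toExp mu') * GopCoef g f mu' nu (k - n))
          + ∑ᶠ nu' : JPartition, Bmat n ℓ (toExp nu) (toExp nu') * GopCoef g f mu nu' (k - n)))
    = ∑ n ∈ Finset.Icc 1 k, ((-1 : F) ^ n / (n : F)) *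
        GopCoef g (Bc n ℓ f) mu nu (k - n) := by
  obtain ⟨A, s1⟩ : ∃ A : ℕ → SymA →ₗ[F] F, ∀ f n, (∑ᶠ mu' : JPartition, Bmat n ℓ (toExp mu) (toExp mu') * GopCoef g f mu' nu (k - n))
      = A n f := by
    refine ⟨fun n => ∑ mu' ∈ (Bmat_fin n ℓ mu).toFinset, Bmat n ℓ (toExp mu) (toExp mu') • gopL hg.1 mu' nu (k - n), ?_⟩
    intro f n
    rw [finsum_eq_sum_of_support_subset _ (s := (Bmat_fin n ℓ mu).toFinset), LinearMap.sum_apply]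
    · refine Finset.sum_congr rfl fun mu' _ => ?_
      rw [gopL_eq hg.1, LinearMap.smul_apply, smul_eq_mul]
    · intro mu' h
      rw [Set.Finite.coe_toFinset]
      exact left_ne_zero_of_mul h
  obtain ⟨B, s2⟩ : ∃ B : ℕ → SymA →ₗ[F] F, ∀ f n, (∑ᶠ nu' : JPartition, Bmat n ℓ (toExp nu) (toExp nu') * GopCoef g f mu nu' (k - n))
      = B n f := by
    refine ⟨fun n => ∑ nu' ∈ (Bmat_fin n ℓ nu).toFinset, Bmat n ℓ (toExp nu) (toExp nu') • gopL hg.1 mu nu' (k - n), ?_⟩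
    intro f n
    rw [finsum_eq_sum_of_support_subset _ (s := (Bmat_fin n ℓ nu).toFinset), LinearMap.sum_apply]
    · refine Finset.sum_congr rfl fun mu' _ => ?_
      rw [gopL_eq hg.1, LinearMap.smul_apply, smul_eq_mul]
    · intro mu' h
      rw [Set.Finite.coe_toFinset]
      exact left_ne_zero_of_mul h
  have hm := fun pi => main_mono hJ hg pi mu nu ℓ k
  simp only [s1, s2] at hm ⊢
  simp only [Bc_eq, gopL_eq hg.1] at hm ⊢
  have hl : ∀ f, ∑ n ∈ Finset.Icc 1 k, ((-1 : F) ^ n / (n : F)) * (A n f + B n f)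
      = (∑ n ∈ Finset.Icc 1 k, ((-1 : F) ^ n / (n : F)) • (A n + B n)) f := by
    intro f
    rw [LinearMap.sum_apply]
    rfl
  have hr : ∀ f, ∑ n ∈ Finset.Icc 1 k, ((-1 : F) ^ n / (n : F)) * (gopL hg.1 mu nu (k - n) (Bo alpha n ℓ f))
      = (∑ n ∈ Finset.Icc 1 k, ((-1 : F) ^ n / (n : F)) • (gopL hg.1 mu nu (k - n) ∘ₗ Bo alpha n ℓ)) f := by
    intro f
    rw [LinearMap.sum_apply]
    rfl
  have hm' : ∀ pi : JPartition, ∑ n ∈ Finset.Icc 1 k, ((-1 : F) ^ n / (n : F)) * (A n (monomial (toExp pi) 1) + B n (monomial (toExp pi) 1)) = _ := hm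
  refine (hl f).trans (Eq.trans ?_ (hr f).symm)
  have : ∀ pi : JPartition, _ = _ := fun pi => (hl _).symm.trans ((hm' pi).trans (hr _))
  rw [as_sum_smul f, map_sum, map_sum]
  refine Finset.sum_congr rfl fun m _ => ?_
  rw [map_smul, map_smul]
  have h := this (P m)
  rw [toExp_P] at h
  rw [h]

end final
end JP

/-- **Theorem 1.9.** The commutation relation
`(B_∞^{(α)}(-t,q,u) + B_∞^{(α)}(-t,r,u)) ⬝ 𝒢^{(α)}(t,p,q,r)
   = 𝒢^{(α)}(t,p,q,r) ⬝ B_∞^{(α)}(-t,p,u)`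
as an identity of linear operators `ℚ(α)[p] → ℚ(α)[q,r]⟦t,u⟧`, stated coefficientwise:
for every argument `f ∈ ℚ(α)[p]`, every `μ, ν` (exponents of `q, r`), every `ℓ`
(exponent of `u`) and every `k` (exponent of `t`), the coefficients in `ℚ(α)` agree. -/
theorem statement1
    (J : JPartition → SymA) (hJ : IsJackFamily J)
    (g : JPartition → JPartition → JPartition → F) (hg : IsStructCoeffs J g)
    (f : SymA) (mu nu : JPartition) (ℓ k : ℕ) :
    (∑ n ∈ Finset.Icc 1 k, ((-1 : F) ^ n / (n : F)) *
        ((∑ᶠ mu' : JPartition, Bmat n ℓ (toExp mu) (toExp mu') * GopCoef g f mu' nu (k - n))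
          + ∑ᶠ nu' : JPartition, Bmat n ℓ (toExp nu) (toExp nu') * GopCoef g f mu nu' (k - n)))
    = ∑ n ∈ Finset.Icc 1 k, ((-1 : F) ^ n / (n : F)) *
        GopCoef g (Bc n ℓ f) mu nu (k - n) := by
  exact JP.main hJ hg f mu nu ℓ k

end
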